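/- arXiv:1509.05822 — 6 statements merged into one kernel-verified Lean document; each statement's English description precedes it below -/
import Mathlib

section
/- Let d ≥ 3 be an integer and let a ≥ -((d-2)/2)² be real. Set σ := (d-2)/2 - √(((d-2)/2)² + a). Then for every f ∈ C_c^∞(ℝ^d \ {0}; ℂ) one has the factorization identity ∫_{ℝ^d} (|∇f(x)|² + (a/|x|²)|f(x)|²) dx = ∫_{ℝ^d} |∇f(x) + σ (x/|x|²) f(x)|² dx. In particular, the quadratic form Q_a(f) := ∫_{ℝ^d} (|∇f(x)|² + (a/|x|²)|f(x)|²) dx is nonnegative. -/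
open MeasureTheory

/-- The integral of a directional derivative of a compactly supported `C¹` function vanishes. -/
theorem integral_fderiv_apply_eq_zero {E : Type*} [NormedAddCommGroup E] [NormedSpace ℝ E]
    [MeasurableSpace E] [BorelSpace E] [FiniteDimensional ℝ E] (μ : Measure E)
    [μ.IsAddHaarMeasure] {g : E → ℝ} (hg : ContDiff ℝ 1 g) (hc : HasCompactSupport g) (v : E) :
    Integrable (fun x ↦ fderiv ℝ g x v) μ ∧ ∫ x, fderiv ℝ g x v ∂μ = 0 := by
  have hint : Integrable (fun x ↦ fderiv ℝ g x v) μ :=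
    ((hg.continuous_fderiv one_ne_zero).clm_apply continuous_const).integrable_of_hasCompactSupport
      (hc.fderiv_apply ℝ v)
  refine ⟨hint, ?_⟩
  have key := integral_mul_fderiv_eq_neg_fderiv_mul_of_integrable (μ := μ) (f := fun _ : E ↦ (1 : ℝ))
    (g := g) (v := v) (by simp) (by simpa using hint)
    (by simpa using hg.continuous.integrable_of_hasCompactSupport hc)
    (fun x _ ↦ by fun_prop) (fun x _ ↦ hg.differentiable one_ne_zero x)
  simpa using key

section RadialField

variable {d : ℕ} {f : EuclideanSpace ℝ (Fin d) → ℂ}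

/-- If `f` is smooth and vanishes near the origin, the field `x ↦ |x|⁻² |f x|² x` is `C¹`. -/
theorem contDiff_coord_div_norm_sq_mul_norm_sq (hf : ContDiff ℝ (⊤ : ℕ∞) f)
    (h0 : (0 : EuclideanSpace ℝ (Fin d)) ∉ tsupport f) (i : Fin d) :
    ContDiff ℝ 1 (fun x ↦ x i / ‖x‖ ^ 2 * ‖f x‖ ^ 2) := by
  rw [contDiff_iff_contDiffAt]
  intro x
  by_cases hx : x ∈ tsupport f
  · have hx0 : x ≠ 0 := fun h ↦ h0 (h ▸ hx)
    have hf1 : ContDiff ℝ 1 f := hf.of_le (by exact_mod_cast le_top)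
    have hcoord : ContDiff ℝ 1 (fun y : EuclideanSpace ℝ (Fin d) ↦ y i) := by fun_prop
    exact (hcoord.contDiffAt.div (contDiff_norm_sq ℝ).contDiffAt
      (by simpa using hx0)).mul (hf1.norm_sq ℝ).contDiffAt
  · refine (contDiffAt_const (c := (0 : ℝ))).congr_of_eventuallyEq ?_
    filter_upwards [notMem_tsupport_iff_eventuallyEq.mp hx] with y hy
    simp [hy]

theorem hasCompactSupport_coord_div_norm_sq_mul_norm_sq (hsupp : HasCompactSupport f)
    (i : Fin d) : HasCompactSupport (fun x ↦ x i / ‖x‖ ^ 2 * ‖f x‖ ^ 2) :=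
  hsupp.mono fun x hx ↦ by
    contrapose! hx
    simp_all

theorem fderiv_coord_div_norm_sq_mul_norm_sq {x : EuclideanSpace ℝ (Fin d)} (hx : x ≠ 0)
    (hf : DifferentiableAt ℝ f x) (i : Fin d) :
    fderiv ℝ (fun y ↦ y i / ‖y‖ ^ 2 * ‖f y‖ ^ 2) x (EuclideanSpace.single i 1) =
      (1 / ‖x‖ ^ 2 - 2 * x i ^ 2 / ‖x‖ ^ 4) * ‖f x‖ ^ 2 +
        2 * (x i / ‖x‖ ^ 2) * inner ℝ (f x) (fderiv ℝ f x (EuclideanSpace.single i 1)) := by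
  have hn : ‖x‖ ≠ 0 := norm_ne_zero_iff.mpr hx
  have hcoord : HasFDerivAt (fun y : EuclideanSpace ℝ (Fin d) ↦ y i)
      (EuclideanSpace.proj i : EuclideanSpace ℝ (Fin d) →L[ℝ] ℝ) x :=
    (EuclideanSpace.proj i : EuclideanSpace ℝ (Fin d) →L[ℝ] ℝ).hasFDerivAt
  have hinv : HasFDerivAt (fun y : EuclideanSpace ℝ (Fin d) ↦ (‖y‖ ^ 2)⁻¹)
      (-((‖x‖ ^ 2) ^ 2)⁻¹ • (2 • (innerSL ℝ x).comp (.id ℝ _))) x :=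
    (hasDerivAt_inv (pow_ne_zero 2 hn)).comp_hasFDerivAt x (hasFDerivAt_id x).norm_sq
  have h := (hcoord.fun_mul hinv).fun_mul hf.hasFDerivAt.norm_sq
  simp only [div_eq_mul_inv]
  rw [h.fderiv]
  simp [EuclideanSpace.inner_single_right]
  field_simp
  ring

/-- Pointwise, completing the square changes the energy density by a divergence. -/
theorem sum_norm_sq_add_eq_add_divergence (hf : ContDiff ℝ (⊤ : ℕ∞) f)
    (h0 : (0 : EuclideanSpace ℝ (Fin d)) ∉ tsupport f) {a σ : ℝ}
    (hσ : σ ^ 2 - ((d : ℝ) - 2) * σ = a) (x : EuclideanSpace ℝ (Fin d)) :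
    ∑ i, ‖fderiv ℝ f x (EuclideanSpace.single i 1) + (↑(σ * (x i / ‖x‖ ^ 2)) : ℂ) * f x‖ ^ 2 =
      ((∑ i, ‖fderiv ℝ f x (EuclideanSpace.single i 1)‖ ^ 2) + a / ‖x‖ ^ 2 * ‖f x‖ ^ 2) +
        σ * ∑ i, fderiv ℝ (fun y ↦ y i / ‖y‖ ^ 2 * ‖f y‖ ^ 2) x (EuclideanSpace.single i 1) := by
  rcases eq_or_ne x 0 with rfl | hx
  · have hev := notMem_tsupport_iff_eventuallyEq.mp h0
    have hG (i : Fin d) :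
        fderiv ℝ (fun y ↦ y i / ‖y‖ ^ 2 * ‖f y‖ ^ 2) (0 : EuclideanSpace ℝ (Fin d)) = 0 := by
      have : (fun y : EuclideanSpace ℝ (Fin d) ↦ y i / ‖y‖ ^ 2 * ‖f y‖ ^ 2) =ᶠ[nhds 0]
          fun _ ↦ (0 : ℝ) := by
        filter_upwards [hev] with y hy
        simp [hy]
      rw [this.fderiv_eq]
      simp
    simp [hG]
  · have hn : ‖x‖ ≠ 0 := norm_ne_zero_iff.mpr hx
    have hsq (i : Fin d) :
        ‖fderiv ℝ f x (EuclideanSpace.single i 1) + (↑(σ * (x i / ‖x‖ ^ 2)) : ℂ) * f x‖ ^ 2 =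
          ‖fderiv ℝ f x (EuclideanSpace.single i 1)‖ ^ 2 +
            σ * fderiv ℝ (fun y ↦ y i / ‖y‖ ^ 2 * ‖f y‖ ^ 2) x (EuclideanSpace.single i 1) +
            ((σ ^ 2 + 2 * σ) / ‖x‖ ^ 4 * ‖f x‖ ^ 2 * x i ^ 2 - σ / ‖x‖ ^ 2 * ‖f x‖ ^ 2) := by
      rw [fderiv_coord_div_norm_sq_mul_norm_sq hx (hf.differentiable (by simp) x),
        ← Complex.real_smul, norm_add_sq_real, inner_smul_right, norm_smul, mul_pow,
        Real.norm_eq_abs, sq_abs, real_inner_comm]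
      field_simp
      ring
    rw [Finset.sum_congr rfl fun i _ ↦ hsq i, Finset.sum_add_distrib, Finset.sum_add_distrib,
      Finset.sum_sub_distrib, ← Finset.mul_sum, ← Finset.mul_sum, ← EuclideanSpace.real_norm_sq_eq,
      ← hσ]
    simp only [Finset.sum_const, Finset.card_univ, Fintype.card_fin, nsmul_eq_mul]
    field_simp
    ring

end RadialField

/-- Factorization identity for the quadratic form
`Q_a(f) = ∫ |∇f|² + (a/|x|²)|f|²` with `σ = (d-2)/2 - √(((d-2)/2)² + a)`,
and the resulting nonnegativity (sharp Hardy inequality). -/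
theorem quadratic_form_factorization_and_nonneg
    (d : ℕ) (hd : 3 ≤ d) (a : ℝ) (ha : -(((d : ℝ) - 2) / 2) ^ 2 ≤ a)
    (σ : ℝ) (hσ : σ = ((d : ℝ) - 2) / 2 - Real.sqrt ((((d : ℝ) - 2) / 2) ^ 2 + a))
    (f : EuclideanSpace ℝ (Fin d) → ℂ)
    (hf : ContDiff ℝ (⊤ : ℕ∞) f) (hsupp : HasCompactSupport f)
    (h0 : (0 : EuclideanSpace ℝ (Fin d)) ∉ tsupport f) :
    (∫ x : EuclideanSpace ℝ (Fin d),
        ((∑ i, ‖fderiv ℝ f x (EuclideanSpace.single i 1)‖ ^ 2)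
          + a / ‖x‖ ^ 2 * ‖f x‖ ^ 2)
      = ∫ x : EuclideanSpace ℝ (Fin d),
          ∑ i, ‖fderiv ℝ f x (EuclideanSpace.single i 1)
            + (↑(σ * (x i / ‖x‖ ^ 2)) : ℂ) * f x‖ ^ 2)
    ∧ 0 ≤ ∫ x : EuclideanSpace ℝ (Fin d),
        ((∑ i, ‖fderiv ℝ f x (EuclideanSpace.single i 1)‖ ^ 2)
          + a / ‖x‖ ^ 2 * ‖f x‖ ^ 2) := by
  have hroot : σ ^ 2 - ((d : ℝ) - 2) * σ = a := by
    have hsqrt := Real.sq_sqrt (show 0 ≤ (((d : ℝ) - 2) / 2) ^ 2 + a by linarith)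
    rw [hσ]
    linear_combination hsqrt
  have hdiv (i : Fin d) := integral_fderiv_apply_eq_zero volume
    (contDiff_coord_div_norm_sq_mul_norm_sq hf h0 i)
    (hasCompactSupport_coord_div_norm_sq_mul_norm_sq hsupp i) (EuclideanSpace.single i 1)
  have hint : Integrable fun x : EuclideanSpace ℝ (Fin d) ↦ σ * ∑ i,
      fderiv ℝ (fun y ↦ y i / ‖y‖ ^ 2 * ‖f y‖ ^ 2) x (EuclideanSpace.single i 1) :=
    (integrable_finsetSum _ fun i _ ↦ (hdiv i).1).const_mul σ
  have hzero : ∫ x : EuclideanSpace ℝ (Fin d), σ * ∑ i,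
      fderiv ℝ (fun y ↦ y i / ‖y‖ ^ 2 * ‖f y‖ ^ 2) x (EuclideanSpace.single i 1) = 0 := by
    rw [integral_const_mul, integral_finsetSum _ fun i _ ↦ (hdiv i).1]
    simp [fun i ↦ (hdiv i).2]
  have heq : (∫ x : EuclideanSpace ℝ (Fin d),
        ((∑ i, ‖fderiv ℝ f x (EuclideanSpace.single i 1)‖ ^ 2)
          + a / ‖x‖ ^ 2 * ‖f x‖ ^ 2)
      = ∫ x : EuclideanSpace ℝ (Fin d),
          ∑ i, ‖fderiv ℝ f x (EuclideanSpace.single i 1)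
            + (↑(σ * (x i / ‖x‖ ^ 2)) : ℂ) * f x‖ ^ 2) := by
    simp only [sum_norm_sq_add_eq_add_divergence hf h0 hroot]
    by_cases hI : Integrable fun x : EuclideanSpace ℝ (Fin d) ↦
        (∑ i, ‖fderiv ℝ f x (EuclideanSpace.single i 1)‖ ^ 2) + a / ‖x‖ ^ 2 * ‖f x‖ ^ 2
    · rw [integral_add hI hint, hzero, add_zero]
    · rw [integral_undef hI, integral_undef fun h ↦ hI
        ((integrable_add_iff_integrable_left' hint).mp h)]
  refine ⟨heq, heq ▸ integral_nonneg fun x ↦ ?_⟩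
  exact Finset.sum_nonneg fun i _ ↦ sq_nonneg _
end

section
/- Let d ≥ 3 be an integer and a < -((d-2)/2)² be real. Then there exists f ∈ C_c^∞(ℝ^d \ {0}; ℝ) with ∫_{ℝ^d} (|∇f(x)|² + (a/|x|²)|f(x)|²) dx < 0; that is, for coupling constants below the sharp Hardy threshold, the quadratic form Q_a fails to be nonnegative. -/
open MeasureTheory

/-- The substitution `r = exp t` in an integral over the positive half-line. -/
theorem integral_Ioi_zero_eq_integral_exp_mul (F : ℝ → ℝ) :
    ∫ r in Set.Ioi (0 : ℝ), F r = ∫ t, Real.exp t * F (Real.exp t) := by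
  have h := integral_image_eq_integral_abs_deriv_smul (f := Real.exp) (f' := Real.exp)
    MeasurableSet.univ (fun t _ => (Real.hasDerivAt_exp t).hasDerivWithinAt)
    Real.exp_injective.injOn F
  simpa [Set.image_univ, Real.range_exp, abs_of_pos (Real.exp_pos _)] using h

/-- Sharpness of the one-dimensional form of the Hardy inequality in logarithmic coordinates. -/
theorem exists_integral_sq_deriv_sub_add_neg (s a : ℝ) (ha : a < -s ^ 2) :
    ∃ ψ : ℝ → ℝ, ContDiff ℝ (⊤ : ℕ∞) ψ ∧ HasCompactSupport ψ ∧ (∀ t ≤ 0, ψ t = 0) ∧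
      ∫ t, ((deriv ψ t - s * ψ t) ^ 2 + a * ψ t ^ 2) < 0 := by
  let φ : ContDiffBump (2 : ℝ) := ⟨1 / 2, 1, by norm_num, by norm_num⟩
  have hφ : ContDiff ℝ (⊤ : ℕ∞) φ := φ.contDiff
  have hφc : HasCompactSupport φ := φ.hasCompactSupport
  have hφ' : Continuous (deriv φ) := hφ.continuous_deriv (by simp)
  have hdφ (t : ℝ) : HasDerivAt φ (deriv φ t) t :=
    (hφ.differentiable (by simp) t).hasDerivAt
  set A := ∫ t, deriv φ t ^ 2
  set B := ∫ t, φ t ^ 2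
  have hA : 0 ≤ A := integral_nonneg fun t => sq_nonneg _
  have iA : Integrable fun t => deriv φ t ^ 2 := by
    simp only [pow_two]
    exact (hφ'.mul hφ').integrable_of_hasCompactSupport hφc.deriv.mul_left
  have iB : Integrable fun t => φ t ^ 2 := by
    simp only [pow_two]
    exact (hφ.continuous.mul hφ.continuous).integrable_of_hasCompactSupport hφc.mul_left
  have iC : Integrable fun t => φ t * deriv φ t :=
    (hφ.continuous.mul hφ').integrable_of_hasCompactSupport hφc.deriv.mul_left
  have hB : 0 < B := by
    refine integral_pos_of_integrable_nonneg_nonzero (x := 2) (by fun_prop) iB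
      (fun t => sq_nonneg _) ?_
    have : φ 2 = 1 := φ.one_of_mem_closedBall (by simp [φ])
    simp [this]
  have hC : ∫ t, φ t * deriv φ t = 0 := by
    have h := integral_eq_zero_of_hasDerivAt_of_integrable (f := fun t => φ t ^ 2)
      (f' := fun t => 2 * (φ t * deriv φ t))
      (fun t => by simpa [mul_assoc] using (hdφ t).fun_pow 2) (iC.const_mul 2) iB
    simpa [integral_const_mul] using h
  obtain ⟨ε, hε, hεA⟩ : ∃ ε : ℝ, 0 < ε ∧ ε ^ 2 * A + (s ^ 2 + a) * B < 0 := by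
    have hk : 0 < -(s ^ 2 + a) * B := mul_pos (by linarith) hB
    refine ⟨√(-(s ^ 2 + a) * B / (A + 1)), by positivity, ?_⟩
    rw [Real.sq_sqrt (by positivity)]
    have : -(s ^ 2 + a) * B / (A + 1) * A < -(s ^ 2 + a) * B := by
      rw [div_mul_eq_mul_div, div_lt_iff₀ (by positivity)]
      linarith
    linarith
  have hd (t : ℝ) : deriv (fun t => φ (ε * t)) t = ε * deriv φ (ε * t) := by
    simpa using deriv_comp_mul_left ε φ t
  refine ⟨fun t => φ (ε * t), hφ.comp (by fun_prop), ?_, fun t ht => ?_, ?_⟩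
  · exact hφc.comp_homeomorph (Homeomorph.mulLeft₀ ε hε.ne')
  · refine φ.zero_of_le_dist ?_
    have : ε * t ≤ 0 := mul_nonpos_of_nonneg_of_nonpos hε.le ht
    rw [Real.dist_eq, abs_sub_comm]
    exact le_trans (by simp only [φ]; linarith) (le_abs_self _)
  · let G : ℝ → ℝ := fun u =>
      ε ^ 2 * deriv φ u ^ 2 + (-2 * s * ε) * (φ u * deriv φ u) + (s ^ 2 + a) * φ u ^ 2
    have h (t : ℝ) : (deriv (fun t => φ (ε * t)) t - s * φ (ε * t)) ^ 2 + a * φ (ε * t) ^ 2 =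
        G (ε * t) := by
      simp only [hd, G]; ring
    have hG : ∫ u, G u = ε ^ 2 * A + (s ^ 2 + a) * B := by
      simp only [G]
      rw [integral_add (by exact (iA.const_mul _).add (iC.const_mul _)) (iB.const_mul _),
        integral_add (iA.const_mul _) (iC.const_mul _)]
      simp only [integral_const_mul, hC, mul_zero, add_zero, A, B]
    rw [integral_congr_ae (.of_forall h), Measure.integral_comp_mul_left G, hG, smul_eq_mul]
    exact mul_neg_of_pos_of_neg (by positivity) hεA

section LogRadial

variable {E : Type*} [NormedAddCommGroup E] {h : ℝ → ℝ}

theorem comp_log_norm_eventuallyEq_zero (h0 : ∀ t ≤ 0, h t = 0) :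
    (fun x : E => h (Real.log ‖x‖)) =ᶠ[nhds 0] 0 := by
  filter_upwards [Metric.ball_mem_nhds (0 : E) one_pos] with x hx
  exact h0 _ (Real.log_nonpos (norm_nonneg x) (mem_ball_zero_iff.1 hx).le)

variable [InnerProductSpace ℝ E]

theorem contDiff_comp_log_norm (hh : ContDiff ℝ (⊤ : ℕ∞) h) (h0 : ∀ t ≤ 0, h t = 0) :
    ContDiff ℝ (⊤ : ℕ∞) fun x : E => h (Real.log ‖x‖) := by
  rw [contDiff_iff_contDiffAt]
  intro x
  rcases eq_or_ne x 0 with rfl | hx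
  · exact contDiffAt_const.congr_of_eventuallyEq (comp_log_norm_eventuallyEq_zero h0)
  · exact hh.contDiffAt.comp x ((contDiffAt_norm ℝ hx).log (norm_ne_zero_iff.2 hx))

theorem hasCompactSupport_comp_log_norm [FiniteDimensional ℝ E] (hc : HasCompactSupport h) :
    HasCompactSupport fun x : E => h (Real.log ‖x‖) := by
  obtain ⟨R, hR⟩ := hc.isCompact.isBounded.subset_closedBall 0
  refine HasCompactSupport.intro (isCompact_closedBall (0 : E) (Real.exp R)) fun x hx => ?_
  by_contra hne
  have hm := hR (subset_tsupport h hne)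
  have hx' : Real.exp R < ‖x‖ := by simpa using hx
  have : R < Real.log ‖x‖ := (Real.lt_log_iff_exp_lt ((Real.exp_pos R).trans hx')).2 hx'
  exact absurd ((le_abs_self _).trans (by simpa using hm)) this.not_ge

theorem fderiv_comp_log_norm {x : E} (hx : x ≠ 0)
    (hh : DifferentiableAt ℝ h (Real.log ‖x‖)) (v : E) :
    fderiv ℝ (fun x : E => h (Real.log ‖x‖)) x v =
      deriv h (Real.log ‖x‖) * (inner ℝ x v / ‖x‖ ^ 2) := by
  have hlog (y : E) : Real.log ‖y‖ = Real.log (‖y‖ ^ 2) / 2 := by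
    rw [Real.log_pow]; push_cast; ring
  have h1 : HasFDerivAt (fun y : E => Real.log ‖y‖)
      ((‖x‖ ^ 2)⁻¹ • innerSL ℝ x) x := by
    have := (((hasStrictFDerivAt_norm_sq x).hasFDerivAt.log
      (pow_ne_zero 2 (norm_ne_zero_iff.2 hx))).const_mul (1 / 2 : ℝ))
    refine (this.congr_fderiv ?_).congr_of_eventuallyEq (.of_forall fun y => ?_)
    · ext v; simp; ring
    · simp only [hlog y]; ring
  have := (hh.hasDerivAt.comp_hasFDerivAt x h1).fderiv
  rw [Function.comp_def] at this
  rw [this]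
  simp only [smul_apply, innerSL_apply_apply, smul_eq_mul]
  ring

end LogRadial

theorem sum_sq_fderiv_comp_log_norm {d : ℕ} {h : ℝ → ℝ} (hh : Differentiable ℝ h)
    (h0 : ∀ t ≤ 0, h t = 0) (x : EuclideanSpace ℝ (Fin d)) :
    ∑ i, (fderiv ℝ (fun x : EuclideanSpace ℝ (Fin d) => h (Real.log ‖x‖)) x
      (EuclideanSpace.single i 1)) ^ 2 = deriv h (Real.log ‖x‖) ^ 2 / ‖x‖ ^ 2 := by
  rcases eq_or_ne x 0 with rfl | hx
  · simp [(comp_log_norm_eventuallyEq_zero h0).fderiv_eq]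
  · have hn : ‖x‖ ≠ 0 := norm_ne_zero_iff.2 hx
    have hsum : ∑ i, x i ^ 2 = ‖x‖ ^ 2 := (EuclideanSpace.real_norm_sq_eq x).symm
    simp only [fderiv_comp_log_norm hx (hh _), EuclideanSpace.inner_single_right, mul_pow, div_pow]
    simp only [conj_trivial, ← Finset.mul_sum, ← Finset.sum_div, hsum]
    field_simp

/-- For `a < -((d-2)/2)²` (below the sharp Hardy threshold), the
quadratic form `Q_a` fails to be nonnegative: there is a smooth compactly
supported real function, supported away from the origin, with `Q_a(f) < 0`. -/
theorem quadratic_form_negative_below_hardy_threshold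
    (d : ℕ) (hd : 3 ≤ d) (a : ℝ) (ha : a < -(((d : ℝ) - 2) / 2) ^ 2) :
    ∃ f : EuclideanSpace ℝ (Fin d) → ℝ,
      ContDiff ℝ (⊤ : ℕ∞) f ∧ HasCompactSupport f ∧
      (0 : EuclideanSpace ℝ (Fin d)) ∉ tsupport f ∧
      (∫ x : EuclideanSpace ℝ (Fin d),
          ((∑ i, (fderiv ℝ f x (EuclideanSpace.single i 1)) ^ 2)
            + a / ‖x‖ ^ 2 * (f x) ^ 2)) < 0 := by
  set s : ℝ := ((d : ℝ) - 2) / 2 with hs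
  obtain ⟨ψ, hψ, hψc, hψ0, hneg⟩ := exists_integral_sq_deriv_sub_add_neg s a ha
  let h : ℝ → ℝ := fun t => Real.exp (-s * t) * ψ t
  have hh : ContDiff ℝ (⊤ : ℕ∞) h := by
    have : ContDiff ℝ (⊤ : ℕ∞) fun t : ℝ => Real.exp (-s * t) := by fun_prop
    exact this.mul hψ
  have h0 : ∀ t ≤ 0, h t = 0 := fun t ht => by simp [h, hψ0 t ht]
  have hd' (t : ℝ) : deriv h t = Real.exp (-s * t) * (deriv ψ t - s * ψ t) := by
    have h1 : HasDerivAt (fun t : ℝ => Real.exp (-s * t)) (Real.exp (-s * t) * -s) t := by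
      simpa using ((hasDerivAt_id t).const_mul (-s)).exp
    refine (h1.mul (hψ.differentiable (by simp) t).hasDerivAt).deriv.trans ?_
    ring
  refine ⟨fun x => h (Real.log ‖x‖), contDiff_comp_log_norm hh h0,
    hasCompactSupport_comp_log_norm hψc.mul_left,
    notMem_tsupport_iff_eventuallyEq.2 (comp_log_norm_eventuallyEq_zero h0), ?_⟩
  have : Nonempty (Fin d) := ⟨⟨0, by omega⟩⟩
  simp_rw [sum_sq_fderiv_comp_log_norm (hh.differentiable (by simp)) h0]
  rw [integral_fun_norm_addHaar (volume : Measure (EuclideanSpace ℝ (Fin d)))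
    (fun r => deriv h (Real.log r) ^ 2 / r ^ 2 + a / r ^ 2 * h (Real.log r) ^ 2),
    integral_Ioi_zero_eq_integral_exp_mul]
  have hint (t : ℝ) : Real.exp t * (Real.exp t ^ (d - 1) •
      (deriv h (Real.log (Real.exp t)) ^ 2 / Real.exp t ^ 2
        + a / Real.exp t ^ 2 * h (Real.log (Real.exp t)) ^ 2)) =
      (deriv ψ t - s * ψ t) ^ 2 + a * ψ t ^ 2 := by
    have hexp : Real.exp t * Real.exp t ^ (d - 1) * Real.exp (-s * t) ^ 2 = Real.exp t ^ 2 := by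
      rw [← pow_succ', Nat.sub_add_cancel (by omega)]
      simp only [← Real.exp_nat_mul, ← Real.exp_add]
      congr 1
      rw [hs]; push_cast; ring
    simp only [Real.log_exp, hd', h, smul_eq_mul]
    calc _ = Real.exp t * Real.exp t ^ (d - 1) * Real.exp (-s * t) ^ 2 / Real.exp t ^ 2 *
          ((deriv ψ t - s * ψ t) ^ 2 + a * ψ t ^ 2) := by ring
      _ = _ := by rw [hexp, div_self (by positivity), one_mul]
  simp only [finrank_euclideanSpace, Fintype.card_fin, hint]
  rw [nsmul_eq_mul, smul_eq_mul]
  have hvol : 0 < (volume : Measure (EuclideanSpace ℝ (Fin d))).real (Metric.ball 0 1) :=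
    ENNReal.toReal_pos (Metric.measure_ball_pos _ _ one_pos).ne' measure_ball_lt_top.ne
  have hdpos : (0 : ℝ) < d := by exact_mod_cast (by omega : 0 < d)
  exact mul_neg_of_pos_of_neg hdpos (mul_neg_of_pos_of_neg hvol hneg)
end

section
/- Let d ≥ 3 be an integer, let a > -((d-2)/2)² be real, and set β := √(1 + 4a/(d-2)²). Define the ground state soliton W_a : ℝ^d → ℝ by W_a(x) := (d(d-2)β²)^{(d-2)/4} · (|x|^{β-1}/(1+|x|^{2β}))^{(d-2)/2}. Then W_a is smooth on ℝ^d \ {0} and satisfies the Euler–Lagrange equation -ΔW_a(x) + (a/|x|²) W_a(x) = W_a(x)^{(d+2)/(d-2)} for every x ∈ ℝ^d \ {0}. -/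
open MeasureTheory

/-- The sum of the second partial derivatives of a radial function `x ↦ F (‖x‖ ^ 2)`
away from the origin. -/
lemma sum_fderiv_fderiv_comp_norm_sq {ι : Type*} [Fintype ι] [DecidableEq ι] {F G : ℝ → ℝ}
    {H : ℝ} {x : EuclideanSpace ℝ ι} (hx : x ≠ 0)
    (hF : ∀ s, 0 < s → HasDerivAt F (G s) s) (hG : HasDerivAt G H (‖x‖ ^ 2)) :
    ∑ i, fderiv ℝ (fun y => fderiv ℝ (fun z => F (‖z‖ ^ 2)) y (EuclideanSpace.single i 1)) x
        (EuclideanSpace.single i 1)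
      = 4 * ‖x‖ ^ 2 * H + 2 * Fintype.card ι * G (‖x‖ ^ 2) := by
  have hnorm (y : EuclideanSpace ℝ ι) :
      HasFDerivAt (fun z : EuclideanSpace ℝ ι => ‖z‖ ^ 2) (2 • innerSL ℝ y) y :=
    (hasStrictFDerivAt_norm_sq y).hasFDerivAt
  have hpartial (i : ι) :
      (fun y => fderiv ℝ (fun z => F (‖z‖ ^ 2)) y (EuclideanSpace.single i 1))
        =ᶠ[nhds x] fun y => G (‖y‖ ^ 2) * (2 * y i) := by
    filter_upwards [isOpen_ne.mem_nhds hx] with y hy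
    have hpos : 0 < ‖y‖ ^ 2 := by positivity [norm_pos_iff.mpr hy]
    have h : HasFDerivAt (fun z => F (‖z‖ ^ 2)) (G (‖y‖ ^ 2) • 2 • innerSL ℝ y) y :=
      (hF _ hpos).comp_hasFDerivAt y (hnorm y)
    rw [h.fderiv]
    simp [EuclideanSpace.inner_single_right]
  have hsecond (i : ι) :
      fderiv ℝ (fun y => fderiv ℝ (fun z => F (‖z‖ ^ 2)) y (EuclideanSpace.single i 1)) x
        (EuclideanSpace.single i 1) = 4 * H * x i ^ 2 + 2 * G (‖x‖ ^ 2) := by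
    have hcoord : HasFDerivAt (fun y : EuclideanSpace ℝ ι => 2 * y i)
        ((2 : ℝ) • EuclideanSpace.proj (𝕜 := ℝ) i) x :=
      (EuclideanSpace.proj (𝕜 := ℝ) i : EuclideanSpace ℝ ι →L[ℝ] ℝ).hasFDerivAt.const_mul 2
    have h : HasFDerivAt (fun y => G (‖y‖ ^ 2)) (H • 2 • innerSL ℝ x) x :=
      hG.comp_hasFDerivAt x (hnorm x)
    rw [(hpartial i).fderiv_eq, (h.fun_mul hcoord).fderiv]
    simp [EuclideanSpace.inner_single_right]
    ring
  simp_rw [hsecond]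
  rw [Finset.sum_add_distrib, ← Finset.mul_sum, ← EuclideanSpace.real_norm_sq_eq]
  simp
  ring

/-- The derivative of the soliton profile `s ↦ (s ^ ((β - 1) / 2) / (1 + s ^ β)) ^ m`,
written as the profile times its logarithmic derivative. -/
lemma hasDerivAt_soliton_profile (C m β : ℝ) {s : ℝ} (hs : 0 < s) :
    HasDerivAt (fun s : ℝ => C * (s ^ ((β - 1) / 2) / (1 + s ^ β)) ^ m)
      (C * (s ^ ((β - 1) / 2) / (1 + s ^ β)) ^ m *
        (m * ((β - 1) / 2 - β * (s ^ β / (1 + s ^ β))) / s)) s := by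
  have hden : 0 < 1 + s ^ β := by positivity
  have hq : 0 < s ^ ((β - 1) / 2) / (1 + s ^ β) := by positivity
  have h := (((Real.hasDerivAt_rpow_const (p := (β - 1) / 2) (Or.inl hs.ne')).fun_div
    ((Real.hasDerivAt_rpow_const (p := β) (Or.inl hs.ne')).const_add 1) hden.ne').rpow_const
    (p := m) (Or.inl hq.ne')).const_mul C
  refine h.congr_deriv ?_
  rw [Real.rpow_sub_one hq.ne', Real.rpow_sub_one hs.ne', Real.rpow_sub_one hs.ne']
  field_simp

/-- The derivative of the logarithmic derivative of the soliton profile. -/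
lemma hasDerivAt_soliton_logDeriv (m β : ℝ) {s : ℝ} (hs : 0 < s) :
    HasDerivAt (fun s : ℝ => m * ((β - 1) / 2 - β * (s ^ β / (1 + s ^ β))) / s)
      (-(m * (β ^ 2 * (s ^ β / (1 + s ^ β) ^ 2)
        + ((β - 1) / 2 - β * (s ^ β / (1 + s ^ β)))) / s ^ 2)) s := by
  have hden : 0 < 1 + s ^ β := by positivity
  have hpow := Real.hasDerivAt_rpow_const (p := β) (Or.inl hs.ne')
  have h := ((((hpow.fun_div (hpow.const_add 1) hden.ne').const_mul β).const_sub
    ((β - 1) / 2)).const_mul m).fun_div (hasDerivAt_id s) hs.ne'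
  refine h.congr_deriv ?_
  simp only [id, Real.rpow_sub_one hs.ne']
  field_simp
  ring

/-- The ground state soliton
`W_a(x) = (d(d-2)β²)^{(d-2)/4} (|x|^{β-1}/(1+|x|^{2β}))^{(d-2)/2}`, with
`β = √(1 + 4a/(d-2)²)`, is smooth away from the origin and solves the
Euler–Lagrange equation `-ΔW_a + (a/|x|²)W_a = W_a^{(d+2)/(d-2)}` on `ℝ^d \ {0}`. -/
theorem ground_state_euler_lagrange
    (d : ℕ) (hd : 3 ≤ d) (a : ℝ) (ha : -(((d : ℝ) - 2) / 2) ^ 2 < a)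
    (β : ℝ) (hβ : β = Real.sqrt (1 + 4 * a / ((d : ℝ) - 2) ^ 2))
    (W : EuclideanSpace ℝ (Fin d) → ℝ)
    (hW : ∀ x, W x = ((d : ℝ) * ((d : ℝ) - 2) * β ^ 2) ^ (((d : ℝ) - 2) / 4) *
        (‖x‖ ^ (β - 1) / (1 + ‖x‖ ^ (2 * β))) ^ (((d : ℝ) - 2) / 2)) :
    ContDiffOn ℝ (⊤ : ℕ∞) W {(0 : EuclideanSpace ℝ (Fin d))}ᶜ
    ∧ ∀ x : EuclideanSpace ℝ (Fin d), x ≠ 0 →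
      -(∑ i, fderiv ℝ (fun y => fderiv ℝ W y (EuclideanSpace.single i 1)) x
            (EuclideanSpace.single i 1))
        + a / ‖x‖ ^ 2 * W x
      = W x ^ (((d : ℝ) + 2) / ((d : ℝ) - 2)) := by
  have hd' : (3 : ℝ) ≤ d := by exact_mod_cast hd
  have hd2 : (0 : ℝ) < (d : ℝ) - 2 := by linarith
  have hrad : 0 < 1 + 4 * a / ((d : ℝ) - 2) ^ 2 := by
    have : 1 + 4 * a / ((d : ℝ) - 2) ^ 2
        = 4 * (a + (((d : ℝ) - 2) / 2) ^ 2) / ((d : ℝ) - 2) ^ 2 := by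
      field_simp
      ring
    rw [this]
    exact div_pos (by linarith) (by positivity)
  have hβpos : 0 < β := hβ ▸ Real.sqrt_pos.mpr hrad
  have ha_eq : a = (((d : ℝ) - 2) / 2) ^ 2 * (β ^ 2 - 1) := by
    rw [hβ, Real.sq_sqrt hrad.le]
    field_simp
    ring
  refine ⟨fun x hx => ContDiffAt.contDiffWithinAt ?_, fun x hx => ?_⟩
  · have hn : 0 < ‖x‖ := norm_pos_iff.mpr hx
    have hnorm : ContDiffAt ℝ (⊤ : ℕ∞) (fun y : EuclideanSpace ℝ (Fin d) => ‖y‖) x :=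
      contDiffAt_norm ℝ hx
    rw [funext hW]
    have hden : 1 + ‖x‖ ^ (2 * β) ≠ 0 := by positivity
    have hq : ‖x‖ ^ (β - 1) / (1 + ‖x‖ ^ (2 * β)) ≠ 0 := by positivity
    exact contDiffAt_const.mul (((hnorm.rpow_const_of_ne hn.ne').div
      (contDiffAt_const.add (hnorm.rpow_const_of_ne hn.ne')) hden).rpow_const_of_ne hq)
  · set m : ℝ := ((d : ℝ) - 2) / 2 with hm
    have hmpos : 0 < m := by positivity
    have hdm : (d : ℝ) = 2 * m + 2 := by rw [hm]; ring
    set K : ℝ := (d : ℝ) * ((d : ℝ) - 2) * β ^ 2 with hK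
    have hKpos : 0 < K := mul_pos (mul_pos (by linarith) hd2) (by positivity)
    set C : ℝ := K ^ (((d : ℝ) - 2) / 4) with hC
    have hWF : W = fun y => C * ((‖y‖ ^ 2) ^ ((β - 1) / 2) / (1 + (‖y‖ ^ 2) ^ β)) ^ m := by
      funext y
      have hsq (p : ℝ) : (‖y‖ ^ 2) ^ p = ‖y‖ ^ (2 * p) := by
        rw [Real.rpow_mul (norm_nonneg y), Real.rpow_two]
      rw [hW, hsq, hsq, mul_div_cancel₀ _ two_ne_zero]
    have hs : 0 < ‖x‖ ^ 2 := by positivity [norm_pos_iff.mpr hx]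
    rw [hWF, sum_fderiv_fderiv_comp_norm_sq hx
      (fun s hs => hasDerivAt_soliton_profile C m β hs)
      ((hasDerivAt_soliton_profile C m β hs).fun_mul (hasDerivAt_soliton_logDeriv m β hs)),
      Fintype.card_fin]
    dsimp only
    generalize ‖x‖ ^ 2 = s at hs ⊢
    have hpower : (C * (s ^ ((β - 1) / 2) / (1 + s ^ β)) ^ m) ^ (((d : ℝ) + 2) / ((d : ℝ) - 2))
        = C * (s ^ ((β - 1) / 2) / (1 + s ^ β)) ^ m * (K * (s ^ β / s / (1 + s ^ β) ^ 2)) := by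
      have hq : 0 < s ^ ((β - 1) / 2) / (1 + s ^ β) := by positivity
      have hexp : ((d : ℝ) + 2) / ((d : ℝ) - 2) = 1 + 2 / m := by
        rw [show (d : ℝ) + 2 = 2 * (m + 2) by rw [hdm]; ring,
          show (d : ℝ) - 2 = 2 * m by rw [hdm]; ring]
        field_simp
      have hCK : C ^ (2 / m) = K := by
        rw [hC, ← Real.rpow_mul hKpos.le, hm]
        convert Real.rpow_one K using 2
        field_simp
        norm_num
      rw [hexp, Real.rpow_add (by positivity), Real.rpow_one,
        Real.mul_rpow (by positivity) (by positivity), hCK, ← Real.rpow_mul hq.le,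
        mul_div_cancel₀ _ hmpos.ne', Real.rpow_two, div_pow, ← Real.rpow_two (s ^ _),
        ← Real.rpow_mul hs.le, div_mul_cancel₀ _ two_ne_zero, Real.rpow_sub_one hs.ne']
    rw [hpower, ha_eq, hK, hdm]
    have hu : 0 < s ^ β := by positivity
    generalize s ^ β = u at hu ⊢
    generalize C * (s ^ ((β - 1) / 2) / (1 + u)) ^ m = w
    field_simp
    ring
end

section
/- Let d ≥ 3 be an integer, let a > -((d-2)/2)² be real, and set β := √(1 + 4a/(d-2)²). Let W_a(x) := (d(d-2)β²)^{(d-2)/4} · (|x|^{β-1}/(1+|x|^{2β}))^{(d-2)/2}. Then the integrals ∫_{ℝ^d} (|∇W_a(x)|² + (a/|x|²) W_a(x)²) dx and ∫_{ℝ^d} W_a(x)^{2d/(d-2)} dx are both finite and equal: Q_a(W_a) = ∫_{ℝ^d} W_a^{2d/(d-2)} dx. -/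
open MeasureTheory

open Filter Topology Set

/-- The squared Emden–Fowler profile `r² f(r)²` of `f(r) = r^(β-1) / (1 + r^(2β))`. -/
noncomputable def emdenProfile (β r : ℝ) : ℝ := r ^ (2 * β) / (1 + r ^ (2 * β)) ^ 2

/-- The logarithmic slope: `r v'(r) = 2 β u(r) v(r)` for `v = emdenProfile β`. -/
noncomputable def emdenSlope (β r : ℝ) : ℝ := (1 - r ^ (2 * β)) / (1 + r ^ (2 * β))

lemma measurable_emdenProfile (β : ℝ) : Measurable (emdenProfile β) := by
  unfold emdenProfile
  fun_prop

lemma measurable_emdenSlope (β : ℝ) : Measurable (emdenSlope β) := by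
  unfold emdenSlope
  fun_prop

lemma emdenProfile_pos (β : ℝ) {r : ℝ} (hr : 0 < r) : 0 < emdenProfile β r := by
  have := Real.rpow_pos_of_pos hr (2 * β)
  unfold emdenProfile
  positivity

lemma emdenSlope_sq (β : ℝ) {r : ℝ} (hr : 0 < r) :
    emdenSlope β r ^ 2 = 1 - 4 * emdenProfile β r := by
  have := Real.rpow_pos_of_pos hr (2 * β)
  unfold emdenProfile emdenSlope
  field_simp
  ring

lemma emdenProfile_le (β : ℝ) {r : ℝ} (hr : 0 < r) : emdenProfile β r ≤ 1 / 4 := by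
  have := emdenSlope_sq β hr
  nlinarith [sq_nonneg (emdenSlope β r)]

lemma abs_emdenSlope_le (β : ℝ) {r : ℝ} (hr : 0 < r) : |emdenSlope β r| ≤ 1 := by
  rw [← sq_le_one_iff_abs_le_one, emdenSlope_sq β hr]
  linarith [emdenProfile_pos β hr]

lemma hasDerivAt_rpow_two_mul (β : ℝ) {r : ℝ} (hr : 0 < r) :
    HasDerivAt (fun r : ℝ => r ^ (2 * β)) (2 * β * r ^ (2 * β) / r) r := by
  convert Real.hasDerivAt_rpow_const (x := r) (p := 2 * β) (Or.inl hr.ne') using 1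
  rw [Real.rpow_sub_one hr.ne']
  ring

lemma hasDerivAt_emdenProfile (β : ℝ) {r : ℝ} (hr : 0 < r) :
    HasDerivAt (emdenProfile β) (2 * β * emdenSlope β r * emdenProfile β r / r) r := by
  have hs := Real.rpow_pos_of_pos hr (2 * β)
  have h := hasDerivAt_rpow_two_mul β hr
  refine (h.div ((h.const_add 1).pow 2) (pow_pos (by positivity) 2).ne').congr_deriv ?_
  unfold emdenProfile emdenSlope
  simp only [Pi.pow_apply]
  field_simp
  ring

lemma hasDerivAt_emdenSlope (β : ℝ) {r : ℝ} (hr : 0 < r) :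
    HasDerivAt (emdenSlope β) (-(4 * β * emdenProfile β r) / r) r := by
  have hs := Real.rpow_pos_of_pos hr (2 * β)
  have h := hasDerivAt_rpow_two_mul β hr
  refine ((h.const_sub 1).div (h.const_add 1) (by positivity)).congr_deriv ?_
  unfold emdenProfile
  field_simp
  ring

lemma continuousAt_rpow_two_mul {β : ℝ} (hβ : 0 < β) :
    ContinuousAt (fun r : ℝ => r ^ (2 * β)) 0 :=
  (Real.continuous_rpow_const (by positivity)).continuousAt

lemma continuousAt_emdenProfile_zero {β : ℝ} (hβ : 0 < β) : ContinuousAt (emdenProfile β) 0 := by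
  have h := continuousAt_rpow_two_mul hβ
  exact h.div ((continuousAt_const.add h).pow 2)
    (by simp [Real.zero_rpow (mul_pos two_pos hβ).ne'])

lemma continuousAt_emdenSlope_zero {β : ℝ} (hβ : 0 < β) : ContinuousAt (emdenSlope β) 0 := by
  have h := continuousAt_rpow_two_mul hβ
  exact (continuousAt_const.sub h).div (continuousAt_const.add h)
    (by simp [Real.zero_rpow (mul_pos two_pos hβ).ne'])

lemma tendsto_emdenProfile_atTop {β : ℝ} (hβ : 0 < β) :
    Tendsto (emdenProfile β) atTop (𝓝 0) := by
  refine squeeze_zero' ?_ ?_ (tendsto_rpow_neg_atTop (mul_pos two_pos hβ))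
  · filter_upwards [eventually_gt_atTop 0] with r hr using (emdenProfile_pos β hr).le
  · filter_upwards [eventually_gt_atTop 0] with r hr
    have hs := Real.rpow_pos_of_pos hr (2 * β)
    rw [Real.rpow_neg hr.le, ← one_div, emdenProfile, div_le_div_iff₀ (by positivity) hs]
    nlinarith

lemma hasDerivAt_emdenProfile_rpow_mul (β m : ℝ) {r : ℝ} (hr : 0 < r) :
    HasDerivAt (fun r => emdenProfile β r ^ m * (m * (β * emdenSlope β r - 1)))
      (emdenProfile β r ^ m / r *
        (m ^ 2 * (β ^ 2 * (1 + emdenSlope β r ^ 2) - 2 * β * emdenSlope β r))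
        - emdenProfile β r ^ m / r * (4 * m * (m + 1) * β ^ 2 * emdenProfile β r)) r := by
  have hv := emdenProfile_pos β hr
  refine (((hasDerivAt_emdenProfile β hr).rpow_const (p := m) (Or.inl hv.ne')).mul
    ((((hasDerivAt_emdenSlope β hr).const_mul β).sub_const 1).const_mul m)).congr_deriv ?_
  rw [Real.rpow_sub_one hv.ne']
  have h : emdenProfile β r = (1 - emdenSlope β r ^ 2) / 4 := by
    linarith [emdenSlope_sq β hr]
  field_simp
  generalize emdenProfile β r ^ m = G
  rw [h]
  ring

lemma integrableOn_emdenProfile_rpow_div {β m : ℝ} (hβ : 0 < β) (hm : 1 / 2 ≤ m) :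
    IntegrableOn (fun r => emdenProfile β r ^ m / r) (Ioi 0) := by
  have hint : IntegrableOn (fun r : ℝ => 1 / (1 + (r ^ β) ^ 2) * (β * r ^ (β - 1))) (Ioi 0) := by
    refine integrableOn_Ioi_deriv_of_nonneg (g := fun r => Real.arctan (r ^ β))
      (l := Real.pi / 2) ?_ ?_ ?_ ?_
    · exact (Real.continuous_arctan.comp
        (Real.continuous_rpow_const hβ.le)).continuousWithinAt
    · intro r hr
      exact (Real.hasDerivAt_rpow_const (Or.inl (ne_of_gt hr))).arctan
    · intro r hr
      have := Real.rpow_pos_of_pos hr (β - 1)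
      positivity
    · exact (Real.tendsto_arctan_atTop.mono_right nhdsWithin_le_nhds).comp
        (tendsto_rpow_atTop hβ)
  refine (hint.const_mul β⁻¹).mono'
    (((measurable_emdenProfile β).pow_const m).div measurable_id).aestronglyMeasurable ?_
  filter_upwards [ae_restrict_mem measurableSet_Ioi] with r (hr : 0 < r)
  have hv := emdenProfile_pos β hr
  have hs := Real.rpow_pos_of_pos hr β
  rw [Real.norm_of_nonneg (by positivity), Real.rpow_sub_one hr.ne']
  calc emdenProfile β r ^ m / r ≤ emdenProfile β r ^ (1 / 2 : ℝ) / r := by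
        gcongr ?_ / r
        exact Real.rpow_le_rpow_of_exponent_ge hv
          ((emdenProfile_le β hr).trans (by norm_num)) hm
    _ = r ^ β / (1 + (r ^ β) ^ 2) / r := by
        rw [← Real.sqrt_eq_rpow, emdenProfile, mul_comm 2 β, Real.rpow_mul hr.le,
          Real.rpow_two, ← div_pow,
          Real.sqrt_sq (by positivity)]
    _ = _ := by field_simp

lemma integral_emdenProfile_rpow_mul_eq {β m : ℝ} (hβ : 0 < β) (hm : 1 / 2 ≤ m) :
    IntegrableOn (fun r => emdenProfile β r ^ m / r *
        (m ^ 2 * (β ^ 2 * (1 + emdenSlope β r ^ 2) - 2 * β * emdenSlope β r))) (Ioi 0) ∧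
    IntegrableOn (fun r => emdenProfile β r ^ m / r *
        (4 * m * (m + 1) * β ^ 2 * emdenProfile β r)) (Ioi 0) ∧
    ∫ r in Ioi 0, emdenProfile β r ^ m / r *
        (m ^ 2 * (β ^ 2 * (1 + emdenSlope β r ^ 2) - 2 * β * emdenSlope β r)) =
      ∫ r in Ioi 0, emdenProfile β r ^ m / r *
        (4 * m * (m + 1) * β ^ 2 * emdenProfile β r) := by
  have hu := measurable_emdenSlope β
  have hv := measurable_emdenProfile β
  have hm0 : 0 < m := by linarith
  have hG := integrableOn_emdenProfile_rpow_div hβ hm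
  have h₁ : IntegrableOn (fun r => emdenProfile β r ^ m / r *
      (m ^ 2 * (β ^ 2 * (1 + emdenSlope β r ^ 2) - 2 * β * emdenSlope β r))) (Ioi 0) := by
    refine hG.mul_bdd (c := m ^ 2 * (β ^ 2 * 2 + 2 * β)) (by fun_prop) ?_
    filter_upwards [ae_restrict_mem measurableSet_Ioi] with r (hr : 0 < r)
    have hu' := abs_le.1 (abs_emdenSlope_le β hr)
    have hv' := emdenProfile_pos β hr
    have hsq := emdenSlope_sq β hr
    rw [norm_mul, Real.norm_of_nonneg (sq_nonneg m)]
    gcongr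
    rw [Real.norm_eq_abs, abs_le]
    constructor <;> nlinarith [sq_nonneg (emdenSlope β r), mul_pos (pow_pos hβ 2) hv', sq_nonneg β,
      mul_nonneg (sq_nonneg β) (sq_nonneg (emdenSlope β r))]
  have h₂ : IntegrableOn (fun r => emdenProfile β r ^ m / r *
      (4 * m * (m + 1) * β ^ 2 * emdenProfile β r)) (Ioi 0) := by
    refine hG.mul_bdd (c := 4 * m * (m + 1) * β ^ 2 * (1 / 4)) (by fun_prop) ?_
    filter_upwards [ae_restrict_mem measurableSet_Ioi] with r (hr : 0 < r)
    have hv' := emdenProfile_pos β hr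
    rw [Real.norm_of_nonneg (by positivity)]
    gcongr
    exact emdenProfile_le β hr
  refine ⟨h₁, h₂, ?_⟩
  rw [← sub_eq_zero, ← integral_sub h₁ h₂]
  rw [integral_Ioi_of_hasDerivAt_of_tendsto
    (f := fun r => emdenProfile β r ^ m * (m * (β * emdenSlope β r - 1))) (m := 0)
    ?_ (fun r hr => hasDerivAt_emdenProfile_rpow_mul β m hr) (h₁.sub h₂) ?_]
  · simp [emdenProfile, Real.zero_rpow (mul_pos two_pos hβ).ne', Real.zero_rpow hm0.ne']
  · exact (((continuousAt_emdenProfile_zero hβ).rpow_const (Or.inr hm0.le)).mul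
      (continuousAt_const.mul ((continuousAt_const.mul
        (continuousAt_emdenSlope_zero hβ)).sub continuousAt_const))).continuousWithinAt
  · have h0 : Tendsto (fun r => emdenProfile β r ^ m) atTop (𝓝 0) := by
      simpa [Real.zero_rpow hm0.ne'] using
        (tendsto_emdenProfile_atTop hβ).rpow_const (p := m) (Or.inr hm0.le)
    refine h0.zero_mul_isBoundedUnder_le (isBoundedUnder_of_eventually_le (a := m * (β + 1)) ?_)
    filter_upwards [eventually_gt_atTop 0] with r hr
    have hu' := abs_le.1 (abs_emdenSlope_le β hr)
    simp only [Function.comp_apply, norm_mul, Real.norm_of_nonneg hm0.le]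
    gcongr
    rw [Real.norm_eq_abs, abs_le]
    constructor <;> nlinarith

/-- The radial profile of the ground state has logarithmic derivative `m (β u - 1)`. -/
lemma hasDerivAt_groundState_profile (C β m : ℝ) {r : ℝ} (hr : 0 < r) :
    HasDerivAt (fun r : ℝ => C * (r ^ (β - 1) / (1 + r ^ (2 * β))) ^ m)
      (C * (r ^ (β - 1) / (1 + r ^ (2 * β))) ^ m * (m * (β * emdenSlope β r - 1)) / r) r := by
  have hs := Real.rpow_pos_of_pos hr (2 * β)
  have ht := Real.rpow_pos_of_pos hr (β - 1)
  have h := hasDerivAt_rpow_two_mul β hr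
  have h' := Real.hasDerivAt_rpow_const (x := r) (p := β - 1) (Or.inl hr.ne')
  have hf : 0 < r ^ (β - 1) / (1 + r ^ (2 * β)) := by positivity
  refine (((h'.div (h.const_add 1) (by positivity)).rpow_const (p := m)
    (Or.inl hf.ne')).const_mul C).congr_deriv ?_
  simp only [Pi.div_apply]
  rw [Real.rpow_sub_one hf.ne', Real.rpow_sub_one hr.ne', emdenSlope]
  generalize (r ^ (β - 1) / (1 + r ^ (2 * β))) ^ m = F
  field_simp
  ring

lemma groundState_base_sq (β : ℝ) {r : ℝ} (hr : 0 < r) :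
    (r ^ (β - 1) / (1 + r ^ (2 * β))) ^ 2 = emdenProfile β r / r ^ 2 := by
  rw [Real.rpow_sub_one hr.ne', emdenProfile, mul_comm 2 β, Real.rpow_mul hr.le, Real.rpow_two]
  field_simp

lemma groundState_base_rpow (β m : ℝ) {r : ℝ} (hr : 0 < r) :
    (r ^ (β - 1) / (1 + r ^ (2 * β))) ^ (2 * m) = emdenProfile β r ^ m / r ^ (2 * m) := by
  have hs := Real.rpow_pos_of_pos hr (2 * β)
  have ht := Real.rpow_pos_of_pos hr (β - 1)
  rw [Real.rpow_mul (by positivity), Real.rpow_two, groundState_base_sq β hr,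
    Real.div_rpow (emdenProfile_pos β hr).le (by positivity), Real.rpow_mul hr.le, Real.rpow_two]

/-- The squared gradient of a radial function is the square of its radial derivative. -/
lemma sum_fderiv_comp_norm_sq {ι : Type*} [Fintype ι] [DecidableEq ι] {φ : ℝ → ℝ} {φ' : ℝ}
    {x : EuclideanSpace ℝ ι} (hx : x ≠ 0) (hφ : HasDerivAt φ φ' ‖x‖) :
    ∑ i, (fderiv ℝ (fun y : EuclideanSpace ℝ ι => φ ‖y‖) x (EuclideanSpace.single i 1)) ^ 2
      = φ' ^ 2 := by
  have hx0 : 0 < ‖x‖ := norm_pos_iff.2 hx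
  have hn : HasFDerivAt (fun y : EuclideanSpace ℝ ι => ‖y‖) (‖x‖⁻¹ • innerSL ℝ x) x := by
    have h := (hasStrictFDerivAt_norm_sq x).hasFDerivAt.sqrt (by positivity)
    simp only [Real.sqrt_sq (norm_nonneg _)] at h
    refine h.congr_fderiv ?_
    ext y
    simp only [one_div, mul_inv_rev, smul_apply, smul_eq_mul, nsmul_eq_mul, Nat.cast_ofNat]
    field_simp
  have h := hφ.comp_hasFDerivAt x hn
  change HasFDerivAt (fun y : EuclideanSpace ℝ ι => φ ‖y‖) _ x at h
  rw [h.fderiv]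
  have key : ∀ i, ((φ' • ‖x‖⁻¹ • innerSL ℝ x) (EuclideanSpace.single i 1)) ^ 2
      = φ' ^ 2 / ‖x‖ ^ 2 * x i ^ 2 := by
    intro i
    simp [EuclideanSpace.inner_single_right]
    field_simp
  rw [Finset.sum_congr rfl fun i _ => key i, ← Finset.mul_sum, ← EuclideanSpace.real_norm_sq_eq]
  field_simp

/-- For the ground state soliton `W_a`, both
`Q_a(W_a) = ∫ |∇W_a|² + (a/|x|²)W_a²` and `∫ W_a^{2d/(d-2)}` are finite, and
they are equal (the Pohozaev-type identity `Q_a(W_a) = ∫ W_a^{2d/(d-2)}`). -/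
theorem ground_state_pohozaev
    (d : ℕ) (hd : 3 ≤ d) (a : ℝ) (ha : -(((d : ℝ) - 2) / 2) ^ 2 < a)
    (β : ℝ) (hβ : β = Real.sqrt (1 + 4 * a / ((d : ℝ) - 2) ^ 2))
    (W : EuclideanSpace ℝ (Fin d) → ℝ)
    (hW : ∀ x, W x = ((d : ℝ) * ((d : ℝ) - 2) * β ^ 2) ^ (((d : ℝ) - 2) / 4) *
        (‖x‖ ^ (β - 1) / (1 + ‖x‖ ^ (2 * β))) ^ (((d : ℝ) - 2) / 2)) :
    Integrable (fun x : EuclideanSpace ℝ (Fin d) =>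
        (∑ i, (fderiv ℝ W x (EuclideanSpace.single i 1)) ^ 2)
          + a / ‖x‖ ^ 2 * (W x) ^ 2)
    ∧ Integrable (fun x : EuclideanSpace ℝ (Fin d) =>
        W x ^ (2 * (d : ℝ) / ((d : ℝ) - 2)))
    ∧ (∫ x : EuclideanSpace ℝ (Fin d),
        ((∑ i, (fderiv ℝ W x (EuclideanSpace.single i 1)) ^ 2)
          + a / ‖x‖ ^ 2 * (W x) ^ 2))
      = ∫ x : EuclideanSpace ℝ (Fin d), W x ^ (2 * (d : ℝ) / ((d : ℝ) - 2)) := by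
  have hd3 : (3 : ℝ) ≤ d := by exact_mod_cast hd
  obtain ⟨m, hm⟩ : ∃ m : ℝ, m = ((d : ℝ) - 2) / 2 := ⟨_, rfl⟩
  have hm2 : 1 / 2 ≤ m := by linarith
  have hm0 : 0 < m := by linarith
  have hdm : (d : ℝ) = 2 * (m + 1) := by linarith
  have hd2 : (d : ℝ) - 2 = 2 * m := by linarith
  have hpos : 0 < 1 + 4 * a / ((d : ℝ) - 2) ^ 2 := by
    rw [hd2] at ha ⊢
    rw [← neg_lt_iff_pos_add', lt_div_iff₀ (by positivity)]
    nlinarith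
  have hβ0 : 0 < β := hβ ▸ Real.sqrt_pos.2 hpos
  have ha' : a = m ^ 2 * (β ^ 2 - 1) := by
    rw [hβ, Real.sq_sqrt hpos.le, hd2]
    field_simp
    ring
  set K : ℝ := (d : ℝ) * ((d : ℝ) - 2) * β ^ 2 with hK
  have hKm : K = 4 * m * (m + 1) * β ^ 2 := by rw [hK, hdm]; ring
  have hK0 : 0 < K := by rw [hKm]; positivity
  set C : ℝ := K ^ (((d : ℝ) - 2) / 4) with hC
  have hC0 : 0 < C := Real.rpow_pos_of_pos hK0 _
  have hCpow : C ^ (2 * (d : ℝ) / ((d : ℝ) - 2)) = C ^ 2 * K := by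
    rw [hC, ← Real.rpow_mul hK0.le, ← Real.rpow_natCast, ← Real.rpow_mul hK0.le,
      ← Real.rpow_add_one hK0.ne', hd2, hdm]
    congr 1
    push_cast
    field_simp
    ring
  obtain ⟨φ, hφ⟩ : ∃ φ : ℝ → ℝ, φ = fun r => C * (r ^ (β - 1) / (1 + r ^ (2 * β))) ^ m :=
    ⟨_, rfl⟩
  have hWφ : W = fun x => φ ‖x‖ := by
    funext x
    rw [hW, hφ, hm]
  have hpow : ∀ r : ℝ, 0 < r → r ^ (d - 1) = r ^ (2 * m) * r := by
    intro r hr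
    rw [← Real.rpow_add_one hr.ne', ← Real.rpow_natCast, Nat.cast_sub (by lia), hdm]
    congr 1
    push_cast
    ring
  have hφsq : ∀ r : ℝ, 0 < r → φ r ^ 2 = C ^ 2 * (emdenProfile β r ^ m / r ^ (2 * m)) := by
    intro r hr
    have hs := Real.rpow_pos_of_pos hr (2 * β)
    have ht := Real.rpow_pos_of_pos hr (β - 1)
    rw [hφ, ← groundState_base_rpow β m hr, mul_pow, ← Real.rpow_two (_ ^ m),
      ← Real.rpow_mul (by positivity), mul_comm m]
  set A : ℝ → ℝ := fun r => (φ r * (m * (β * emdenSlope β r - 1)) / r) ^ 2 + a / r ^ 2 * φ r ^ 2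
    with hA
  set B : ℝ → ℝ := fun r => φ r ^ (2 * (d : ℝ) / ((d : ℝ) - 2)) with hB
  have : Nontrivial (EuclideanSpace ℝ (Fin d)) :=
    Module.nontrivial_of_finrank_pos (R := ℝ) (by simp; lia)
  have hWA : (fun x : EuclideanSpace ℝ (Fin d) =>
      (∑ i, (fderiv ℝ W x (EuclideanSpace.single i 1)) ^ 2) + a / ‖x‖ ^ 2 * (W x) ^ 2)
      =ᵐ[volume] fun x => A ‖x‖ := by
    filter_upwards [Measure.ae_ne volume (0 : EuclideanSpace ℝ (Fin d))] with x hx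
    have hr : 0 < ‖x‖ := norm_pos_iff.2 hx
    rw [hWφ, sum_fderiv_comp_norm_sq hx
      (φ' := φ ‖x‖ * (m * (β * emdenSlope β ‖x‖ - 1)) / ‖x‖)
      (by rw [hφ]; exact hasDerivAt_groundState_profile C β m hr)]
  have hAr : EqOn (fun r : ℝ => r ^ (d - 1) • A r) (fun r => C ^ 2 * (emdenProfile β r ^ m / r *
      (m ^ 2 * (β ^ 2 * (1 + emdenSlope β r ^ 2) - 2 * β * emdenSlope β r)))) (Ioi 0) := by
    intro r (hr : 0 < r)
    have hr' := Real.rpow_pos_of_pos hr (2 * m)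
    simp only [hA, smul_eq_mul]
    rw [hpow r hr, div_pow, mul_pow, hφsq r hr, ha']
    field_simp
    ring
  have hBr : EqOn (fun r : ℝ => r ^ (d - 1) • B r) (fun r => C ^ 2 * (emdenProfile β r ^ m / r *
      (4 * m * (m + 1) * β ^ 2 * emdenProfile β r))) (Ioi 0) := by
    intro r (hr : 0 < r)
    have hs := Real.rpow_pos_of_pos hr (2 * β)
    have ht := Real.rpow_pos_of_pos hr (β - 1)
    have hr' := Real.rpow_pos_of_pos hr (2 * m)
    have hexp : m * (2 * (d : ℝ) / ((d : ℝ) - 2)) = 2 * (m + 1) := by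
      rw [hd2, hdm]
      field_simp
    simp only [hB, smul_eq_mul]
    rw [hpow r hr, hφ, Real.mul_rpow hC0.le (by positivity),
      ← Real.rpow_mul (x := r ^ (β - 1) / (1 + r ^ (2 * β))) (by positivity), hexp,
      groundState_base_rpow β (m + 1) hr, hCpow, Real.rpow_add_one (emdenProfile_pos β hr).ne',
      mul_add, Real.rpow_add hr, mul_one, Real.rpow_two, hKm]
    field_simp
  obtain ⟨hintA, hintB, heq⟩ := integral_emdenProfile_rpow_mul_eq hβ0 hm2
  have hWB : (fun x : EuclideanSpace ℝ (Fin d) => W x ^ (2 * (d : ℝ) / ((d : ℝ) - 2)))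
      = fun x => B ‖x‖ := by rw [hWφ]
  rw [integrable_congr hWA, integral_congr_ae hWA, hWB,
    integrable_fun_norm_addHaar volume, integrable_fun_norm_addHaar volume,
    integral_fun_norm_addHaar volume, integral_fun_norm_addHaar volume]
  simp only [finrank_euclideanSpace, Fintype.card_fin]
  rw [integrableOn_congr_fun hAr measurableSet_Ioi, integrableOn_congr_fun hBr measurableSet_Ioi,
    setIntegral_congr_fun measurableSet_Ioi hAr, setIntegral_congr_fun measurableSet_Ioi hBr,
    integral_const_mul, integral_const_mul, heq]
  exact ⟨hintA.const_mul _, hintB.const_mul _, rfl⟩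
end

section
/- Let d ≥ 3 be an integer, set β := √(1 + 4a/(d-2)²), and define w : (0,∞) → ℝ by w(r) := (d(d-2)β²)^{(d-2)/4} · r^{(d-2)β/2} / (1 + r^{2β})^{(d-2)/2} (i.e. w(r) = r^{(d-2)/2} W_a(x) for |x| = r). Then for a > -((d-2)/2)² and every r > 0, w satisfies the first-order conservation law r² w'(r)² = (((d-2)/2)² + a) w(r)² - ((d-2)/d) w(r)^{2d/(d-2)}. -/
/-- Derivative of `r ↦ c r^{nβ/2} / (1 + r^{2β})^{n/2}`. -/
lemma hasDerivAt_bubble (c n β : ℝ) {r : ℝ} (hr : 0 < r) :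
    HasDerivAt (fun s : ℝ => c * s ^ (n * β / 2) / (1 + s ^ (2 * β)) ^ (n / 2))
      (c * r ^ (n * β / 2) / (1 + r ^ (2 * β)) ^ (n / 2) *
        (n * β / 2 * ((1 - r ^ (2 * β)) / (1 + r ^ (2 * β)))) / r) r := by
  have ht : 0 < r ^ (2 * β) := Real.rpow_pos_of_pos hr _
  have hq : 0 < 1 + r ^ (2 * β) := by linarith
  have hnum := (Real.hasDerivAt_rpow_const (p := n * β / 2) (Or.inl hr.ne')).const_mul c
  have hden := ((Real.hasDerivAt_rpow_const (p := 2 * β) (Or.inl hr.ne')).const_add 1).rpow_const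
    (p := n / 2) (Or.inl hq.ne')
  have hD : (1 + r ^ (2 * β)) ^ (n / 2) ≠ 0 := (Real.rpow_pos_of_pos hq _).ne'
  refine (hnum.fun_div hden hD).congr_deriv ?_
  rw [Real.rpow_sub_one hr.ne', Real.rpow_sub_one hr.ne', Real.rpow_sub_one hq.ne']
  field_simp
  ring

/-- The power `4/n` of `K^{n/4} r^{nβ/2} / (1 + r^{2β})^{n/2}`. -/
lemma bubble_rpow_four_div {K n r : ℝ} (β : ℝ) (hK : 0 < K) (hn : 0 < n) (hr : 0 < r) :
    (K ^ (n / 4) * r ^ (n * β / 2) / (1 + r ^ (2 * β)) ^ (n / 2)) ^ (4 / n) =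
      K * r ^ (2 * β) / (1 + r ^ (2 * β)) ^ 2 := by
  have hq : 0 < 1 + r ^ (2 * β) := by positivity
  rw [Real.div_rpow (by positivity) (by positivity), Real.mul_rpow (by positivity) (by positivity),
    ← Real.rpow_mul hK.le, ← Real.rpow_mul hr.le, ← Real.rpow_mul hq.le,
    show n / 4 * (4 / n) = 1 by field_simp, show n * β / 2 * (4 / n) = 2 * β by field_simp; ring,
    show n / 2 * (4 / n) = (2 : ℕ) by field_simp; norm_num, Real.rpow_one, Real.rpow_natCast]

/-- The radial profile `w(r) = r^{(d-2)/2} W_a(r)`, i.e.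
`w(r) = (d(d-2)β²)^{(d-2)/4} r^{(d-2)β/2}/(1+r^{2β})^{(d-2)/2}`, satisfies the
zero-energy first integral
`r² w'(r)² = (((d-2)/2)² + a) w(r)² - ((d-2)/d) w(r)^{2d/(d-2)}` for `r > 0`. -/
theorem ground_state_radial_conservation_law
    (d : ℕ) (hd : 3 ≤ d) (a : ℝ) (ha : -(((d : ℝ) - 2) / 2) ^ 2 < a)
    (β : ℝ) (hβ : β = Real.sqrt (1 + 4 * a / ((d : ℝ) - 2) ^ 2))
    (w : ℝ → ℝ)
    (hw : ∀ r : ℝ, 0 < r →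
      w r = ((d : ℝ) * ((d : ℝ) - 2) * β ^ 2) ^ (((d : ℝ) - 2) / 4) *
        r ^ (((d : ℝ) - 2) * β / 2) / (1 + r ^ (2 * β)) ^ (((d : ℝ) - 2) / 2)) :
    ∀ r : ℝ, 0 < r →
      r ^ 2 * (deriv w r) ^ 2
        = ((((d : ℝ) - 2) / 2) ^ 2 + a) * (w r) ^ 2
          - (((d : ℝ) - 2) / (d : ℝ)) * (w r) ^ (2 * (d : ℝ) / ((d : ℝ) - 2)) := by
  intro r hr
  have hd' : (3 : ℝ) ≤ d := by exact_mod_cast hd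
  have hd0 : 0 < (d : ℝ) := by linarith
  have hn : 0 < (d : ℝ) - 2 := by linarith
  have hpos : 0 < 1 + 4 * a / ((d : ℝ) - 2) ^ 2 := by
    rw [← mul_pos_iff_of_pos_left (pow_pos hn 2), mul_add, mul_div_cancel₀ _ (pow_pos hn 2).ne']
    linarith
  have hβ2 : β ^ 2 = 1 + 4 * a / ((d : ℝ) - 2) ^ 2 := by rw [hβ, Real.sq_sqrt hpos.le]
  have hcoef : (((d : ℝ) - 2) / 2) ^ 2 + a = (((d : ℝ) - 2) * β / 2) ^ 2 := by
    rw [div_pow (_ * _), mul_pow, hβ2]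
    field_simp
    ring
  have hK : 0 < (d : ℝ) * ((d : ℝ) - 2) * β ^ 2 := by
    rw [hβ2]
    positivity
  have hderiv : deriv w r = w r * (((d : ℝ) - 2) * β / 2 *
      ((1 - r ^ (2 * β)) / (1 + r ^ (2 * β)))) / r := by
    rw [hw r hr]
    refine ((hasDerivAt_bubble _ _ β hr).congr_of_eventuallyEq ?_).deriv
    filter_upwards [lt_mem_nhds hr] with s hs using hw s hs
  have hwpos : 0 < w r := by
    rw [hw r hr]
    positivity
  have hpow : w r ^ (2 * (d : ℝ) / ((d : ℝ) - 2)) = w r ^ 2 *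
      ((d : ℝ) * ((d : ℝ) - 2) * β ^ 2 * r ^ (2 * β) / (1 + r ^ (2 * β)) ^ 2) := by
    rw [← bubble_rpow_four_div β hK hn hr, ← hw r hr, ← Real.rpow_natCast,
      ← Real.rpow_add hwpos]
    congr 1
    field_simp
    push_cast
    ring
  have hq : 1 + r ^ (2 * β) ≠ 0 := by positivity
  rw [hpow, hderiv, hcoef]
  field_simp
  ring
end

section
/- Let d ≥ 3 be an integer and let a satisfy -((d-2)/2)² < a < 0. Set β := √(1 + 4a/(d-2)²) and W_a(x) := (d(d-2)β²)^{(d-2)/4} · (|x|^{β-1}/(1+|x|^{2β}))^{(d-2)/2}. Then for every f ∈ C_c^∞(ℝ^d \ {0}; ℂ) one has the sharp Sobolev inequality (∫_{ℝ^d} |f|^{2d/(d-2)} dx)^{(d-2)/(2d)} ≤ (∫_{ℝ^d} W_a^{2d/(d-2)} dx)^{(d-2)/(2d)} · Q_a(W_a)^{-1/2} · Q_a(f)^{1/2}, where Q_a(g) := ∫_{ℝ^d} (|∇g(x)|² + (a/|x|²)|g(x)|²) dx. -/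
open MeasureTheory

theorem strictMono_intervalIntegral {γ : ℝ → ℝ} (hγ : Continuous γ) (hpos : ∀ t, 0 < γ t) (b : ℝ) :
    StrictMono fun t => ∫ r in b..t, γ r := by
  intro s t hst
  have h := intervalIntegral.integral_add_adjacent_intervals
    (hγ.intervalIntegrable (μ := volume) b s) (hγ.intervalIntegrable s t)
  have h' := intervalIntegral.intervalIntegral_pos_of_pos
    (hγ.intervalIntegrable (μ := volume) s t) hpos hst
  change (∫ r in b..s, γ r) < ∫ r in b..t, γ r
  linarith

/-- Existence of the monotone rearrangement value between two positive densities on intervals. -/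
theorem exists_transport_value {α γ : ℝ → ℝ} (hα : Continuous α) (hγ : Continuous γ)
    (hα0 : ∀ s, 0 < α s) (hγ0 : ∀ t, 0 < γ t) {L R s : ℝ} (hR : 0 < R)
    (hs : s ∈ Set.Ioo (-L) L) :
    ∃ t ∈ Set.Ioo (-R) R, (∫ r in (-R)..t, γ r) * (∫ r in (-L)..L, α r)
      = (∫ r in (-L)..s, α r) * ∫ r in (-R)..R, γ r := by
  have hA := strictMono_intervalIntegral hα hα0 (-L)
  have hG := strictMono_intervalIntegral hγ hγ0 (-R)
  have h0 : 0 < ∫ r in (-L)..s, α r := by simpa using hA hs.1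
  have h1 : (∫ r in (-L)..s, α r) < ∫ r in (-L)..L, α r := hA hs.2
  have h2 : 0 < ∫ r in (-R)..R, γ r := by simpa using hG (show -R < R by linarith)
  have hc : ContinuousOn (fun t => (∫ r in (-R)..t, γ r) * (∫ r in (-L)..L, α r))
      (Set.Icc (-R) R) :=
    ((intervalIntegral.continuous_primitive (fun a b => hγ.intervalIntegrable a b) _).mul
      continuous_const).continuousOn
  have := intermediate_value_Ioo (show -R ≤ R by linarith) hc
  obtain ⟨t, ht, e⟩ := this (show (∫ r in (-L)..s, α r) * ∫ r in (-R)..R, γ r ∈ _ by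
    constructor
    · simp only [intervalIntegral.integral_same, zero_mul]; positivity
    · rw [mul_comm]; exact mul_lt_mul_of_pos_left h1 h2)
  exact ⟨t, ht, e⟩

theorem strictMonoOn_transport {α γ : ℝ → ℝ} (hα : Continuous α) (hγ : Continuous γ)
    (hα0 : ∀ s, 0 < α s) (hγ0 : ∀ t, 0 < γ t) {L R : ℝ} (hL : 0 < L) (hR : 0 < R) {τ : ℝ → ℝ}
    (hτ : ∀ s ∈ Set.Ioo (-L) L, τ s ∈ Set.Ioo (-R) R ∧
      (∫ r in (-R)..(τ s), γ r) * (∫ r in (-L)..L, α r)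
      = (∫ r in (-L)..s, α r) * ∫ r in (-R)..R, γ r) : StrictMonoOn τ (Set.Ioo (-L) L) := by
  have hA := strictMono_intervalIntegral hα hα0 (-L)
  have hG := strictMono_intervalIntegral hγ hγ0 (-R)
  have h1 : 0 < ∫ r in (-L)..L, α r := by simpa using hA (show -L < L by linarith)
  have h2 : 0 < ∫ r in (-R)..R, γ r := by simpa using hG (show -R < R by linarith)
  intro s hs t ht hst
  rw [← hG.lt_iff_lt]
  have h3 := mul_lt_mul_of_pos_right (hA hst) h2
  simp only at h3
  rw [← (hτ s hs).2, ← (hτ t ht).2] at h3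
  exact lt_of_mul_lt_mul_right h3 h1.le

theorem image_transport {α γ : ℝ → ℝ} (hα : Continuous α) (hγ : Continuous γ)
    (hα0 : ∀ s, 0 < α s) (hγ0 : ∀ t, 0 < γ t) {L R : ℝ} (hL : 0 < L) {τ : ℝ → ℝ}
    (hτ : ∀ s ∈ Set.Ioo (-L) L, τ s ∈ Set.Ioo (-R) R ∧
      (∫ r in (-R)..(τ s), γ r) * (∫ r in (-L)..L, α r)
      = (∫ r in (-L)..s, α r) * ∫ r in (-R)..R, γ r) : τ '' Set.Ioo (-L) L = Set.Ioo (-R) R := by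
  have hG := strictMono_intervalIntegral hγ hγ0 (-R)
  have hA := strictMono_intervalIntegral hα hα0 (-L)
  have h1 : 0 < ∫ r in (-L)..L, α r := by simpa using hA (show -L < L by linarith)
  refine Set.Subset.antisymm ?_ ?_
  · rintro _ ⟨s, hs, rfl⟩; exact (hτ s hs).1
  · intro t ht
    obtain ⟨s, hs, e⟩ := exists_transport_value hγ hα hγ0 hα0 hL ht
    refine ⟨s, hs, hG.injective ?_⟩
    have := (hτ s hs).2
    rw [e] at this
    exact mul_right_cancel₀ h1.ne' this

theorem hasDerivAt_transport {α γ : ℝ → ℝ} (hα : Continuous α) (hγ : Continuous γ)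
    (hα0 : ∀ s, 0 < α s) (hγ0 : ∀ t, 0 < γ t) {L R : ℝ} (hL : 0 < L) (hR : 0 < R) {τ : ℝ → ℝ}
    (hτ : ∀ s ∈ Set.Ioo (-L) L, τ s ∈ Set.Ioo (-R) R ∧
      (∫ r in (-R)..(τ s), γ r) * (∫ r in (-L)..L, α r)
      = (∫ r in (-L)..s, α r) * ∫ r in (-R)..R, γ r) {s : ℝ} (hs : s ∈ Set.Ioo (-L) L) :
    HasDerivAt τ (α s * (∫ r in (-R)..R, γ r) / ((∫ r in (-L)..L, α r) * γ (τ s))) s := by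
  have hA := strictMono_intervalIntegral hα hα0 (-L)
  have hG := strictMono_intervalIntegral hγ hγ0 (-R)
  have h1 : 0 < ∫ r in (-L)..L, α r := by simpa using hA (show -L < L by linarith)
  have h2 : 0 < ∫ r in (-R)..R, γ r := by simpa using hG (show -R < R by linarith)
  have hmono := strictMonoOn_transport hα hγ hα0 hγ0 hL hR hτ
  have him := image_transport hα hγ hα0 hγ0 hL hτ
  have hcont : ContinuousAt τ s := hmono.continuousAt_of_image_mem_nhds (Ioo_mem_nhds hs.1 hs.2)
    (by rw [him]; exact Ioo_mem_nhds (hτ s hs).1.1 (hτ s hs).1.2)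
  have dA : ∀ s, HasDerivAt (fun u => ∫ r in (-L)..u, α r) (α s) s := fun s =>
    intervalIntegral.integral_hasDerivAt_right (hα.intervalIntegrable _ _)
      hα.aestronglyMeasurable.stronglyMeasurableAtFilter hα.continuousAt
  have dG : ∀ s, HasDerivAt (fun u => ∫ r in (-R)..u, γ r) (γ s) s := fun s =>
    intervalIntegral.integral_hasDerivAt_right (hγ.intervalIntegrable _ _)
      hγ.aestronglyMeasurable.stronglyMeasurableAtFilter hγ.continuousAt
  have he : ∀ᶠ u in nhds s, (∫ r in (-R)..(τ u), γ r)
      = (∫ r in (-L)..u, α r) * (∫ r in (-R)..R, γ r) / ∫ r in (-L)..L, α r := by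
    filter_upwards [Ioo_mem_nhds hs.1 hs.2] with u hu
    rw [eq_div_iff h1.ne']; exact (hτ u hu).2
  have hsl := hasDerivAt_iff_tendsto_slope.1 (dG (τ s))
  have hτn : Filter.Tendsto τ (nhdsWithin s {s}ᶜ) (nhdsWithin (τ s) {τ s}ᶜ) := by
    refine tendsto_nhdsWithin_iff.2 ⟨hcont.tendsto.mono_left nhdsWithin_le_nhds, ?_⟩
    filter_upwards [self_mem_nhdsWithin, nhdsWithin_le_nhds (Ioo_mem_nhds hs.1 hs.2)] with u hu hu'
    exact fun h => hu (hmono.injOn hu' hs h)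
  have hlim := (hasDerivAt_iff_tendsto_slope.1 (((dA s).mul_const (∫ r in (-R)..R, γ r)).div_const
    (∫ r in (-L)..L, α r))).div (hsl.comp hτn) (hγ0 _).ne'
  rw [hasDerivAt_iff_tendsto_slope, ← div_div]
  refine hlim.congr' ?_
  filter_upwards [self_mem_nhdsWithin, nhdsWithin_le_nhds (Ioo_mem_nhds hs.1 hs.2),
    nhdsWithin_le_nhds he] with u hu hu' hu2
  have e1 : u - s ≠ 0 := sub_ne_zero.2 hu
  have e2 : τ u - τ s ≠ 0 := sub_ne_zero.2 fun h => hu (hmono.injOn hu' hs h)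
  have e3 : (∫ r in (-R)..(τ u), γ r) - (∫ r in (-R)..(τ s), γ r) ≠ 0 :=
    sub_ne_zero.2 fun h => hu (hmono.injOn hu' hs (hG.injective h))
  simp only [Pi.div_apply, Function.comp_apply, slope_def_field]
  rw [← hu2, ← he.self_of_nhds]
  field_simp

theorem lintegral_transport {α γ : ℝ → ℝ} (hα : Continuous α) (hγ : Continuous γ)
    (hα0 : ∀ s, 0 < α s) (hγ0 : ∀ t, 0 < γ t) {L R : ℝ} (hL : 0 < L) (hR : 0 < R) {τ : ℝ → ℝ}
    (hτ : ∀ s ∈ Set.Ioo (-L) L, τ s ∈ Set.Ioo (-R) R ∧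
      (∫ r in (-R)..(τ s), γ r) * (∫ r in (-L)..L, α r)
      = (∫ r in (-L)..s, α r) * ∫ r in (-R)..R, γ r) (h : ℝ → ENNReal) :
    ∫⁻ s in Set.Ioo (-L) L, ENNReal.ofReal (α s * (∫ r in (-R)..R, γ r) / ∫ r in (-L)..L, α r) *
      h (τ s) = ∫⁻ t in Set.Ioo (-R) R, ENNReal.ofReal (γ t) * h t := by
  have hmono := strictMonoOn_transport hα hγ hα0 hγ0 hL hR hτ
  have him := image_transport hα hγ hα0 hγ0 hL hτ
  have hA := strictMono_intervalIntegral hα hα0 (-L)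
  have hG := strictMono_intervalIntegral hγ hγ0 (-R)
  have h1 : 0 < ∫ r in (-L)..L, α r := by simpa using hA (show -L < L by linarith)
  have h2 : 0 < ∫ r in (-R)..R, γ r := by simpa using hG (show -R < R by linarith)
  rw [← him, lintegral_image_eq_lintegral_deriv_mul_of_monotoneOn measurableSet_Ioo
    (fun s hs => (hasDerivAt_transport hα hγ hα0 hγ0 hL hR hτ hs).hasDerivWithinAt)
    hmono.monotoneOn]
  refine setLIntegral_congr_fun measurableSet_Ioo fun s hs => ?_
  have := hα0 s
  have := hγ0 (τ s)
  rw [← mul_assoc, ← ENNReal.ofReal_mul (by positivity)]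
  congr 2
  field_simp

/-- The open cube `(-L, L)^n`. -/
def openCube (n : ℕ) (L : ℝ) : Set (Fin n → ℝ) := {x | ∀ i, x i ∈ Set.Ioo (-L) L}

theorem isOpen_openCube (n : ℕ) (L : ℝ) : IsOpen (openCube n L) := by
  have : openCube n L = Set.univ.pi fun _ => Set.Ioo (-L) L := by ext; simp [openCube]
  rw [this]
  exact isOpen_set_pi Set.finite_univ fun _ _ => isOpen_Ioo

theorem measurableSet_openCube (n : ℕ) (L : ℝ) : MeasurableSet (openCube n L) :=
  (isOpen_openCube n L).measurableSet

theorem openCube_subset_Icc (n : ℕ) (L : ℝ) :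
    openCube n L ⊆ Set.Icc (fun _ => -L) (fun _ => L) :=
  fun _ hx => ⟨fun i => (hx i).1.le, fun i => (hx i).2.le⟩

theorem snoc_mem_openCube {n : ℕ} {L : ℝ} {x : Fin n → ℝ} {s : ℝ} :
    (Fin.snoc x s : Fin (n + 1) → ℝ) ∈ openCube (n + 1) L ↔
      x ∈ openCube n L ∧ s ∈ Set.Ioo (-L) L := by
  simp only [openCube, Set.mem_ofPred_eq, Fin.forall_fin_succ', Fin.snoc_castSucc, Fin.snoc_last]

theorem continuous_snoc (n : ℕ) :
    Continuous fun z : (Fin n → ℝ) × ℝ => (Fin.snoc z.1 z.2 : Fin (n + 1) → ℝ) :=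
  Continuous.finSnoc (A := fun _ => ℝ) continuous_fst continuous_snd

theorem continuous_init (n : ℕ) :
    Continuous fun x : Fin (n + 1) → ℝ => (Fin.init x : Fin n → ℝ) :=
  continuous_pi fun i => continuous_apply i.castSucc

/-- Tonelli on the cube, integrating the last coordinate first. -/
theorem lintegral_openCube_succ (n : ℕ) (L : ℝ) {h : (Fin (n + 1) → ℝ) → ENNReal}
    (hh : Measurable h) :
    ∫⁻ x in openCube (n + 1) L, h x
      = ∫⁻ x in openCube n L, ∫⁻ s in Set.Ioo (-L) L, h (Fin.snoc x s) := by
  have hmp := (volume_preserving_piFinSuccAbove (fun _ : Fin (n + 1) => ℝ) (Fin.last n)).symm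
  have hset : (MeasurableEquiv.piFinSuccAbove (fun _ : Fin (n + 1) => ℝ) (Fin.last n)).symm ⁻¹'
      openCube (n + 1) L = Set.Ioo (-L) L ×ˢ openCube n L := by
    ext z
    have : (MeasurableEquiv.piFinSuccAbove (fun _ : Fin (n + 1) => ℝ) (Fin.last n)).symm z
      = Fin.snoc z.2 z.1 := Fin.insertNth_last' z.1 z.2
    rw [Set.mem_preimage, this, snoc_mem_openCube, Set.mem_prod, and_comm]
  rw [← hmp.setLIntegral_comp_preimage_emb (MeasurableEquiv.measurableEmbedding _), hset,
    Measure.volume_eq_prod, setLIntegral_prod_symm]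
  · refine lintegral_congr fun x => lintegral_congr fun s => ?_
    congr 1
    exact Fin.insertNth_last' s x
  · exact (hh.comp (MeasurableEquiv.measurable _)).aemeasurable

/-- A Knothe-type triangular transport map between positive continuous densities on cubes. -/
theorem exists_triangular_transport {L R : ℝ} (hL : 0 < L) (hR : 0 < R) (n : ℕ) :
    ∀ F G : (Fin n → ℝ) → ℝ, Continuous F → Continuous G → (∀ x, 0 < F x) → (∀ x, 0 < G x) →
    ∃ (T : (Fin n → ℝ) → Fin n → ℝ) (J : Fin n → (Fin n → ℝ) → ℝ) (κ C : ℝ), 0 < κ ∧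
      Measurable T ∧ (∀ i, Measurable (J i)) ∧
      (∀ x ∈ openCube n L, T x ∈ openCube n R ∧ (∀ i, 0 < J i x ∧ J i x ≤ C) ∧
        (∀ i, HasLineDerivAt ℝ (fun z => T z i) (J i x) x (Pi.single i 1)) ∧
        (∏ i, J i x) * G (T x) = κ * F x) ∧
      ∀ h : (Fin n → ℝ) → ENNReal, Measurable h →
        ∫⁻ x in openCube n L, ENNReal.ofReal (κ * F x) * h (T x)
          = ∫⁻ y in openCube n R, ENNReal.ofReal (G y) * h y := by
  classical
  induction n with
  | zero =>
    intro F G _ _ hF0 hG0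
    refine ⟨id, fun i => i.elim0, G 0 / F 0, 0, div_pos (hG0 _) (hF0 _), measurable_id,
      fun i => i.elim0, fun x _ => ⟨fun i => i.elim0, fun i => i.elim0, fun i => i.elim0, ?_⟩, ?_⟩
    · rw [Subsingleton.elim (id x) 0, Subsingleton.elim x 0]
      have := (hF0 0).ne'
      simp only [Finset.univ_eq_empty, Finset.prod_empty, one_mul]; field_simp
    · intro h _
      have e : openCube 0 L = openCube 0 R := by ext x; simp [openCube]
      rw [e]
      refine lintegral_congr fun x => ?_
      rw [Subsingleton.elim x 0]
      have := (hF0 0).ne'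
      congr 2
      field_simp
  | succ n ih =>
    intro F G hF hG hF0 hG0
    have hFs : Continuous fun z : (Fin n → ℝ) × ℝ => F (Fin.snoc z.1 z.2) :=
      hF.comp (continuous_snoc n)
    have hGs : Continuous fun z : (Fin n → ℝ) × ℝ => G (Fin.snoc z.1 z.2) :=
      hG.comp (continuous_snoc n)
    set F' : (Fin n → ℝ) → ℝ := fun x => ∫ s in (-L)..L, F (Fin.snoc x s) with hF'
    set G' : (Fin n → ℝ) → ℝ := fun x => ∫ s in (-R)..R, G (Fin.snoc x s) with hG'
    have cF' : Continuous F' :=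
      intervalIntegral.continuous_parametric_intervalIntegral_of_continuous' hFs _ _
    have cG' : Continuous G' :=
      intervalIntegral.continuous_parametric_intervalIntegral_of_continuous' hGs _ _
    have hFx : ∀ x : Fin n → ℝ, Continuous fun s : ℝ => F (Fin.snoc x s) := fun x =>
      hFs.comp (Continuous.prodMk_right x)
    have hGx : ∀ x : Fin n → ℝ, Continuous fun s : ℝ => G (Fin.snoc x s) := fun x =>
      hGs.comp (Continuous.prodMk_right x)
    have pF' : ∀ x, 0 < F' x := fun x =>
      intervalIntegral.intervalIntegral_pos_of_pos ((hFx x).intervalIntegrable _ _)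
        (fun s => hF0 _) (by linarith)
    have pG' : ∀ x, 0 < G' x := fun x =>
      intervalIntegral.intervalIntegral_pos_of_pos ((hGx x).intervalIntegrable _ _)
        (fun s => hG0 _) (by linarith)
    obtain ⟨T', J', κ, C', hκ, mT', mJ', hT', push'⟩ := ih F' G' cF' cG' pF' pG'
    have hex : ∀ x : Fin n → ℝ, ∀ s : ℝ, ∃ t, s ∈ Set.Ioo (-L) L → t ∈ Set.Ioo (-R) R ∧
        (∫ r in (-R)..t, G (Fin.snoc (T' x) r)) * F' x
          = (∫ r in (-L)..s, F (Fin.snoc x r)) * G' (T' x) := by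
      intro x s
      by_cases hs : s ∈ Set.Ioo (-L) L
      · obtain ⟨t, ht⟩ := exists_transport_value (hFx x) (hGx (T' x)) (fun s => hF0 _)
          (fun s => hG0 _) hR hs
        exact ⟨t, fun _ => ht⟩
      · exact ⟨0, fun h => absurd h hs⟩
    choose τ₀ hτ₀ using hex
    set τ : (Fin n → ℝ) → ℝ → ℝ := fun x s => if s ∈ Set.Ioo (-L) L then τ₀ x s else 0 with hτdef
    have hτ : ∀ x, ∀ s ∈ Set.Ioo (-L) L, τ x s ∈ Set.Ioo (-R) R ∧
        (∫ r in (-R)..(τ x s), G (Fin.snoc (T' x) r)) * F' x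
          = (∫ r in (-L)..s, F (Fin.snoc x r)) * G' (T' x) := by
      intro x s hs
      simp only [hτdef, if_pos hs]
      exact hτ₀ x s hs
    have mτ : Measurable fun z : (Fin n → ℝ) × ℝ => τ z.1 z.2 := by
      have mIoo : MeasurableSet {z : (Fin n → ℝ) × ℝ | z.2 ∈ Set.Ioo (-L) L} :=
        measurable_snd measurableSet_Ioo
      refine measurable_of_Iic fun c => ?_
      have e : (fun z : (Fin n → ℝ) × ℝ => τ z.1 z.2) ⁻¹' Set.Iic c
          = ({z | z.2 ∈ Set.Ioo (-L) L} ∩ {z | (∫ r in (-L)..z.2, F (Fin.snoc z.1 r)) * G' (T' z.1)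
              ≤ (∫ r in (-R)..c, G (Fin.snoc (T' z.1) r)) * F' z.1})
            ∪ ({z | z.2 ∈ Set.Ioo (-L) L}ᶜ ∩ {_z | 0 ≤ c}) := by
        ext z
        by_cases hz : z.2 ∈ Set.Ioo (-L) L
        · simp only [Set.mem_preimage, Set.mem_Iic, Set.mem_union, Set.mem_inter_iff,
            Set.mem_ofPred_eq, Set.mem_compl_iff, hz, true_and, not_true_eq_false, false_and,
            or_false]
          rw [← (hτ z.1 z.2 hz).2, mul_le_mul_iff_left₀ (pF' _)]
          exact (StrictMono.le_iff_le (strictMono_intervalIntegral (hGx (T' z.1))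
            (fun s => hG0 _) (-R))).symm
        · simp only [Set.mem_preimage, Set.mem_Iic, Set.mem_union, Set.mem_inter_iff,
            Set.mem_ofPred_eq, Set.mem_compl_iff, hz, false_and, not_false_eq_true, true_and,
            false_or, hτdef, if_false]
      rw [e]
      have m1 : Continuous fun z : (Fin n → ℝ) × ℝ => ∫ r in (-L)..z.2, F (Fin.snoc z.1 r) :=
        intervalIntegral.continuous_parametric_intervalIntegral_of_continuous
          (f := fun (z : (Fin n → ℝ) × ℝ) r => F (Fin.snoc z.1 r))
          (hFs.comp ((continuous_fst.comp continuous_fst).prodMk continuous_snd)) continuous_snd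
      have m2 : Continuous fun y : Fin n → ℝ => ∫ r in (-R)..c, G (Fin.snoc y r) :=
        intervalIntegral.continuous_parametric_intervalIntegral_of_continuous' hGs _ _
      have mT1 : Measurable fun z : (Fin n → ℝ) × ℝ => T' z.1 := mT'.comp measurable_fst
      refine (mIoo.inter (measurableSet_le ?_ ?_)).union (mIoo.compl.inter (.const _))
      · exact m1.measurable.mul (cG'.measurable.comp mT1)
      · exact (m2.measurable.comp mT1).mul (cF'.measurable.comp measurable_fst)
    have minit : Measurable fun x : Fin (n + 1) → ℝ => (Fin.init x : Fin n → ℝ) :=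
      (continuous_init n).measurable
    set T : (Fin (n + 1) → ℝ) → Fin (n + 1) → ℝ := fun x =>
      Fin.snoc (T' (Fin.init x)) (τ (Fin.init x) (x (Fin.last n))) with hTdef
    have mT : Measurable T := (continuous_snoc n).measurable.comp
      ((mT'.comp minit).prodMk (mτ.comp (minit.prodMk (measurable_pi_apply _))))
    set Jl : (Fin (n + 1) → ℝ) → ℝ := fun x =>
      F x * G' (T' (Fin.init x)) / (F' (Fin.init x) * G (T x)) with hJl
    have mJl : Measurable Jl :=
      (hF.measurable.mul (cG'.measurable.comp (mT'.comp minit))).div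
        ((cF'.measurable.comp minit).mul (hG.measurable.comp mT))
    obtain ⟨Cl, hCl⟩ : ∃ Cl, ∀ x ∈ openCube (n + 1) L, ∀ y ∈ openCube (n + 1) R,
        F x * G' (Fin.init y) / (F' (Fin.init x) * G y) ≤ Cl := by
      have hc : Continuous fun z : (Fin (n + 1) → ℝ) × (Fin (n + 1) → ℝ) =>
          F z.1 * G' (Fin.init z.2) / (F' (Fin.init z.1) * G z.2) := by
        refine Continuous.div ?_ ?_ fun z => (mul_pos (pF' _) (hG0 _)).ne'
        · exact (hF.comp continuous_fst).mul (cG'.comp ((continuous_init n).comp continuous_snd))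
        · exact (cF'.comp ((continuous_init n).comp continuous_fst)).mul (hG.comp continuous_snd)
      obtain ⟨Cl, hCl⟩ := ((isCompact_Icc (a := fun _ : Fin (n + 1) => -L) (b := fun _ => L)).prod
        (isCompact_Icc (a := fun _ : Fin (n + 1) => -R) (b := fun _ => R))).bddAbove_image
          hc.continuousOn
      exact ⟨Cl, fun x hx y hy => hCl ⟨(x, y), ⟨openCube_subset_Icc _ _ hx,
        openCube_subset_Icc _ _ hy⟩, rfl⟩⟩
    refine ⟨T, Fin.snoc (α := fun _ => (Fin (n + 1) → ℝ) → ℝ) (fun i x => J' i (Fin.init x)) Jl,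
      κ, max C' Cl, hκ, mT, ?_, ?_, ?_⟩
    · intro i
      refine Fin.lastCases ?_ (fun j => ?_) i
      · simpa using mJl
      · rw [Fin.snoc_castSucc]; exact (mJ' j).comp minit
    · intro x hx
      have hx' : Fin.init x ∈ openCube n L ∧ x (Fin.last n) ∈ Set.Ioo (-L) L := by
        rw [← snoc_mem_openCube, Fin.snoc_init_self]; exact hx
      have hT := hT' _ hx'.1
      have hTx : T x ∈ openCube (n + 1) R :=
        snoc_mem_openCube.2 ⟨hT.1, (hτ _ _ hx'.2).1⟩
      refine ⟨hTx, ?_, ?_, ?_⟩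
      · intro i
        refine Fin.lastCases ?_ (fun j => ?_) i
        · rw [Fin.snoc_last]
          refine ⟨div_pos (mul_pos (hF0 _) (pG' _)) (mul_pos (pF' _) (hG0 _)), ?_⟩
          have := hCl x hx (T x) hTx
          rw [show Fin.init (T x) = T' (Fin.init x) from Fin.init_snoc _ _] at this
          exact this.trans (le_max_right _ _)
        · rw [Fin.snoc_castSucc]
          exact ⟨(hT.2.1 j).1, (hT.2.1 j).2.trans (le_max_left _ _)⟩
      · intro i
        refine Fin.lastCases ?_ (fun j => ?_) i
        · rw [Fin.snoc_last]
          have key := hasDerivAt_transport (hFx (Fin.init x)) (hGx (T' (Fin.init x)))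
            (fun s => hF0 _) (fun s => hG0 _) hL hR (hτ (Fin.init x)) hx'.2
          have e : ∀ t : ℝ, T (x + t • Pi.single (Fin.last n) 1) (Fin.last n)
              = τ (Fin.init x) (x (Fin.last n) + t) := by
            intro t
            have e1 : (Fin.init (x + t • Pi.single (Fin.last n) (1 : ℝ)) : Fin n → ℝ)
                = Fin.init x := by
              ext j; simp [Fin.init]
            simp only [hTdef, Fin.snoc_last, e1]
            simp
          unfold HasLineDerivAt
          simp only [e]
          have hs := Fin.snoc_init_self (α := fun _ => ℝ) x
          rw [hs] at key
          refine HasDerivAt.comp_const_add _ _ ?_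
          rw [add_zero]
          exact key
        · rw [Fin.snoc_castSucc]
          have key := hT.2.2.1 j
          have e : ∀ t : ℝ, T (x + t • Pi.single j.castSucc 1) j.castSucc
              = T' (Fin.init x + t • Pi.single j 1) j := by
            intro t
            have e1 : (Fin.init (x + t • Pi.single j.castSucc (1 : ℝ)) : Fin n → ℝ)
                = Fin.init x + t • Pi.single j 1 := by
              ext k
              simp [Fin.init, Pi.single_apply]
            simp only [hTdef, Fin.snoc_castSucc, e1]
          unfold HasLineDerivAt at key ⊢
          simp only [e]
          exact key
      · rw [Fin.prod_univ_castSucc]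
        simp only [Fin.snoc_castSucc, Fin.snoc_last, hJl]
        have h1 := hT.2.2.2
        have := pF' (Fin.init x)
        have := pG' (T' (Fin.init x))
        have := hG0 (T x)
        field_simp
        linear_combination (F x) * h1
    · intro h hh
      rw [lintegral_openCube_succ n L, lintegral_openCube_succ n R]
      · have mk : Measurable fun z : (Fin n → ℝ) × ℝ =>
            ENNReal.ofReal (G (Fin.snoc z.1 z.2)) * h (Fin.snoc z.1 z.2) :=
          hGs.measurable.ennreal_ofReal.mul (hh.comp (continuous_snoc n).measurable)
        have mI : Measurable fun y : Fin n → ℝ => ∫⁻ t in Set.Ioo (-R) R,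
            ENNReal.ofReal (G (Fin.snoc y t)) * h (Fin.snoc y t) := mk.lintegral_prod_right'
        have inner : ∀ x : Fin n → ℝ, ∫⁻ s in Set.Ioo (-L) L,
            ENNReal.ofReal (κ * F (Fin.snoc x s)) * h (T (Fin.snoc x s))
            = ENNReal.ofReal (κ * F' x) * (ENNReal.ofReal (1 / G' (T' x)) *
              ∫⁻ t in Set.Ioo (-R) R,
                ENNReal.ofReal (G (Fin.snoc (T' x) t)) * h (Fin.snoc (T' x) t)) := by
          intro x
          rw [← lintegral_transport (hFx x) (hGx (T' x)) (fun s => hF0 _) (fun s => hG0 _) hL hR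
            (hτ x) (fun t => h (Fin.snoc (T' x) t)), ← mul_assoc,
            ← ENNReal.ofReal_mul (mul_pos hκ (pF' x)).le, ← lintegral_const_mul']
          · refine lintegral_congr fun s => ?_
            have p1 := pF' x
            have p2 := pG' (T' x)
            rw [← mul_assoc, ← ENNReal.ofReal_mul (by positivity)]
            congr 2
            · change κ * F (Fin.snoc x s)
                = κ * F' x * (1 / G' (T' x)) * (F (Fin.snoc x s) * G' (T' x) / F' x)
              field_simp
            · simp only [hTdef, Fin.init_snoc, Fin.snoc_last]
          · exact ENNReal.ofReal_ne_top
        simp only [inner]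
        rw [push' (fun y => ENNReal.ofReal (1 / G' y) * ∫⁻ t in Set.Ioo (-R) R,
          ENNReal.ofReal (G (Fin.snoc y t)) * h (Fin.snoc y t))
          ((cG'.measurable.const_div 1).ennreal_ofReal.mul mI)]
        refine lintegral_congr fun y => ?_
        rw [← mul_assoc, ← ENNReal.ofReal_mul (pG' y).le, mul_one_div_cancel (pG' y).ne',
          ENNReal.ofReal_one, one_mul]
      · exact (hG.measurable.ennreal_ofReal).mul hh
      · exact ((hF.measurable.const_mul κ).ennreal_ofReal).mul (hh.comp mT)

theorem integral_mul_le_sqrt_mul_sqrt {X : Type*} [MeasurableSpace X] {μ : Measure X} {a b : X → ℝ}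
    (ha : 0 ≤ a) (hb : 0 ≤ b) (ma : AEStronglyMeasurable a μ) (mb : AEStronglyMeasurable b μ)
    (ia : Integrable (fun x => a x ^ 2) μ) (ib : Integrable (fun x => b x ^ 2) μ) :
    ∫ x, a x * b x ∂μ ≤ √(∫ x, a x ^ 2 ∂μ) * √(∫ x, b x ^ 2 ∂μ) := by
  have h := integral_mul_le_Lp_mul_Lq_of_nonneg (μ := μ) (f := a) (g := b)
    Real.HolderConjugate.two_two (.of_forall ha) (.of_forall hb)
    (by simpa using (memLp_two_iff_integrable_sq ma).2 ia)
    (by simpa using (memLp_two_iff_integrable_sq mb).2 ib)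
  simpa [Real.sqrt_eq_rpow] using h

/-- Pushforward identity for nonnegative real integrands. -/
theorem setIntegral_eq_of_lintegral {n : ℕ} {L R κ : ℝ} {F G : (Fin n → ℝ) → ℝ}
    {T : (Fin n → ℝ) → Fin n → ℝ} (hF : Continuous F) (hG : Continuous G) (hF0 : ∀ x, 0 < F x)
    (hG0 : ∀ x, 0 < G x) (hκ : 0 < κ) (mT : Measurable T)
    (push : ∀ h : (Fin n → ℝ) → ENNReal, Measurable h →
        ∫⁻ x in openCube n L, ENNReal.ofReal (κ * F x) * h (T x)
          = ∫⁻ y in openCube n R, ENNReal.ofReal (G y) * h y)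
    {h : (Fin n → ℝ) → ℝ} (mh : Measurable h) (h0 : ∀ y, 0 ≤ h y) :
    κ * ∫ x in openCube n L, F x * h (T x) = ∫ y in openCube n R, G y * h y := by
  rw [← integral_const_mul, integral_eq_lintegral_of_nonneg_ae, integral_eq_lintegral_of_nonneg_ae]
  · congr 1
    rw [← (lintegral_congr fun y => ENNReal.ofReal_mul (q := h y) (hG0 y).le).symm,
      ← push (fun y => ENNReal.ofReal (h y)) mh.ennreal_ofReal]
    refine lintegral_congr fun x => ?_
    rw [← ENNReal.ofReal_mul (mul_pos hκ (hF0 x)).le, mul_assoc]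
  · exact .of_forall fun y => mul_nonneg (hG0 y).le (h0 y)
  · exact (hG.measurable.mul mh).aestronglyMeasurable
  · exact .of_forall fun x => mul_nonneg hκ.le (mul_nonneg (hF0 x).le (h0 _))
  · exact ((hF.measurable.mul (mh.comp mT)).const_mul κ).aestronglyMeasurable

/-- `1 + |y|²` in coordinates. -/
def onePlusSq {n : ℕ} (y : Fin n → ℝ) : ℝ := 1 + ∑ i, y i ^ 2

theorem continuous_onePlusSq {n : ℕ} : Continuous (onePlusSq (n := n)) := by
  unfold onePlusSq; fun_prop

theorem onePlusSq_pos {n : ℕ} (y : Fin n → ℝ) : 0 < onePlusSq y := by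
  unfold onePlusSq
  have : 0 ≤ ∑ i, y i ^ 2 := Finset.sum_nonneg fun i _ => sq_nonneg _
  linarith

theorem onePlusSq_le_of_mem_openCube {n : ℕ} {R : ℝ} {y : Fin n → ℝ} (hy : y ∈ openCube n R) :
    onePlusSq y ≤ 1 + n * R ^ 2 := by
  unfold onePlusSq
  have : ∑ i, y i ^ 2 ≤ ∑ _i : Fin n, R ^ 2 :=
    Finset.sum_le_sum fun i _ => sq_le_sq' (hy i).1.le (hy i).2.le
  simp at this
  linarith

theorem integrableOn_openCube {n : ℕ} {L : ℝ} {F : (Fin n → ℝ) → ℝ} (hF : Continuous F) :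
    IntegrableOn F (openCube n L) :=
  (hF.continuousOn.integrableOn_compact isCompact_Icc).mono_set (openCube_subset_Icc n L)

theorem integrableOn_openCube_mul {n : ℕ} {L C : ℝ} {F k : (Fin n → ℝ) → ℝ} (hF : Continuous F)
    (mk : Measurable k) (hk : ∀ x ∈ openCube n L, |k x| ≤ C) :
    IntegrableOn (fun x => F x * k x) (openCube n L) :=
  (integrableOn_openCube hF).mul_bdd (c := C) mk.aestronglyMeasurable
    ((ae_restrict_iff' (measurableSet_openCube n L)).2 (.of_forall hk))

/-- Arithmetic–geometric mean in the form used for triangular Jacobians. -/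
theorem card_mul_rpow_le_sum {n : ℕ} (hn : 0 < n) {J : Fin n → ℝ} (hJ : ∀ i, 0 ≤ J i) {c Q : ℝ}
    (hc : 0 ≤ c) (hQ : 0 ≤ Q) (h : ∏ i, J i = c * Q ^ n) :
    n * (c ^ (1 / (n : ℝ)) * Q) ≤ ∑ i, J i := by
  have hn' : (0 : ℝ) < n := by exact_mod_cast hn
  have := Real.geom_mean_le_arith_mean Finset.univ (fun _ : Fin n => (1 : ℝ)) J
    (fun _ _ => zero_le_one) (by simpa using hn) (fun i _ => hJ i)
  simp only [Real.rpow_one, Finset.sum_const, Finset.card_univ, Fintype.card_fin, nsmul_eq_mul,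
    mul_one, one_mul] at this
  rw [h, Real.mul_rpow hc (by positivity), Real.pow_rpow_inv_natCast hQ hn.ne', le_div_iff₀ hn',
    ← one_div] at this
  linarith

/-- The transport inequality with a regularised density, at fixed truncation. -/
theorem exists_transport_inequality {d : ℕ} (hd : 3 ≤ d) {g : (Fin d → ℝ) → ℂ}
    (hg : ContDiff ℝ 1 g) (hsupp : HasCompactSupport g) {L R δ S : ℝ} (hL : 0 < L) (hR : 0 < R)
    (hδ : 0 < δ) (hδ1 : δ ≤ 1) (hsub : tsupport g ⊆ openCube d L) (hS : ∀ x, ‖g x‖ ^ 2 ≤ S) :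
    ∃ κ : ℝ, 0 < κ ∧
      κ * ∫ x, ‖g x‖ ^ (2 * (d : ℝ) / ((d : ℝ) - 2)) ≤
        ∫ y in openCube d R, (onePlusSq y ^ d)⁻¹ ∧
      (d : ℝ) * κ ^ (1 / (d : ℝ)) * (κ⁻¹ * (∫ y in openCube d R, (onePlusSq y ^ d)⁻¹ * onePlusSq y)
        - δ ^ (((d : ℝ) - 1) / ((d : ℝ) - 2)) *
          (volume.real (openCube d L) * ((S + 1) ^ (1 / ((d : ℝ) - 2)) * (1 + d * R ^ 2)))) ≤
      2 * (((d : ℝ) - 1) / ((d : ℝ) - 2)) *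
        (√(∫ x, ∑ i, ‖fderiv ℝ g x (Pi.single i 1)‖ ^ 2) *
        √(κ⁻¹ * ∫ y in openCube d R, (onePlusSq y ^ d)⁻¹ * ∑ i, y i ^ 2)) := by
  have hd3 : (3 : ℝ) ≤ d := by exact_mod_cast hd
  have hd2 : (0 : ℝ) < (d : ℝ) - 2 := by linarith
  set s : ℝ := ((d : ℝ) - 1) / ((d : ℝ) - 2) with hs
  set σ : ℝ := (d : ℝ) / ((d : ℝ) - 2) with hσ
  have hs1 : 1 < s := by rw [hs, lt_div_iff₀ hd2]; linarith
  set v : (Fin d → ℝ) → ℝ := fun x => ‖g x‖ ^ 2 + δ with hv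
  have v0 : ∀ x, 0 < v x := fun x => by simp only [hv]; positivity
  have cv : ContDiff ℝ 1 v := (hg.norm_sq ℝ).add contDiff_const
  set F : (Fin d → ℝ) → ℝ := fun x => v x ^ σ with hF
  set G : (Fin d → ℝ) → ℝ := fun y => (onePlusSq y ^ d)⁻¹ with hG
  have cF : Continuous F := cv.continuous.rpow_const fun x => Or.inl (v0 x).ne'
  have cG : Continuous G :=
    (continuous_onePlusSq.pow d).inv₀ fun y => (pow_pos (onePlusSq_pos y) d).ne'
  have F0 : ∀ x, 0 < F x := fun x => Real.rpow_pos_of_pos (v0 x) _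
  have G0 : ∀ x, 0 < G x := fun x => inv_pos.2 (pow_pos (onePlusSq_pos x) d)
  obtain ⟨T, J, κ, C, hκ, mT, mJ, hT, push⟩ := exists_triangular_transport hL hR d F G cF cG F0 G0
  have pushR : ∀ {h : (Fin d → ℝ) → ℝ}, Measurable h → (∀ y, 0 ≤ h y) →
      κ * ∫ x in openCube d L, F x * h (T x) = ∫ y in openCube d R, G y * h y :=
    fun mh h0 => setIntegral_eq_of_lintegral cF cG F0 G0 hκ mT push mh h0
  have g0 : ∀ x ∉ openCube d L, g x = 0 := fun x hx => image_eq_zero_of_notMem_tsupport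
    fun h => hx (hsub h)
  set U := openCube d L with hU
  have mU : MeasurableSet U := measurableSet_openCube d L
  refine ⟨κ, hκ, ?_, ?_⟩
  · have h1 := pushR (h := fun _ => 1) measurable_const fun _ => zero_le_one
    simp only [mul_one] at h1
    rw [← h1]
    refine mul_le_mul_of_nonneg_left ?_ hκ.le
    rw [← setIntegral_eq_integral_of_forall_compl_eq_zero (s := U)]
    · refine setIntegral_mono_on ?_ (integrableOn_openCube cF) mU fun x _ => ?_
      · refine integrableOn_openCube (hg.continuous.norm.rpow_const fun x => Or.inr ?_)
        positivity
      · rw [hF, mul_div_assoc, Real.rpow_mul (norm_nonneg _), Real.rpow_two]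
        exact Real.rpow_le_rpow (by positivity) (by simp only [hv]; linarith) (by positivity)
    · intro x hx
      rw [g0 x hx, norm_zero, Real.zero_rpow (by positivity)]
  set φ : (Fin d → ℝ) → ℝ := fun x => v x ^ s - δ ^ s with hφ
  set D : Fin d → (Fin d → ℝ) → ℝ := fun i x => ‖fderiv ℝ g x (Pi.single i 1)‖ with hD
  have cφ : ContDiff ℝ 1 φ := (cv.rpow_const_of_ne fun x => (v0 x).ne').sub contDiff_const
  have φ0 : ∀ x, 0 ≤ φ x := fun x => sub_nonneg.2 <|
    Real.rpow_le_rpow hδ.le (by simp only [hv]; nlinarith [norm_nonneg (g x)]) (by linarith)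
  have φt : tsupport φ ⊆ tsupport g := by
    refine closure_mono fun x hx => ?_
    contrapose! hx
    have : g x = 0 := by simpa using hx
    simp [hφ, hv, this]
  have φc : HasCompactSupport φ := hsupp.mono' (subset_closure.trans φt)
  have dφ : ∀ x i, |fderiv ℝ φ x (Pi.single i 1)| ≤ 2 * s * (√(F x) * D i x) := by
    intro x i
    have hgd : HasFDerivAt g (fderiv ℝ g x) x :=
      (hg.differentiable one_ne_zero x).hasFDerivAt
    have h1 := ((hgd.norm_sq.add_const δ).rpow_const (p := s) (Or.inl (v0 x).ne')).sub_const (δ ^ s)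
    rw [HasFDerivAt.fderiv h1]
    simp only [smul_apply, ContinuousLinearMap.comp_apply, innerSL_apply_apply,
      smul_eq_mul, nsmul_eq_mul, Nat.cast_ofNat]
    have hi : |inner ℝ (g x) (fderiv ℝ g x (Pi.single i 1))| ≤ √(v x) * D i x := by
      refine (abs_real_inner_le_norm _ _).trans ?_
      refine mul_le_mul_of_nonneg_right ?_ (norm_nonneg _)
      exact Real.le_sqrt_of_sq_le (by simp only [hv]; linarith)
    have hF2 : √(F x) = v x ^ (s - 1) * √(v x) := by
      rw [Real.sqrt_eq_rpow, Real.sqrt_eq_rpow, hF, ← Real.rpow_mul (v0 x).le,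
        ← Real.rpow_add (v0 x)]
      congr 1
      rw [hs, hσ]; field_simp; ring
    have hvp : 0 < v x ^ (s - 1) := Real.rpow_pos_of_pos (v0 x) _
    change |s * v x ^ (s - 1) * (2 * inner ℝ (g x) (fderiv ℝ g x (Pi.single i 1)))| ≤ _
    rw [hF2, abs_mul, abs_mul, abs_mul, abs_of_pos hvp, abs_of_pos (by linarith : 0 < s), abs_two]
    calc s * v x ^ (s - 1) * (2 * |inner ℝ (g x) (fderiv ℝ g x (Pi.single i 1))|)
        ≤ s * v x ^ (s - 1) * (2 * (√(v x) * D i x)) := by gcongr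
      _ = _ := by ring
  have hamgm : ∀ x ∈ U, (d : ℝ) * κ ^ (1 / (d : ℝ)) * (F x ^ (1 / (d : ℝ)) * onePlusSq (T x))
      ≤ ∑ i, J i x := by
    intro x hx
    have hx' := hT x hx
    have := card_mul_rpow_le_sum (by omega : 0 < d) (fun i => (hx'.2.1 i).1.le)
      (mul_pos hκ (F0 x)).le (onePlusSq_pos (T x)).le (Q := onePlusSq (T x)) (by
        rw [← hx'.2.2.2]; simp only [hG]
        rw [mul_assoc, inv_mul_cancel₀ (pow_pos (onePlusSq_pos _) d).ne', mul_one])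
    rw [Real.mul_rpow hκ.le (F0 x).le] at this
    linarith
  have hibp : ∀ i, ∫ x in U, φ x * J i x = - ∫ x in U, T x i * fderiv ℝ φ x (Pi.single i 1) := by
    intro i
    have hJb : ∀ x ∈ U, |J i x| ≤ C := fun x hx => by
      rw [abs_of_pos ((hT x hx).2.1 i).1]; exact ((hT x hx).2.1 i).2
    have cdφ : Continuous fun x => fderiv ℝ φ x (Pi.single i 1) :=
      (cφ.continuous_fderiv one_ne_zero).clm_apply continuous_const
    have φz : ∀ x ∉ U, φ x = 0 := fun x hx => image_eq_zero_of_notMem_tsupport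
      fun h => hx (hsub (φt h))
    have dφz : ∀ x ∉ U, fderiv ℝ φ x (Pi.single i 1) = 0 := fun x hx => by
      rw [fderiv_of_notMem_tsupport ℝ fun h => hx (hsub (φt h))]; rfl
    have hTb : ∀ x ∈ U, |T x i| ≤ R := fun x hx =>
      abs_le.2 ⟨((hT x hx).1 i).1.le, ((hT x hx).1 i).2.le⟩
    have mTi : Measurable fun x => T x i := (measurable_pi_apply i).comp mT
    have i1 : Integrable fun x => J i x * φ x := by
      rw [← integrableOn_iff_integrable_of_support_subset (s := U)]
      · simpa only [mul_comm] using integrableOn_openCube_mul cφ.continuous (mJ i) hJb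
      · intro x hx; by_contra h; exact hx (by simp [φz x h])
    have i2 : Integrable fun x => T x i * fderiv ℝ φ x (Pi.single i 1) := by
      rw [← integrableOn_iff_integrable_of_support_subset (s := U)]
      · simpa only [mul_comm] using integrableOn_openCube_mul cdφ mTi hTb
      · intro x hx; by_contra h; exact hx (by simp [dφz x h])
    have i3 : Integrable fun x => T x i * φ x := by
      rw [← integrableOn_iff_integrable_of_support_subset (s := U)]
      · simpa only [mul_comm] using integrableOn_openCube_mul cφ.continuous mTi hTb
      · intro x hx; by_contra h; exact hx (by simp [φz x h])
    have key := integral_bilinear_hasLineDerivAt_right_eq_neg_left_of_integrable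
      (μ := (volume : Measure (Fin d → ℝ))) (B := ContinuousLinearMap.mul ℝ ℝ)
      (f := fun x => T x i) (f' := J i) (g := φ) (g' := fun x => fderiv ℝ φ x (Pi.single i 1))
      (v := Pi.single i 1) i1 i2 i3 (fun x hx => (hT x (hsub (φt hx))).2.2.1 i)
      (fun x _ => ((cφ.differentiable one_ne_zero x).hasFDerivAt).hasLineDerivAt _)
    simp only [ContinuousLinearMap.mul_apply'] at key
    rw [setIntegral_eq_integral_of_forall_compl_eq_zero fun x hx => by rw [φz x hx, zero_mul],
      setIntegral_eq_integral_of_forall_compl_eq_zero fun x hx => by rw [dφz x hx, mul_zero], key,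
      neg_neg]
    simp only [mul_comm]
  have hprod : ∀ x, φ x * F x ^ (1 / (d : ℝ)) = F x - δ ^ s * F x ^ (1 / (d : ℝ)) := by
    intro x
    have e : v x ^ s * F x ^ (1 / (d : ℝ)) = F x := by
      rw [hF, ← Real.rpow_mul (v0 x).le, ← Real.rpow_add (v0 x)]
      congr 1
      rw [hs, hσ]; field_simp; ring
    simp only [hφ]
    rw [sub_mul, e]
  have hlow : (d : ℝ) * κ ^ (1 / (d : ℝ)) * (κ⁻¹ * (∫ y in openCube d R, G y * onePlusSq y)
        - δ ^ s * (volume.real U * ((S + 1) ^ (1 / ((d : ℝ) - 2)) * (1 + d * R ^ 2))))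
      ≤ ∑ i, ∫ x in U, φ x * J i x := by
    have mq : Measurable fun x => onePlusSq (T x) := continuous_onePlusSq.measurable.comp mT
    have hqb : ∀ x ∈ U, |onePlusSq (T x)| ≤ 1 + d * R ^ 2 := fun x hx => by
      rw [abs_of_pos (onePlusSq_pos _)]; exact onePlusSq_le_of_mem_openCube (hT x hx).1
    have cFd : Continuous fun x => F x ^ (1 / (d : ℝ)) :=
      cF.rpow_const fun x => Or.inl (F0 x).ne'
    have i1 := integrableOn_openCube_mul cF mq hqb
    have i2 := integrableOn_openCube_mul cFd mq hqb
    have iJ : ∀ i, IntegrableOn (fun x => φ x * J i x) U := fun i =>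
      integrableOn_openCube_mul cφ.continuous (mJ i) fun x hx => by
        rw [abs_of_pos ((hT x hx).2.1 i).1]; exact ((hT x hx).2.1 i).2
    have e1 := pushR (h := onePlusSq) continuous_onePlusSq.measurable fun y => (onePlusSq_pos y).le
    have hvol : volume U < ⊤ :=
      (measure_mono (openCube_subset_Icc d L)).trans_lt isCompact_Icc.measure_lt_top
    have e2 : ∫ x in U, F x ^ (1 / (d : ℝ)) * onePlusSq (T x)
        ≤ volume.real U * ((S + 1) ^ (1 / ((d : ℝ) - 2)) * (1 + d * R ^ 2)) := by
      rw [← smul_eq_mul, ← setIntegral_const]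
      refine setIntegral_mono_on i2 (integrableOn_const hvol.ne) mU fun x hx => ?_
      have hFd : F x ^ (1 / (d : ℝ)) = v x ^ (1 / ((d : ℝ) - 2)) := by
        rw [hF, ← Real.rpow_mul (v0 x).le]
        congr 1
        rw [hσ]; field_simp
      rw [hFd]
      have hvS : v x ≤ S + 1 := add_le_add (hS x) hδ1
      refine mul_le_mul (Real.rpow_le_rpow (v0 x).le hvS (by positivity))
        ((le_abs_self _).trans (hqb x hx)) (onePlusSq_pos _).le ?_
      exact Real.rpow_nonneg ((v0 x).le.trans hvS) _
    have hk : 0 < (d : ℝ) * κ ^ (1 / (d : ℝ)) := by positivity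
    calc _ ≤ (d : ℝ) * κ ^ (1 / (d : ℝ)) * ((∫ x in U, F x * onePlusSq (T x))
          - δ ^ s * ∫ x in U, F x ^ (1 / (d : ℝ)) * onePlusSq (T x)) := by
          rw [← e1, inv_mul_cancel_left₀ hκ.ne']
          gcongr
      _ = ∫ x in U, φ x *
          ((d : ℝ) * κ ^ (1 / (d : ℝ)) * (F x ^ (1 / (d : ℝ)) * onePlusSq (T x))) := by
          rw [← integral_const_mul, ← integral_sub i1 (i2.const_mul _), ← integral_const_mul]
          refine integral_congr_ae (.of_forall fun x => ?_)
          simp only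
          linear_combination (-(d : ℝ) * κ ^ (1 / (d : ℝ)) * onePlusSq (T x)) * hprod x
      _ ≤ ∫ x in U, ∑ i, φ x * J i x := by
          refine setIntegral_mono_on ?_ (integrable_finsetSum _ fun i _ => iJ i) mU fun x hx => ?_
          · have := (integrableOn_openCube_mul (cφ.continuous.mul cFd) mq hqb).const_mul
              ((d : ℝ) * κ ^ (1 / (d : ℝ)))
            refine this.congr (.of_forall fun x => ?_)
            simp only [Pi.mul_apply]; ring
          · rw [← Finset.mul_sum]
            exact mul_le_mul_of_nonneg_left (hamgm x hx) (φ0 x)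
      _ = _ := integral_finsetSum _ fun i _ => iJ i
  refine hlow.trans ?_
  have cD : ∀ i, Continuous (D i) := fun i =>
    ((hg.continuous_fderiv one_ne_zero).clm_apply continuous_const).norm
  have cS : Continuous fun x => √(∑ i, D i x ^ 2) :=
    (continuous_finsetSum _ fun i _ => (cD i).pow 2).sqrt
  have mT2 : Measurable fun x => ∑ i, T x i ^ 2 :=
    (show Continuous fun y : Fin d → ℝ => ∑ i, y i ^ 2 by fun_prop).measurable.comp mT
  have hT2 : ∀ x ∈ U, |∑ i, T x i ^ 2| ≤ 1 + d * R ^ 2 := fun x hx => by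
    rw [abs_of_nonneg (Finset.sum_nonneg fun i _ => sq_nonneg _)]
    have := onePlusSq_le_of_mem_openCube (hT x hx).1
    unfold onePlusSq at this; linarith
  have iprod : IntegrableOn (fun x => √(∑ i, D i x ^ 2) * √(F x * ∑ i, T x i ^ 2)) U := by
    have := integrableOn_openCube_mul (L := L) (cS.mul cF.sqrt) mT2.sqrt
      (C := √(1 + d * R ^ 2)) fun x hx => by
        rw [abs_of_nonneg (Real.sqrt_nonneg _)]
        exact Real.sqrt_le_sqrt ((le_abs_self _).trans (hT2 x hx))
    refine this.congr (.of_forall fun x => ?_)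
    simp only [Pi.mul_apply]
    rw [Real.sqrt_mul (F0 x).le]; ring
  have hup : ∑ i, ∫ x in U, φ x * J i x
      ≤ ∫ x in U, 2 * s * (√(∑ i, D i x ^ 2) * √(F x * ∑ i, T x i ^ 2)) := by
    have iT : ∀ i, IntegrableOn (fun x => T x i * fderiv ℝ φ x (Pi.single i 1)) U := fun i => by
      have cdφ : Continuous fun x => fderiv ℝ φ x (Pi.single i 1) :=
        (cφ.continuous_fderiv one_ne_zero).clm_apply continuous_const
      have mTi : Measurable fun x => T x i := (measurable_pi_apply i).comp mT
      simpa only [mul_comm] using integrableOn_openCube_mul cdφ mTi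
        fun x hx => abs_le.2 ⟨((hT x hx).1 i).1.le, ((hT x hx).1 i).2.le⟩
    simp only [hibp]
    rw [Finset.sum_neg_distrib, ← integral_finsetSum _ fun i _ => iT i, ← integral_neg]
    refine setIntegral_mono_on (integrable_finsetSum _ fun i _ => iT i).neg
      (iprod.const_mul _) mU fun x _ => ?_
    calc -∑ i, T x i * fderiv ℝ φ x (Pi.single i 1)
        ≤ ∑ i, |T x i| * (2 * s * (√(F x) * D i x)) := by
          rw [← Finset.sum_neg_distrib]
          refine Finset.sum_le_sum fun i _ => (neg_le_abs _).trans ?_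
          rw [abs_mul]
          exact mul_le_mul_of_nonneg_left (dφ x i) (abs_nonneg _)
      _ = 2 * s * √(F x) * ∑ i, D i x * |T x i| := by
          rw [Finset.mul_sum]; exact Finset.sum_congr rfl fun i _ => by ring
      _ ≤ 2 * s * √(F x) * (√(∑ i, D i x ^ 2) * √(∑ i, |T x i| ^ 2)) :=
          mul_le_mul_of_nonneg_left (Real.sum_mul_le_sqrt_mul_sqrt _ _ _) (by positivity)
      _ = _ := by
          simp only [sq_abs]
          rw [Real.sqrt_mul (F0 x).le]; ring
  refine hup.trans ?_
  rw [integral_const_mul]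
  refine mul_le_mul_of_nonneg_left ?_ (by positivity)
  have hB := pushR (h := fun y => ∑ i, y i ^ 2) (by fun_prop)
    fun y => Finset.sum_nonneg fun i _ => sq_nonneg _
  have e3 : ∀ x, √(∑ i, D i x ^ 2) ^ 2 = ∑ i, D i x ^ 2 := fun x =>
    Real.sq_sqrt (Finset.sum_nonneg fun i _ => sq_nonneg _)
  have e4 : ∀ x, √(F x * ∑ i, T x i ^ 2) ^ 2 = F x * ∑ i, T x i ^ 2 := fun x =>
    Real.sq_sqrt (mul_nonneg (F0 x).le (Finset.sum_nonneg fun i _ => sq_nonneg _))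
  have iD : Integrable fun x => ∑ i, D i x ^ 2 := by
    refine Continuous.integrable_of_hasCompactSupport
      (continuous_finsetSum _ fun i _ => (cD i).pow 2)
      (HasCompactSupport.intro hsupp fun x hx => ?_)
    refine Finset.sum_eq_zero fun i _ => ?_
    simp [hD, fderiv_of_notMem_tsupport ℝ hx]
  refine (integral_mul_le_sqrt_mul_sqrt (fun x => Real.sqrt_nonneg _) (fun x => Real.sqrt_nonneg _)
    cS.aestronglyMeasurable ?_ ?_ ?_).trans ?_
  · exact (cF.measurable.mul mT2).sqrt.aestronglyMeasurable
  · simp only [e3]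
    exact iD.integrableOn
  · simp only [e4]
    exact integrableOn_openCube_mul cF mT2 hT2
  · simp only [e3, e4]
    rw [← hB, inv_mul_cancel_left₀ hκ.ne']
    refine mul_le_mul_of_nonneg_right (Real.sqrt_le_sqrt ?_) (Real.sqrt_nonneg _)
    exact setIntegral_le_integral iD (.of_forall fun x => Finset.sum_nonneg fun i _ => sq_nonneg _)

theorem iUnion_openCube (n : ℕ) : ⋃ k : ℕ, openCube n ((k : ℝ) + 1) = Set.univ := by
  refine Set.eq_univ_of_forall fun x => Set.mem_iUnion.2 ?_
  obtain ⟨k, hk⟩ := exists_nat_gt ‖x‖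
  refine ⟨k, fun i => ?_⟩
  have h1 : |x i| < k + 1 := ((norm_le_pi_norm x i).trans_lt hk).trans (lt_add_one _)
  exact abs_lt.1 h1

theorem monotone_openCube (n : ℕ) : Monotone fun k : ℕ => openCube n ((k : ℝ) + 1) := by
  intro k l hkl x hx i
  have h : (k : ℝ) ≤ l := by exact_mod_cast hkl
  exact ⟨by linarith [(hx i).1], by linarith [(hx i).2]⟩

theorem subset_openCube_of_isCompact {n : ℕ} {s : Set (Fin n → ℝ)} (hs : IsCompact s) :
    ∃ L : ℝ, 0 < L ∧ s ⊆ openCube n L := by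
  obtain ⟨C, hC0, hC⟩ := hs.isBounded.exists_pos_norm_lt
  exact ⟨C, hC0, fun x hx i => abs_lt.1 ((norm_le_pi_norm x i).trans_lt (hC x hx))⟩

/-- Letting the regularisation and truncation parameters of `exists_transport_inequality`
tend to their limits. -/
theorem transport_inequality {d : ℕ} (hd : 3 ≤ d) {g : (Fin d → ℝ) → ℂ}
    (hg : ContDiff ℝ 1 g) (hsupp : HasCompactSupport g)
    (hG : Integrable fun y : Fin d → ℝ => (onePlusSq y ^ d)⁻¹)
    (hGy : Integrable fun y : Fin d → ℝ => (onePlusSq y ^ d)⁻¹ * ∑ i, y i ^ 2)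
    (hN : 0 < ∫ x, ‖g x‖ ^ (2 * (d : ℝ) / ((d : ℝ) - 2))) :
    (d : ℝ) * ((∫ y : Fin d → ℝ, (onePlusSq y ^ d)⁻¹) /
        ∫ x, ‖g x‖ ^ (2 * (d : ℝ) / ((d : ℝ) - 2))) ^ (1 / (d : ℝ) - 1 / 2) *
        ∫ y : Fin d → ℝ, (onePlusSq y ^ d)⁻¹ * onePlusSq y
      ≤ 2 * (((d : ℝ) - 1) / ((d : ℝ) - 2)) *
        (√(∫ x, ∑ i, ‖fderiv ℝ g x (Pi.single i 1)‖ ^ 2) *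
          √(∫ y : Fin d → ℝ, (onePlusSq y ^ d)⁻¹ * ∑ i, y i ^ 2)) := by
  have hd' : (3 : ℝ) ≤ d := by exact_mod_cast hd
  have G0 : ∀ y : Fin d → ℝ, 0 ≤ (onePlusSq y ^ d)⁻¹ := fun y => by
    have := onePlusSq_pos y; positivity
  have y0 : ∀ y : Fin d → ℝ, 0 ≤ ∑ i, y i ^ 2 := fun y => Finset.sum_nonneg fun i _ => sq_nonneg _
  have hGA : Integrable fun y : Fin d → ℝ => (onePlusSq y ^ d)⁻¹ * onePlusSq y := by
    refine (hG.add hGy).congr (.of_forall fun y => ?_)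
    simp only [Pi.add_apply, onePlusSq]; ring
  set N := ∫ x, ‖g x‖ ^ (2 * (d : ℝ) / ((d : ℝ) - 2))
  set K := ∫ y : Fin d → ℝ, (onePlusSq y ^ d)⁻¹
  set B := ∫ y : Fin d → ℝ, (onePlusSq y ^ d)⁻¹ * ∑ i, y i ^ 2
  set D := ∫ x, ∑ i, ‖fderiv ℝ g x (Pi.single i 1)‖ ^ 2
  obtain ⟨L, hL, hsub⟩ := subset_openCube_of_isCompact hsupp
  obtain ⟨S, hS⟩ : ∃ S : ℝ, ∀ x, ‖g x‖ ^ 2 ≤ S := by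
    obtain ⟨C, hC⟩ := hsupp.exists_bound_of_continuous hg.continuous
    exact ⟨C ^ 2, fun x => pow_le_pow_left₀ (norm_nonneg _) (hC x) 2⟩
  have S0 : 0 ≤ S := (sq_nonneg _).trans (hS 0)
  set q := K / N with hq
  have htrunc : ∀ R : ℝ, 0 < R → (d : ℝ) * q ^ (1 / (d : ℝ) - 1 / 2) *
      (∫ y in openCube d R, (onePlusSq y ^ d)⁻¹ * onePlusSq y)
        ≤ 2 * (((d : ℝ) - 1) / ((d : ℝ) - 2)) * (√D * √B) := by
    intro R hR
    set A := ∫ y in openCube d R, (onePlusSq y ^ d)⁻¹ * onePlusSq y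
    set E := volume.real (openCube d L) * ((S + 1) ^ (1 / ((d : ℝ) - 2)) * (1 + d * R ^ 2))
    have A0 : 0 ≤ A := integral_nonneg fun y => mul_nonneg (G0 y) (onePlusSq_pos y).le
    have E0 : 0 ≤ E := by positivity
    have hδ : ∀ δ ∈ Set.Ioc (0 : ℝ) 1, (d : ℝ) * q ^ (1 / (d : ℝ) - 1 / 2) * A
        ≤ 2 * (((d : ℝ) - 1) / ((d : ℝ) - 2)) * (√D * √B) +
          (d : ℝ) * q ^ (1 / (d : ℝ) + 1 / 2) * E * δ ^ (((d : ℝ) - 1) / ((d : ℝ) - 2)) := by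
      intro δ hδ
      obtain ⟨κ, hκ, h1, h2⟩ := exists_transport_inequality hd hg hsupp hL hR hδ.1 hδ.2 hsub hS
      have hκq : κ ≤ q := by
        rw [hq, le_div_iff₀ hN]
        exact h1.trans (setIntegral_le_integral hG (.of_forall G0))
      have hBR : ∫ y in openCube d R, (onePlusSq y ^ d)⁻¹ * ∑ i, y i ^ 2 ≤ B :=
        setIntegral_le_integral hGy (.of_forall fun y => mul_nonneg (G0 y) (y0 y))
      have h3 : √(κ⁻¹ * ∫ y in openCube d R, (onePlusSq y ^ d)⁻¹ * ∑ i, y i ^ 2)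
          ≤ (√κ)⁻¹ * √B := by
        rw [Real.sqrt_mul (inv_nonneg.2 hκ.le), Real.sqrt_inv]
        gcongr
      have sκ : 0 < √κ := Real.sqrt_pos.2 hκ
      have c0 : 0 ≤ 2 * (((d : ℝ) - 1) / ((d : ℝ) - 2)) := by
        have : (0 : ℝ) ≤ ((d : ℝ) - 1) / ((d : ℝ) - 2) :=
          div_nonneg (by linarith) (by linarith)
        linarith
      have h4 := mul_le_mul_of_nonneg_left (h2.trans (mul_le_mul_of_nonneg_left
        (mul_le_mul_of_nonneg_left h3 (Real.sqrt_nonneg D)) c0)) sκ.le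
      have e1 : √κ * (2 * (((d : ℝ) - 1) / ((d : ℝ) - 2)) * (√D * ((√κ)⁻¹ * √B)))
          = 2 * (((d : ℝ) - 1) / ((d : ℝ) - 2)) * (√D * √B) := by
        field_simp
      have e2 : √κ * κ ^ (1 / (d : ℝ)) * κ⁻¹ = κ ^ (1 / (d : ℝ) - 1 / 2) := by
        rw [Real.sqrt_eq_rpow, ← Real.rpow_neg_one κ, ← Real.rpow_add hκ, ← Real.rpow_add hκ]
        congr 1; ring
      have e3 : √κ * κ ^ (1 / (d : ℝ)) = κ ^ (1 / (d : ℝ) + 1 / 2) := by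
        rw [Real.sqrt_eq_rpow, ← Real.rpow_add hκ, add_comm]
      have h5 : q ^ (1 / (d : ℝ) - 1 / 2) ≤ κ ^ (1 / (d : ℝ) - 1 / 2) := by
        refine Real.rpow_le_rpow_of_nonpos hκ hκq ?_
        rw [sub_nonpos]
        exact one_div_le_one_div_of_le (by norm_num) (by linarith)
      have h6 : κ ^ (1 / (d : ℝ) + 1 / 2) ≤ q ^ (1 / (d : ℝ) + 1 / 2) :=
        Real.rpow_le_rpow hκ.le hκq (by positivity)
      rw [e1] at h4
      have e4 : √κ * ((d : ℝ) * κ ^ (1 / (d : ℝ)) *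
          (κ⁻¹ * A - δ ^ (((d : ℝ) - 1) / ((d : ℝ) - 2)) * E)) =
          d * (√κ * κ ^ (1 / (d : ℝ)) * κ⁻¹) * A -
            d * (√κ * κ ^ (1 / (d : ℝ))) * E * δ ^ (((d : ℝ) - 1) / ((d : ℝ) - 2)) := by ring
      rw [e4, e2, e3] at h4
      have h7 : (d : ℝ) * q ^ (1 / (d : ℝ) - 1 / 2) * A ≤ d * κ ^ (1 / (d : ℝ) - 1 / 2) * A := by
        gcongr
      have h8 : (d : ℝ) * κ ^ (1 / (d : ℝ) + 1 / 2) * E * δ ^ (((d : ℝ) - 1) / ((d : ℝ) - 2))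
          ≤ d * q ^ (1 / (d : ℝ) + 1 / 2) * E * δ ^ (((d : ℝ) - 1) / ((d : ℝ) - 2)) := by
        have := Real.rpow_nonneg hδ.1.le (((d : ℝ) - 1) / ((d : ℝ) - 2))
        gcongr
      linarith
    have hs : 0 < ((d : ℝ) - 1) / ((d : ℝ) - 2) := div_pos (by linarith) (by linarith)
    have hlim : Filter.Tendsto (fun δ : ℝ => 2 * (((d : ℝ) - 1) / ((d : ℝ) - 2)) * (√D * √B) +
        (d : ℝ) * q ^ (1 / (d : ℝ) + 1 / 2) * E * δ ^ (((d : ℝ) - 1) / ((d : ℝ) - 2)))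
        (nhdsWithin 0 (Set.Ioi 0)) (nhds (2 * (((d : ℝ) - 1) / ((d : ℝ) - 2)) * (√D * √B) +
        (d : ℝ) * q ^ (1 / (d : ℝ) + 1 / 2) * E * (0 : ℝ) ^ (((d : ℝ) - 1) / ((d : ℝ) - 2)))) := by
      have := (Real.continuous_rpow_const hs.le).tendsto (0 : ℝ)
      exact tendsto_nhdsWithin_of_tendsto_nhds ((this.const_mul _).const_add _)
    rw [Real.zero_rpow hs.ne', mul_zero, add_zero] at hlim
    refine ge_of_tendsto hlim ?_
    filter_upwards [Ioc_mem_nhdsGT (zero_lt_one (α := ℝ))] with δ h using hδ δ h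
  have hlimR := tendsto_setIntegral_of_monotone (μ := volume)
    (fun k : ℕ => measurableSet_openCube d ((k : ℝ) + 1)) (monotone_openCube d)
    (f := fun y => (onePlusSq y ^ d)⁻¹ * onePlusSq y)
    hGA.integrableOn
  rw [iUnion_openCube, setIntegral_univ] at hlimR
  exact le_of_tendsto (hlimR.const_mul _) (.of_forall fun k => htrunc _ (by positivity))

/-- The radial profile `r ^ β / (1 + r ^ (2 * β))`. -/
noncomputable def bubble (β r : ℝ) : ℝ := r ^ β / (1 + r ^ (2 * β))

/-- The logarithmic derivative of `bubble β`, up to the factor `β / r`. -/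
noncomputable def bubbleTilt (β r : ℝ) : ℝ := (1 - r ^ (2 * β)) / (1 + r ^ (2 * β))

theorem bubble_pos (β : ℝ) {r : ℝ} (hr : 0 < r) : 0 < bubble β r := by
  unfold bubble; positivity

theorem rpow_two_mul_eq_sq (β : ℝ) {r : ℝ} (hr : 0 ≤ r) : r ^ (2 * β) = (r ^ β) ^ 2 := by
  rw [mul_comm, Real.rpow_mul hr, Real.rpow_two]

theorem bubbleTilt_sq (β : ℝ) {r : ℝ} (hr : 0 < r) :
    bubbleTilt β r ^ 2 = 1 - 4 * bubble β r ^ 2 := by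
  have h : 0 < r ^ β := by positivity
  simp only [bubble, bubbleTilt, rpow_two_mul_eq_sq β hr.le]
  field_simp
  ring

theorem abs_bubbleTilt_le (β : ℝ) {r : ℝ} (hr : 0 < r) : |bubbleTilt β r| ≤ 1 := by
  rw [← sq_le_one_iff_abs_le_one, bubbleTilt_sq β hr]
  nlinarith [sq_nonneg (bubble β r)]

theorem bubble_le_rpow (β : ℝ) {r : ℝ} (hr : 0 < r) : bubble β r ≤ r ^ β := by
  have h : 0 < r ^ (2 * β) := by positivity
  exact div_le_self (by positivity) (by linarith)

theorem bubble_le_rpow_neg (β : ℝ) {r : ℝ} (hr : 0 < r) : bubble β r ≤ r ^ (-β) := by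
  have h : 0 < r ^ β := by positivity
  rw [bubble, rpow_two_mul_eq_sq β hr.le, Real.rpow_neg hr.le, div_le_iff₀ (by positivity)]
  field_simp
  nlinarith

theorem hasDerivAt_bubble_s8 (β : ℝ) {r : ℝ} (hr : 0 < r) :
    HasDerivAt (bubble β) (β * bubbleTilt β r * bubble β r / r) r := by
  have h1 : HasDerivAt (fun r : ℝ => r ^ β) (β * r ^ (β - 1)) r :=
    Real.hasDerivAt_rpow_const (.inl hr.ne')
  have h2 : HasDerivAt (fun r : ℝ => r ^ (2 * β)) (2 * β * r ^ (2 * β - 1)) r :=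
    Real.hasDerivAt_rpow_const (.inl hr.ne')
  have h3 : 0 < r ^ β := by positivity
  refine (h1.div (h2.const_add 1) (by positivity)).congr_deriv ?_
  simp only [bubble, bubbleTilt, Real.rpow_sub_one hr.ne', rpow_two_mul_eq_sq β hr.le]
  field_simp
  ring

theorem hasDerivAt_bubbleTilt (β : ℝ) {r : ℝ} (hr : 0 < r) :
    HasDerivAt (bubbleTilt β) (-4 * β * bubble β r ^ 2 / r) r := by
  have h2 : HasDerivAt (fun r : ℝ => r ^ (2 * β)) (2 * β * r ^ (2 * β - 1)) r :=
    Real.hasDerivAt_rpow_const (.inl hr.ne')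
  have h3 : 0 < r ^ β := by positivity
  refine ((h2.const_sub 1).div (h2.const_add 1) (by positivity)).congr_deriv ?_
  simp only [bubble, Real.rpow_sub_one hr.ne', rpow_two_mul_eq_sq β hr.le]
  field_simp
  ring

theorem hasDerivAt_bubble_rpow (β k : ℝ) {r : ℝ} (hr : 0 < r) :
    HasDerivAt (fun r => bubble β r ^ k) (k * β * bubbleTilt β r * bubble β r ^ k / r) r := by
  have h := bubble_pos β hr
  refine ((hasDerivAt_bubble_s8 β hr).rpow_const (.inl h.ne')).congr_deriv ?_
  rw [Real.rpow_sub_one h.ne']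
  field_simp

theorem continuousOn_bubble_rpow (β k : ℝ) :
    ContinuousOn (fun r => bubble β r ^ k) (Set.Ioi 0) := fun _ hr =>
  (hasDerivAt_bubble_rpow β k hr).continuousAt.continuousWithinAt

theorem continuousOn_bubbleTilt (β : ℝ) : ContinuousOn (bubbleTilt β) (Set.Ioi 0) := fun _ hr =>
  (hasDerivAt_bubbleTilt β hr).continuousAt.continuousWithinAt

theorem bubble_rpow_le_rpow {β k : ℝ} (hk : 0 < k) {r : ℝ} (hr : 0 < r) :
    bubble β r ^ k ≤ r ^ (k * β) := by
  rw [mul_comm, Real.rpow_mul hr.le]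
  exact Real.rpow_le_rpow (bubble_pos β hr).le (bubble_le_rpow β hr) hk.le

theorem bubble_rpow_le_rpow_neg {β k : ℝ} (hk : 0 < k) {r : ℝ} (hr : 0 < r) :
    bubble β r ^ k ≤ r ^ (-(k * β)) := by
  rw [mul_comm, ← neg_mul, Real.rpow_mul hr.le]
  exact Real.rpow_le_rpow (bubble_pos β hr).le (bubble_le_rpow_neg β hr) hk.le

theorem integrableOn_bubble_rpow {β k : ℝ} (hβ : 0 < β) (hk : 0 < k) :
    IntegrableOn (fun r => bubble β r ^ k / r) (Set.Ioi 0) := by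
  have hkβ : 0 < k * β := mul_pos hk hβ
  have hc : ContinuousOn (fun r => bubble β r ^ k / r) (Set.Ioi 0) :=
    (continuousOn_bubble_rpow β k).div continuousOn_id fun r hr => (Set.mem_Ioi.1 hr).ne'
  have hn : ∀ r : ℝ, 0 < r → ‖bubble β r ^ k / r‖ = bubble β r ^ k / r := fun r hr =>
    Real.norm_of_nonneg (div_nonneg (Real.rpow_nonneg (bubble_pos β hr).le _) hr.le)
  rw [← Set.Ioc_union_Ioi_eq_Ioi (zero_le_one (α := ℝ))]
  refine IntegrableOn.union ?_ ?_
  · have h := (intervalIntegral.intervalIntegrable_rpow' (a := 0) (b := 1)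
      (show (-1 : ℝ) < k * β - 1 by linarith)).1
    refine h.mono' ((hc.mono Set.Ioc_subset_Ioi_self).aestronglyMeasurable measurableSet_Ioc) ?_
    filter_upwards [ae_restrict_mem measurableSet_Ioc] with r hr
    rw [hn r hr.1, Real.rpow_sub_one hr.1.ne']
    exact div_le_div_of_nonneg_right (bubble_rpow_le_rpow hk hr.1) hr.1.le
  · have h := integrableOn_Ioi_rpow_of_lt (show -(k * β) - 1 < -1 by linarith) zero_lt_one
    refine h.mono' ((hc.mono (Set.Ioi_subset_Ioi zero_le_one)).aestronglyMeasurable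
      measurableSet_Ioi) ?_
    filter_upwards [ae_restrict_mem measurableSet_Ioi] with r hr
    have hr0 : 0 < r := zero_lt_one.trans hr
    rw [hn r hr0, Real.rpow_sub_one hr0.ne']
    exact div_le_div_of_nonneg_right (bubble_rpow_le_rpow_neg hk hr0) hr0.le

theorem integrableOn_bubble_rpow_mul_bubbleTilt {β k : ℝ} (hβ : 0 < β) (hk : 0 < k) :
    IntegrableOn (fun r => bubble β r ^ k * bubbleTilt β r / r) (Set.Ioi 0) := by
  refine (integrableOn_bubble_rpow hβ hk).mono' (ContinuousOn.aestronglyMeasurable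
    (((continuousOn_bubble_rpow β k).mul (continuousOn_bubbleTilt β)).div continuousOn_id
      fun r hr => (Set.mem_Ioi.1 hr).ne') measurableSet_Ioi) ?_
  filter_upwards [ae_restrict_mem measurableSet_Ioi] with r hr
  have hr : 0 < r := hr
  have h := Real.rpow_nonneg (bubble_pos β hr).le k
  rw [norm_div, norm_mul, Real.norm_of_nonneg h, Real.norm_of_nonneg hr.le]
  exact div_le_div_of_nonneg_right (mul_le_of_le_one_right h (abs_bubbleTilt_le β hr)) hr.le

/-- If `F = O(bubble β ^ k)` is differentiable on the half-line with integrable derivative, then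
the integral of its derivative vanishes. -/
theorem integral_deriv_eq_zero_of_le_bubble_rpow {β k : ℝ} (hβ : 0 < β) (hk : 0 < k)
    {F F' : ℝ → ℝ} (hF : ∀ r, 0 < r → HasDerivAt F (F' r) r) (hF' : IntegrableOn F' (Set.Ioi 0))
    (hle : ∀ r, 0 < r → |F r| ≤ bubble β r ^ k) : ∫ r in Set.Ioi 0, F' r = 0 := by
  have hkβ : 0 < k * β := mul_pos hk hβ
  have h0 : Filter.Tendsto F (nhdsWithin 0 (Set.Ioi 0)) (nhds 0) := by
    have h := (Real.continuous_rpow_const hkβ.le).tendsto (0 : ℝ)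
    rw [Real.zero_rpow hkβ.ne'] at h
    refine squeeze_zero_norm' ?_ (tendsto_nhdsWithin_of_tendsto_nhds h)
    filter_upwards [self_mem_nhdsWithin] with r hr
    exact (hle r hr).trans (bubble_rpow_le_rpow hk hr)
  have h1 : Filter.Tendsto F Filter.atTop (nhds 0) := by
    refine squeeze_zero_norm' ?_ (tendsto_rpow_neg_atTop hkβ)
    filter_upwards [Filter.eventually_gt_atTop 0] with r hr
    exact (hle r hr).trans (bubble_rpow_le_rpow_neg hk hr)
  have h := integral_Ioi_deriv_mul_eq_sub (u := F) (v := fun _ => 1) (u' := F') (v' := fun _ => 0)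
    (a := 0) (a' := 0) (b' := 0) hF (fun r _ => hasDerivAt_const r 1)
    (hF'.congr (.of_forall fun r => by simp)) (h0.congr fun r => by simp)
    (h1.congr fun r => by simp)
  simpa using h

theorem integral_bubble_rpow_mul_bubbleTilt {β k : ℝ} (hβ : 0 < β) (hk : 0 < k) :
    ∫ r in Set.Ioi 0, bubble β r ^ k * bubbleTilt β r / r = 0 := by
  have h := integral_deriv_eq_zero_of_le_bubble_rpow hβ hk
    (fun r hr => hasDerivAt_bubble_rpow β k hr)
    (((integrableOn_bubble_rpow_mul_bubbleTilt hβ hk).const_mul (k * β)).congr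
      (.of_forall fun r => by simp only; ring))
    fun r hr => (abs_of_nonneg (Real.rpow_nonneg (bubble_pos β hr).le _)).le
  have e : ∀ r, k * β * bubbleTilt β r * bubble β r ^ k / r
      = k * β * (bubble β r ^ k * bubbleTilt β r / r) := fun r => by ring
  simp only [e, integral_const_mul] at h
  exact (mul_eq_zero.1 h).resolve_left (mul_pos hk hβ).ne'

theorem mul_integral_bubble_rpow {β k : ℝ} (hβ : 0 < β) (hk : 0 < k) :
    k * ∫ r in Set.Ioi 0, bubble β r ^ k / r
      = 4 * (k + 1) * ∫ r in Set.Ioi 0, bubble β r ^ (k + 2) / r := by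
  have i1 := integrableOn_bubble_rpow hβ hk
  have i2 := integrableOn_bubble_rpow hβ (show 0 < k + 2 by linarith)
  have i3 : IntegrableOn (fun r => β * (k * (bubble β r ^ k / r)
      - 4 * (k + 1) * (bubble β r ^ (k + 2) / r))) (Set.Ioi 0) :=
    ((i1.const_mul k).sub (i2.const_mul (4 * (k + 1)))).const_mul β
  have h := integral_deriv_eq_zero_of_le_bubble_rpow hβ hk
    (F := fun r => bubble β r ^ k * bubbleTilt β r) (fun r hr => by
      have hb := bubble_pos β hr
      refine ((hasDerivAt_bubble_rpow β k hr).mul (hasDerivAt_bubbleTilt β hr)).congr_deriv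
        (g' := β * (k * (bubble β r ^ k / r) - 4 * (k + 1) * (bubble β r ^ (k + 2) / r))) ?_
      rw [Real.rpow_add hb, Real.rpow_two]
      have := bubbleTilt_sq β hr
      linear_combination k * β * bubble β r ^ k / r * this) i3 fun r hr => by
    have hb := Real.rpow_nonneg (bubble_pos β hr).le k
    rw [abs_mul, abs_of_nonneg hb]
    exact mul_le_of_le_one_right hb (abs_bubbleTilt_le β hr)
  rw [integral_const_mul, integral_sub (i1.const_mul k) (i2.const_mul (4 * (k + 1))),
    integral_const_mul, integral_const_mul] at h
  linarith [(mul_eq_zero.1 h).resolve_left (ne_of_gt hβ)]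

/-- The area of the unit sphere of `EuclideanSpace ℝ (Fin d)`. -/
noncomputable def sphereArea (d : ℕ) : ℝ :=
  d * volume.real (Metric.ball (0 : EuclideanSpace ℝ (Fin d)) 1)

theorem sphereArea_pos {d : ℕ} (hd : 0 < d) : 0 < sphereArea d := by
  have : (0 : ℝ) < d := by exact_mod_cast hd
  have h : 0 < volume.real (Metric.ball (0 : EuclideanSpace ℝ (Fin d)) 1) :=
    ENNReal.toReal_pos (Metric.measure_ball_pos _ _ one_pos).ne' measure_ball_lt_top.ne
  exact mul_pos this h

theorem ae_ne_zero_euclidean {d : ℕ} (hd : 0 < d) :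
    ∀ᵐ x : EuclideanSpace ℝ (Fin d), x ≠ 0 := by
  have : Nonempty (Fin d) := ⟨⟨0, hd⟩⟩
  exact compl_mem_ae_iff.2 (measure_singleton _)

/-- Integrability of radial functions. -/
theorem integrable_radial {d : ℕ} (hd : 0 < d) {F : EuclideanSpace ℝ (Fin d) → ℝ} {h H : ℝ → ℝ}
    (hF : ∀ x, x ≠ 0 → F x = h ‖x‖) (hH : ∀ r, 0 < r → r ^ (d - 1) * h r = H r)
    (hi : IntegrableOn H (Set.Ioi 0)) : Integrable F := by
  have : Nonempty (Fin d) := ⟨⟨0, hd⟩⟩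
  have : Integrable fun x : EuclideanSpace ℝ (Fin d) => h ‖x‖ := by
    rw [integrable_fun_norm_addHaar, finrank_euclideanSpace_fin]
    exact hi.congr_fun (fun r hr => (hH r hr).symm) measurableSet_Ioi
  refine this.congr ?_
  filter_upwards [ae_ne_zero_euclidean hd] with x hx using (hF x hx).symm

/-- Integration of radial functions in polar coordinates. -/
theorem integral_radial {d : ℕ} (hd : 0 < d) {F : EuclideanSpace ℝ (Fin d) → ℝ} {h H : ℝ → ℝ}
    (hF : ∀ x, x ≠ 0 → F x = h ‖x‖) (hH : ∀ r, 0 < r → r ^ (d - 1) * h r = H r) :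
    ∫ x, F x = sphereArea d * ∫ r in Set.Ioi 0, H r := by
  have : Nonempty (Fin d) := ⟨⟨0, hd⟩⟩
  have h1 : ∫ x, F x = ∫ x : EuclideanSpace ℝ (Fin d), h ‖x‖ := by
    refine integral_congr_ae ?_
    filter_upwards [ae_ne_zero_euclidean hd] with x hx using hF x hx
  rw [h1, integral_fun_norm_addHaar, finrank_euclideanSpace_fin, sphereArea, nsmul_eq_mul,
    smul_eq_mul, ← mul_assoc]
  congr 1
  exact setIntegral_congr_fun measurableSet_Ioi fun r hr => hH r hr

theorem integral_bubble_rpow_eq_inv_mul {β : ℝ} (hβ : 0 < β) (k : ℝ) :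
    ∫ r in Set.Ioi 0, bubble β r ^ k / r = β⁻¹ * ∫ r in Set.Ioi 0, bubble 1 r ^ k / r := by
  rw [← integral_comp_rpow_Ioi (fun r => bubble 1 r ^ k / r) hβ.ne', ← integral_const_mul]
  refine setIntegral_congr_fun measurableSet_Ioi fun r hr => ?_
  have hr : 0 < r := hr
  have h : 0 < r ^ β := by positivity
  have e : bubble 1 (r ^ β) = bubble β r := by
    simp only [bubble, Real.rpow_one, mul_one, Real.rpow_two, rpow_two_mul_eq_sq β hr.le]
  simp only [e, smul_eq_mul, abs_of_pos hβ, Real.rpow_sub_one (ne_of_gt hr)]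
  field_simp

/-- The normalising integral `∫ (1 + |y|²)⁻ᵈ dy`. -/
noncomputable def bubbleMass (d : ℕ) : ℝ :=
  sphereArea d * ∫ r in Set.Ioi 0, bubble 1 r ^ (d : ℝ) / r

theorem bubbleMass_pos {d : ℕ} (hd : 0 < d) : 0 < bubbleMass d := by
  refine mul_pos (sphereArea_pos hd) ?_
  have hd' : (0 : ℝ) < d := by exact_mod_cast hd
  rw [integral_pos_iff_support_of_nonneg_ae]
  · have : (volume.restrict (Set.Ioi (0:ℝ))) (Set.Ioi 0) ≤ (volume.restrict (Set.Ioi (0:ℝ)))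
      (Function.support fun r => bubble 1 r ^ (d : ℝ) / r) := measure_mono fun r hr =>
        (div_pos (Real.rpow_pos_of_pos (bubble_pos 1 hr) _) hr).ne'
    refine lt_of_lt_of_le ?_ this
    simp
  · filter_upwards [ae_restrict_mem measurableSet_Ioi] with r hr
    exact (div_pos (Real.rpow_pos_of_pos (bubble_pos 1 hr) _) hr).le
  · exact integrableOn_bubble_rpow one_pos hd'

theorem bubble_one {r : ℝ} : bubble 1 r = r / (1 + r ^ 2) := by
  simp [bubble]

theorem pow_mul_inv_eq_bubble_rpow {d : ℕ} (hd : 0 < d) {r : ℝ} (hr : 0 < r) :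
    r ^ (d - 1) * ((1 + r ^ 2) ^ d)⁻¹ = bubble 1 r ^ (d : ℝ) / r := by
  rw [Real.rpow_natCast, bubble_one, div_pow]
  have h : r ^ d = r ^ (d - 1) * r := (pow_sub_one_mul hd.ne' r).symm
  rw [h]
  field_simp

theorem pow_mul_inv_mul_eq_bubble_rpow {d : ℕ} (hd : 0 < d) {r : ℝ} (hr : 0 < r) :
    r ^ (d - 1) * (((1 + r ^ 2) ^ d)⁻¹ * (1 + r ^ 2)) =
      2⁻¹ * (bubble 1 r ^ ((d : ℝ) - 2) / r - bubble 1 r ^ ((d : ℝ) - 2) * bubbleTilt 1 r / r) := by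
  have hb := bubble_pos 1 hr
  rw [← mul_assoc, pow_mul_inv_eq_bubble_rpow hd hr, Real.rpow_sub hb, Real.rpow_two]
  have h2 : bubble 1 r ^ 2 = (r / (1 + r ^ 2)) ^ 2 := by rw [bubble_one]
  have h3 : bubbleTilt 1 r = (1 - r ^ 2) / (1 + r ^ 2) := by simp [bubbleTilt]
  rw [h2, h3]
  generalize bubble 1 r ^ (d : ℝ) = z
  field_simp
  ring

theorem onePlusSq_ofLp {d : ℕ} (x : EuclideanSpace ℝ (Fin d)) :
    onePlusSq (WithLp.ofLp x) = 1 + ‖x‖ ^ 2 := by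
  rw [EuclideanSpace.real_norm_sq_eq, onePlusSq]

theorem integrable_comp_ofLp_iff {d : ℕ} {F : (Fin d → ℝ) → ℝ} :
    Integrable (fun x : EuclideanSpace ℝ (Fin d) => F (WithLp.ofLp x)) ↔ Integrable F :=
  (EuclideanSpace.volume_preserving_symm_measurableEquiv_toLp (Fin d)).integrable_comp_emb
    (MeasurableEquiv.measurableEmbedding _)

theorem integral_comp_ofLp {d : ℕ} (F : (Fin d → ℝ) → ℝ) :
    ∫ x : EuclideanSpace ℝ (Fin d), F (WithLp.ofLp x) = ∫ y, F y :=
  (EuclideanSpace.volume_preserving_symm_measurableEquiv_toLp (Fin d)).integral_comp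
    (MeasurableEquiv.measurableEmbedding _) F

theorem integrable_inv_onePlusSq_pow {d : ℕ} (hd : 0 < d) :
    Integrable fun y : Fin d → ℝ => (onePlusSq y ^ d)⁻¹ := by
  have hd' : (0 : ℝ) < d := by exact_mod_cast hd
  rw [← integrable_comp_ofLp_iff]
  simp only [onePlusSq_ofLp]
  exact integrable_radial hd (h := fun r => ((1 + r ^ 2) ^ d)⁻¹) (fun x _ => rfl)
    (fun r hr => pow_mul_inv_eq_bubble_rpow hd hr) (integrableOn_bubble_rpow one_pos hd')

theorem integral_inv_onePlusSq_pow {d : ℕ} (hd : 0 < d) :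
    ∫ y : Fin d → ℝ, (onePlusSq y ^ d)⁻¹ = bubbleMass d := by
  rw [← integral_comp_ofLp]
  simp only [onePlusSq_ofLp]
  exact integral_radial hd (h := fun r => ((1 + r ^ 2) ^ d)⁻¹) (fun x _ => rfl)
    (fun r hr => pow_mul_inv_eq_bubble_rpow hd hr)

theorem integrable_inv_onePlusSq_pow_mul {d : ℕ} (hd : 3 ≤ d) :
    Integrable fun y : Fin d → ℝ => (onePlusSq y ^ d)⁻¹ * onePlusSq y := by
  have hd' : (3 : ℝ) ≤ d := by exact_mod_cast hd
  have hd0 : 0 < d := by omega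
  rw [← integrable_comp_ofLp_iff]
  simp only [onePlusSq_ofLp]
  exact integrable_radial hd0 (h := fun r => ((1 + r ^ 2) ^ d)⁻¹ * (1 + r ^ 2)) (fun x _ => rfl)
    (fun r hr => pow_mul_inv_mul_eq_bubble_rpow hd0 hr)
    (((integrableOn_bubble_rpow one_pos (by linarith)).sub
      (integrableOn_bubble_rpow_mul_bubbleTilt one_pos (by linarith))).const_mul _)

theorem integral_inv_onePlusSq_pow_mul {d : ℕ} (hd : 3 ≤ d) :
    ∫ y : Fin d → ℝ, (onePlusSq y ^ d)⁻¹ * onePlusSq y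
      = 2 * ((d : ℝ) - 1) / ((d : ℝ) - 2) * bubbleMass d := by
  have hd' : (3 : ℝ) ≤ d := by exact_mod_cast hd
  have hd0 : 0 < d := by omega
  have hk : 0 < (d : ℝ) - 2 := by linarith
  rw [← integral_comp_ofLp]
  simp only [onePlusSq_ofLp]
  rw [integral_radial hd0 (h := fun r => ((1 + r ^ 2) ^ d)⁻¹ * (1 + r ^ 2)) (fun x _ => rfl)
    (fun r hr => pow_mul_inv_mul_eq_bubble_rpow hd0 hr), integral_const_mul,
    integral_sub (integrableOn_bubble_rpow one_pos hk)
      (integrableOn_bubble_rpow_mul_bubbleTilt one_pos hk),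
    integral_bubble_rpow_mul_bubbleTilt one_pos hk, bubbleMass]
  have h := mul_integral_bubble_rpow one_pos hk
  rw [sub_add_cancel] at h
  have h' : ∫ r in Set.Ioi 0, bubble 1 r ^ ((d : ℝ) - 2) / r = 4 * ((d : ℝ) - 1) / ((d : ℝ) - 2) *
      ∫ r in Set.Ioi 0, bubble 1 r ^ (d : ℝ) / r := by
    field_simp
    linear_combination h
  rw [h']; ring

theorem integrable_inv_onePlusSq_pow_mul_sum {d : ℕ} (hd : 3 ≤ d) :
    Integrable fun y : Fin d → ℝ => (onePlusSq y ^ d)⁻¹ * ∑ i, y i ^ 2 := by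
  refine ((integrable_inv_onePlusSq_pow_mul hd).sub
    (integrable_inv_onePlusSq_pow (by omega))).congr (.of_forall fun y => ?_)
  simp only [Pi.sub_apply, onePlusSq]; ring

theorem integral_inv_onePlusSq_pow_mul_sum {d : ℕ} (hd : 3 ≤ d) :
    ∫ y : Fin d → ℝ, (onePlusSq y ^ d)⁻¹ * ∑ i, y i ^ 2
      = d / ((d : ℝ) - 2) * bubbleMass d := by
  have hd' : (3 : ℝ) ≤ d := by exact_mod_cast hd
  have hk : (d : ℝ) - 2 ≠ 0 := by linarith
  have e : ∀ y : Fin d → ℝ, (onePlusSq y ^ d)⁻¹ * ∑ i, y i ^ 2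
      = (onePlusSq y ^ d)⁻¹ * onePlusSq y - (onePlusSq y ^ d)⁻¹ := fun y => by
    simp only [onePlusSq]; ring
  simp only [e]
  rw [integral_sub (integrable_inv_onePlusSq_pow_mul hd) (integrable_inv_onePlusSq_pow (by omega)),
    integral_inv_onePlusSq_pow_mul hd, integral_inv_onePlusSq_pow (by omega)]
  field_simp
  ring

/-- The sharp Sobolev inequality in `EuclideanSpace ℝ (Fin d)`. -/
theorem sharp_sobolev_euclidean {d : ℕ} (hd : 3 ≤ d) {g : EuclideanSpace ℝ (Fin d) → ℂ}
    (hg : ContDiff ℝ 1 g) (hsupp : HasCompactSupport g) :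
    (∫ x, ‖g x‖ ^ (2 * (d : ℝ) / ((d : ℝ) - 2))) ^ (((d : ℝ) - 2) / (2 * (d : ℝ)))
      ≤ bubbleMass d ^ (-(1 / (d : ℝ))) * (√((d : ℝ) * ((d : ℝ) - 2)))⁻¹ *
        √(∫ x, ∑ i, ‖fderiv ℝ g x (EuclideanSpace.single i 1)‖ ^ 2) := by
  have hd' : (3 : ℝ) ≤ d := by exact_mod_cast hd
  have hd0 : 0 < d := by omega
  have hk : 0 < (d : ℝ) - 2 := by linarith
  have hK := bubbleMass_pos hd0
  have hN0 : 0 ≤ ∫ x, ‖g x‖ ^ (2 * (d : ℝ) / ((d : ℝ) - 2)) :=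
    integral_nonneg fun x => Real.rpow_nonneg (norm_nonneg (g x)) _
  rcases hN0.eq_or_lt' with hN | hN
  · rw [hN, Real.zero_rpow (by positivity)]
    positivity
  let e : (Fin d → ℝ) ≃L[ℝ] EuclideanSpace ℝ (Fin d) := (EuclideanSpace.equiv (Fin d) ℝ).symm
  have hge : ContDiff ℝ 1 (g ∘ e) := hg.comp e.contDiff
  have hse : HasCompactSupport (g ∘ e) :=
    hsupp.comp_homeomorph e.toHomeomorph
  have hder : ∀ (x : EuclideanSpace ℝ (Fin d)) (i : Fin d),
      fderiv ℝ (g ∘ e) (WithLp.ofLp x) (Pi.single i 1)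
        = fderiv ℝ g x (EuclideanSpace.single i 1) := fun x i => by
    rw [e.comp_right_fderiv]
    rfl
  have eN : ∫ x, ‖(g ∘ e) x‖ ^ (2 * (d : ℝ) / ((d : ℝ) - 2))
      = ∫ x, ‖g x‖ ^ (2 * (d : ℝ) / ((d : ℝ) - 2)) := by
    rw [← integral_comp_ofLp]; rfl
  have eD : ∫ x, ∑ i, ‖fderiv ℝ (g ∘ e) x (Pi.single i 1)‖ ^ 2
      = ∫ x, ∑ i, ‖fderiv ℝ g x (EuclideanSpace.single i 1)‖ ^ 2 := by
    rw [← integral_comp_ofLp]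
    simp only [hder]
  have h := transport_inequality hd hge hse (integrable_inv_onePlusSq_pow hd0)
    (integrable_inv_onePlusSq_pow_mul_sum hd) (by rwa [eN])
  rw [eN, eD, integral_inv_onePlusSq_pow hd0, integral_inv_onePlusSq_pow_mul hd,
    integral_inv_onePlusSq_pow_mul_sum hd] at h
  set N := ∫ x, ‖g x‖ ^ (2 * (d : ℝ) / ((d : ℝ) - 2))
  set D := ∫ x, ∑ i, ‖fderiv ℝ g x (EuclideanSpace.single i 1)‖ ^ 2
  set K := bubbleMass d
  have e1 : (K / N) ^ (1 / (d : ℝ) - 1 / 2) =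
      K ^ (1 / (d : ℝ)) * (√K)⁻¹ * N ^ (((d : ℝ) - 2) / (2 * (d : ℝ))) := by
    rw [Real.div_rpow hK.le hN.le, Real.rpow_sub hK, ← Real.sqrt_eq_rpow, div_eq_mul_inv,
      ← Real.rpow_neg hN.le, div_eq_mul_inv]
    congr 2
    field_simp
    ring
  have e2 : √((d : ℝ) / ((d : ℝ) - 2) * K) = d * (√((d : ℝ) * ((d : ℝ) - 2)))⁻¹ * √K := by
    rw [Real.sqrt_mul (by positivity)]
    congr 1
    rw [← Real.sqrt_inv, ← Real.sqrt_sq (Nat.cast_nonneg (α := ℝ) d),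
      ← Real.sqrt_mul (by positivity), Real.sqrt_sq (Nat.cast_nonneg (α := ℝ) d)]
    congr 1
    field_simp
  rw [e1, e2] at h
  have hsK : 0 < √K := Real.sqrt_pos.2 hK
  have hKK : √K * √K = K := Real.mul_self_sqrt hK.le
  have hKd : 0 < K ^ (1 / (d : ℝ)) := Real.rpow_pos_of_pos hK _
  have hd1 : 0 < (d : ℝ) - 1 := by linarith
  have c0 : 0 < (d : ℝ) * (2 * (((d : ℝ) - 1) / ((d : ℝ) - 2))) * √K := by positivity
  rw [Real.rpow_neg hK.le]
  have h2 : ((d : ℝ) * (2 * (((d : ℝ) - 1) / ((d : ℝ) - 2))) * √K) *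
      (K ^ (1 / (d : ℝ)) * N ^ (((d : ℝ) - 2) / (2 * (d : ℝ)))) ≤
      ((d : ℝ) * (2 * (((d : ℝ) - 1) / ((d : ℝ) - 2))) * √K) *
      ((√((d : ℝ) * ((d : ℝ) - 2)))⁻¹ * √D) := by
    refine le_trans (le_of_eq ?_) (h.trans (le_of_eq ?_))
    · have : K = √K * √K := hKK.symm
      rw [show (d : ℝ) * (K ^ (1 / (d : ℝ)) * (√K)⁻¹ * N ^ (((d : ℝ) - 2) / (2 * (d : ℝ)))) *
        (2 * ((d : ℝ) - 1) / ((d : ℝ) - 2) * K) =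
        d * (K ^ (1 / (d : ℝ)) * ((√K)⁻¹ * K) * N ^ (((d : ℝ) - 2) / (2 * (d : ℝ)))) *
        (2 * ((d : ℝ) - 1) / ((d : ℝ) - 2)) by ring, show (√K)⁻¹ * K = √K by
          rw [inv_mul_eq_iff_eq_mul₀ hsK.ne', hKK]]
      ring
    · ring
  have h3 := le_of_mul_le_mul_left h2 c0
  rw [mul_assoc, le_inv_mul_iff₀ hKd]
  exact h3

theorem hasFDerivAt_norm_euclidean {d : ℕ} {x : EuclideanSpace ℝ (Fin d)} (hx : x ≠ 0) :
    HasFDerivAt (fun y : EuclideanSpace ℝ (Fin d) => ‖y‖) (‖x‖⁻¹ • innerSL ℝ x) x := by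
  have h0 : ‖x‖ ≠ 0 := norm_ne_zero_iff.2 hx
  have h := ((hasStrictFDerivAt_norm_sq x).hasFDerivAt).sqrt (pow_ne_zero 2 h0)
  simp only [Real.sqrt_sq (norm_nonneg _)] at h
  refine h.congr_fderiv ?_
  ext v
  simp
  field_simp

theorem sum_sq_euclidean {d : ℕ} (x : EuclideanSpace ℝ (Fin d)) : ∑ i, x i ^ 2 = ‖x‖ ^ 2 :=
  (EuclideanSpace.real_norm_sq_eq x).symm

/-- The squared gradient of a radial function. -/
theorem sum_fderiv_radial_sq {d : ℕ} {w : ℝ → ℝ} {w' : ℝ} {x : EuclideanSpace ℝ (Fin d)}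
    (hx : x ≠ 0) (hw : HasDerivAt w w' ‖x‖) :
    ∑ i, (fderiv ℝ (fun y : EuclideanSpace ℝ (Fin d) => w ‖y‖) x
      (EuclideanSpace.single i 1)) ^ 2 = w' ^ 2 := by
  have h0 : ‖x‖ ≠ 0 := norm_ne_zero_iff.2 hx
  have h := hw.comp_hasFDerivAt x (hasFDerivAt_norm_euclidean hx)
  have e : ∀ i, fderiv ℝ (fun y : EuclideanSpace ℝ (Fin d) => w ‖y‖) x
      (EuclideanSpace.single i 1) = w' * (‖x‖⁻¹ * x i) := fun i => by
    rw [show (fun y : EuclideanSpace ℝ (Fin d) => w ‖y‖) = w ∘ fun y => ‖y‖ from rfl, h.fderiv]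
    simp [EuclideanSpace.inner_single_right]
  simp only [e, mul_pow]
  rw [← Finset.mul_sum, ← Finset.mul_sum, sum_sq_euclidean]
  field_simp

theorem rpow_div_eq_bubble_div (β : ℝ) {r : ℝ} (hr : 0 < r) :
    r ^ (β - 1) / (1 + r ^ (2 * β)) = bubble β r / r := by
  rw [bubble, Real.rpow_sub_one hr.ne']
  ring

theorem pow_sub_one_eq_rpow_div {d : ℕ} (hd : 0 < d) {r : ℝ} (hr : 0 < r) :
    r ^ (d - 1) = r ^ (d : ℝ) / r := by
  rw [Real.rpow_natCast, ← pow_sub_one_mul hd.ne' r]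
  field_simp

theorem hasDerivAt_bubble_div_rpow (β m : ℝ) {r : ℝ} (hr : 0 < r) :
    HasDerivAt (fun r => (bubble β r / r) ^ m)
      (m * (β * bubbleTilt β r - 1) / r * (bubble β r / r) ^ m) r := by
  have hb := bubble_pos β hr
  have h : 0 < bubble β r / r := div_pos hb hr
  refine (((hasDerivAt_bubble_s8 β hr).div (hasDerivAt_id r) hr.ne').rpow_const
    (.inl h.ne')).congr_deriv ?_
  simp only [Pi.div_apply, id_eq]
  rw [Real.rpow_sub_one h.ne']
  field_simp

theorem integral_soliton_rpow {d : ℕ} (hd : 3 ≤ d) {β : ℝ} (hβ : 0 < β)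
    {W : EuclideanSpace ℝ (Fin d) → ℝ}
    (hW : ∀ x, W x = ((d : ℝ) * ((d : ℝ) - 2) * β ^ 2) ^ (((d : ℝ) - 2) / 4) *
        (‖x‖ ^ (β - 1) / (1 + ‖x‖ ^ (2 * β))) ^ (((d : ℝ) - 2) / 2)) :
    ∫ x, W x ^ (2 * (d : ℝ) / ((d : ℝ) - 2))
      = ((d : ℝ) * ((d : ℝ) - 2) * β ^ 2) ^ ((d : ℝ) / 2) * β⁻¹ * bubbleMass d := by
  have hd' : (3 : ℝ) ≤ d := by exact_mod_cast hd
  have hd0 : 0 < d := by omega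
  have hk : 0 < (d : ℝ) - 2 := by linarith
  have hX : 0 < (d : ℝ) * ((d : ℝ) - 2) * β ^ 2 := by positivity
  set X := (d : ℝ) * ((d : ℝ) - 2) * β ^ 2
  rw [integral_radial hd0 (h := fun r => X ^ ((d : ℝ) / 2) * (bubble β r / r) ^ (d : ℝ))
    (H := fun r => X ^ ((d : ℝ) / 2) * (bubble β r ^ (d : ℝ) / r)), integral_const_mul,
    integral_bubble_rpow_eq_inv_mul hβ, bubbleMass]
  · ring
  · intro x hx
    have hr : 0 < ‖x‖ := norm_pos_iff.2 hx
    have hb : 0 < bubble β ‖x‖ / ‖x‖ := div_pos (bubble_pos β hr) hr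
    rw [hW, rpow_div_eq_bubble_div β hr, Real.mul_rpow (by positivity) (by positivity),
      ← Real.rpow_mul hX.le, ← Real.rpow_mul hb.le]
    congr 2 <;> field_simp
    norm_num
  · intro r hr
    have hb := bubble_pos β hr
    rw [pow_sub_one_eq_rpow_div hd0 hr, Real.div_rpow hb.le hr.le]
    have : 0 < r ^ (d : ℝ) := by positivity
    field_simp

theorem quadraticForm_soliton {d : ℕ} (hd : 3 ≤ d) {a β : ℝ} (hβ : 0 < β)
    (ha : a = (((d : ℝ) - 2) / 2) ^ 2 * (β ^ 2 - 1)) {W : EuclideanSpace ℝ (Fin d) → ℝ}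
    (hW : ∀ x, W x = ((d : ℝ) * ((d : ℝ) - 2) * β ^ 2) ^ (((d : ℝ) - 2) / 4) *
        (‖x‖ ^ (β - 1) / (1 + ‖x‖ ^ (2 * β))) ^ (((d : ℝ) - 2) / 2)) :
    ∫ x : EuclideanSpace ℝ (Fin d), ((∑ i, (fderiv ℝ W x (EuclideanSpace.single i 1)) ^ 2)
        + a / ‖x‖ ^ 2 * (W x) ^ 2)
      = ((d : ℝ) * ((d : ℝ) - 2) * β ^ 2) ^ ((d : ℝ) / 2) * β⁻¹ * bubbleMass d := by
  have hd' : (3 : ℝ) ≤ d := by exact_mod_cast hd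
  have hd0 : 0 < d := by omega
  have hk : 0 < (d : ℝ) - 2 := by linarith
  have hX : 0 < (d : ℝ) * ((d : ℝ) - 2) * β ^ 2 := by positivity
  set X := (d : ℝ) * ((d : ℝ) - 2) * β ^ 2 with hXdef
  set m := ((d : ℝ) - 2) / 2 with hm
  set c := X ^ (((d : ℝ) - 2) / 4) with hc
  have i1 := integrableOn_bubble_rpow hβ hk
  have i2 := integrableOn_bubble_rpow_mul_bubbleTilt hβ hk
  have i3 := integrableOn_bubble_rpow hβ (show (0 : ℝ) < d by linarith)
  have hrad : ∀ r, 0 < r → HasDerivAt (fun r => c * (r ^ (β - 1) / (1 + r ^ (2 * β))) ^ m)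
      (c * (m * (β * bubbleTilt β r - 1) / r * (bubble β r / r) ^ m)) r := fun r hr => by
    refine ((hasDerivAt_bubble_div_rpow β m hr).const_mul c).congr_of_eventuallyEq ?_
    filter_upwards [lt_mem_nhds hr] with s hs
    rw [rpow_div_eq_bubble_div β hs]
  have hWeq : W = fun x => c * (‖x‖ ^ (β - 1) / (1 + ‖x‖ ^ (2 * β))) ^ m := funext hW
  rw [integral_radial hd0 (h := fun r => c ^ 2 * ((bubble β r / r) ^ m) ^ 2 *
      (m ^ 2 * (β * bubbleTilt β r - 1) ^ 2 + a) / r ^ 2)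
    (H := fun r => c ^ 2 * m ^ 2 * (2 * β ^ 2 * (bubble β r ^ ((d : ℝ) - 2) / r)
      - 2 * β * (bubble β r ^ ((d : ℝ) - 2) * bubbleTilt β r / r)
      - 4 * β ^ 2 * (bubble β r ^ (d : ℝ) / r)))]
  · have i4 : IntegrableOn (fun r => 2 * β ^ 2 * (bubble β r ^ ((d : ℝ) - 2) / r)
        - 2 * β * (bubble β r ^ ((d : ℝ) - 2) * bubbleTilt β r / r)) (Set.Ioi 0) :=
      (i1.const_mul _).sub (i2.const_mul _)
    rw [integral_const_mul, integral_sub i4 (i3.const_mul _),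
      integral_sub (i1.const_mul _) (i2.const_mul _), integral_const_mul, integral_const_mul,
      integral_const_mul, integral_bubble_rpow_mul_bubbleTilt hβ hk, bubbleMass]
    have h := mul_integral_bubble_rpow hβ hk
    rw [sub_add_cancel] at h
    have h' : ∫ r in Set.Ioi 0, bubble β r ^ ((d : ℝ) - 2) / r
        = 4 * ((d : ℝ) - 1) / ((d : ℝ) - 2) * ∫ r in Set.Ioi 0, bubble β r ^ (d : ℝ) / r := by
      field_simp
      linear_combination h
    have hcX : X ^ ((d : ℝ) / 2) = c ^ 2 * X := by
      rw [hc, ← Real.rpow_two, ← Real.rpow_mul hX.le]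
      nth_rewrite 3 [← Real.rpow_one X]
      rw [← Real.rpow_add hX]
      congr 1
      ring
    rw [h', integral_bubble_rpow_eq_inv_mul hβ, hcX, hXdef, hm]
    field_simp
    ring
  · intro x hx
    have hr : 0 < ‖x‖ := norm_pos_iff.2 hx
    rw [hWeq]
    simp only
    rw [sum_fderiv_radial_sq hx (hrad _ hr), rpow_div_eq_bubble_div β hr]
    field_simp
  · intro r hr
    have hb := bubble_pos β hr
    have e1 : ((bubble β r / r) ^ m) ^ 2 = bubble β r ^ ((d : ℝ) - 2) / (r ^ (d : ℝ) / r ^ 2) := by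
      rw [← Real.rpow_two, ← Real.rpow_mul (by positivity), Real.div_rpow hb.le hr.le, hm,
        div_mul_cancel₀ _ two_ne_zero, Real.rpow_sub hr, Real.rpow_two]
    have e2 : bubble β r ^ (d : ℝ) = bubble β r ^ ((d : ℝ) - 2) * bubble β r ^ 2 := by
      rw [← Real.rpow_two, ← Real.rpow_add hb, sub_add_cancel]
    have h3 : 0 < r ^ (d : ℝ) := by positivity
    have e3 := bubbleTilt_sq β hr
    rw [pow_sub_one_eq_rpow_div hd0 hr, e1, e2, ha]
    field_simp
    linear_combination c ^ 2 * m ^ 2 * β ^ 2 * e3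

/-- The radial power map `x ↦ |x| ^ (s - 1) x`. -/
noncomputable def radialPow {d : ℕ} (s : ℝ) (x : EuclideanSpace ℝ (Fin d)) :
    EuclideanSpace ℝ (Fin d) := ‖x‖ ^ (s - 1) • x

/-- The derivative of `radialPow s` away from the origin. -/
noncomputable def radialPowDeriv {d : ℕ} (s : ℝ) (x : EuclideanSpace ℝ (Fin d)) :
    EuclideanSpace ℝ (Fin d) →L[ℝ] EuclideanSpace ℝ (Fin d) :=
  ‖x‖ ^ (s - 1) • (ContinuousLinearMap.id ℝ _ +
    (((s - 1) / ‖x‖ ^ 2) • innerSL ℝ x).smulRight x)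

theorem radialPow_ne_zero {d : ℕ} (s : ℝ) {x : EuclideanSpace ℝ (Fin d)} (hx : x ≠ 0) :
    radialPow s x ≠ 0 :=
  smul_ne_zero (Real.rpow_pos_of_pos (norm_pos_iff.2 hx) _).ne' hx

theorem norm_radialPow {d : ℕ} (s : ℝ) {x : EuclideanSpace ℝ (Fin d)} (hx : x ≠ 0) :
    ‖radialPow s x‖ = ‖x‖ ^ s := by
  have hr : 0 < ‖x‖ := norm_pos_iff.2 hx
  rw [radialPow, norm_smul, Real.norm_of_nonneg (Real.rpow_nonneg hr.le _),
    Real.rpow_sub_one hr.ne', div_mul_cancel₀ _ hr.ne']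

theorem radialPow_radialPow {d : ℕ} {s t : ℝ} (hst : s * t = 1) {x : EuclideanSpace ℝ (Fin d)}
    (hx : x ≠ 0) : radialPow s (radialPow t x) = x := by
  have hr : 0 < ‖x‖ := norm_pos_iff.2 hx
  rw [radialPow, norm_radialPow t hx, radialPow, smul_smul, ← Real.rpow_mul hr.le,
    ← Real.rpow_add hr]
  have : t * (s - 1) + (t - 1) = 0 := by linear_combination hst
  rw [this, Real.rpow_zero, one_smul]

theorem hasFDerivAt_norm_rpow_euclidean {d : ℕ} (s : ℝ) {x : EuclideanSpace ℝ (Fin d)}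
    (hx : x ≠ 0) : HasFDerivAt (fun y : EuclideanSpace ℝ (Fin d) => ‖y‖ ^ s)
      ((‖x‖ ^ s * (s / ‖x‖ ^ 2)) • innerSL ℝ x) x := by
  have hr : 0 < ‖x‖ := norm_pos_iff.2 hx
  refine ((hasFDerivAt_norm_euclidean hx).rpow_const (.inl hr.ne')).congr_fderiv ?_
  rw [smul_smul, Real.rpow_sub_one hr.ne']
  congr 1
  field_simp

theorem hasFDerivAt_radialPow {d : ℕ} (s : ℝ) {x : EuclideanSpace ℝ (Fin d)} (hx : x ≠ 0) :
    HasFDerivAt (radialPow s) (radialPowDeriv s x) x := by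
  refine ((hasFDerivAt_norm_rpow_euclidean (s - 1) hx).smul (hasFDerivAt_id x)).congr_fderiv ?_
  ext v : 1
  simp [radialPowDeriv, smul_smul, mul_assoc]

theorem det_radialPowDeriv {d : ℕ} (s : ℝ) {x : EuclideanSpace ℝ (Fin d)} (hx : x ≠ 0) :
    (radialPowDeriv s x).det = s * ‖x‖ ^ (d * (s - 1)) := by
  have hr : 0 < ‖x‖ := norm_pos_iff.2 hx
  have e : ((radialPowDeriv s x : EuclideanSpace ℝ (Fin d) →L[ℝ] EuclideanSpace ℝ (Fin d)) :
      EuclideanSpace ℝ (Fin d) →ₗ[ℝ] EuclideanSpace ℝ (Fin d)) = ‖x‖ ^ (s - 1) •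
        LinearMap.transvection (((s - 1) / ‖x‖ ^ 2) • (innerSL ℝ x).toLinearMap) x := by
    ext v : 1
    simp [radialPowDeriv, LinearMap.transvection.apply]
  rw [ContinuousLinearMap.det, e, LinearMap.det_smul, LinearMap.transvection.det,
    finrank_euclideanSpace_fin, ← Real.rpow_mul_natCast hr.le]
  have : 1 + (((s - 1) / ‖x‖ ^ 2) • (innerSL ℝ x).toLinearMap) x = s := by
    simp
    field_simp
    ring
  rw [this, mul_comm (s - 1) (d : ℝ), mul_comm]

/-- Change of variables along `radialPow s`. -/
theorem integral_comp_radialPow {d : ℕ} (hd : 0 < d) {s : ℝ} (hs : 0 < s)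
    (H : EuclideanSpace ℝ (Fin d) → ℝ) :
    ∫ x, s * ‖x‖ ^ (d * (s - 1)) * H (radialPow s x) = ∫ y, H y := by
  have : Nonempty (Fin d) := ⟨⟨0, hd⟩⟩
  have himg : radialPow s '' {(0 : EuclideanSpace ℝ (Fin d))}ᶜ = {0}ᶜ := by
    ext y
    constructor
    · rintro ⟨x, hx, rfl⟩
      exact radialPow_ne_zero s hx
    · exact fun hy => ⟨radialPow s⁻¹ y, radialPow_ne_zero _ hy,
        radialPow_radialPow (mul_inv_cancel₀ hs.ne') hy⟩
  have hinj : Set.InjOn (radialPow s) {(0 : EuclideanSpace ℝ (Fin d))}ᶜ := fun x hx y hy hxy => by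
    rw [← radialPow_radialPow (inv_mul_cancel₀ hs.ne') hx, hxy,
      radialPow_radialPow (inv_mul_cancel₀ hs.ne') hy]
  have h := integral_image_eq_integral_abs_det_fderiv_smul volume
    (measurableSet_singleton (0 : EuclideanSpace ℝ (Fin d))).compl
    (fun x hx => (hasFDerivAt_radialPow s hx).hasFDerivWithinAt) hinj H
  rw [himg, restrict_compl_singleton] at h
  rw [h]
  refine integral_congr_ae ?_
  filter_upwards [ae_ne_zero_euclidean hd] with x hx
  rw [det_radialPowDeriv s hx, abs_of_nonneg (by positivity), smul_eq_mul]

theorem contDiffAt_norm_rpow {d : ℕ} (s : ℝ) {x : EuclideanSpace ℝ (Fin d)} (hx : x ≠ 0)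
    {n : WithTop ℕ∞} : ContDiffAt ℝ n (fun y : EuclideanSpace ℝ (Fin d) => ‖y‖ ^ s) x :=
  (contDiffAt_norm ℝ hx).rpow_const_of_ne (norm_ne_zero_iff.2 hx)

theorem contDiffAt_radialPow {d : ℕ} (s : ℝ) {x : EuclideanSpace ℝ (Fin d)} (hx : x ≠ 0)
    {n : WithTop ℕ∞} : ContDiffAt ℝ n (radialPow s) x :=
  (contDiffAt_norm_rpow (s - 1) hx).smul contDiffAt_id

theorem contDiff_of_eventuallyEq_zero {V F : Type*} [NormedAddCommGroup V] [NormedSpace ℝ V]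
    [NormedAddCommGroup F] [NormedSpace ℝ F] {n : WithTop ℕ∞} {k : V → F}
    (h0 : k =ᶠ[nhds 0] 0) (hk : ∀ x, x ≠ 0 → ContDiffAt ℝ n k x) : ContDiff ℝ n k := by
  refine contDiff_iff_contDiffAt.2 fun x => ?_
  rcases eq_or_ne x 0 with rfl | hx
  · exact (contDiffAt_const (c := (0 : F))).congr_of_eventuallyEq h0
  · exact hk x hx

/-- The gradient of `g ∘ radialPow s` for `s ≤ 1` is bounded below by that of `g`. -/
theorem sum_norm_comp_radialPowDeriv_sq_ge {d : ℕ} {s : ℝ} (hs : 0 ≤ s) (hs1 : s ≤ 1)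
    {x : EuclideanSpace ℝ (Fin d)} (hx : x ≠ 0) (l : EuclideanSpace ℝ (Fin d) →L[ℝ] ℂ) :
    ‖x‖ ^ (2 * (s - 1)) * (s ^ 2 * ∑ i, ‖l (EuclideanSpace.single i 1)‖ ^ 2) ≤
      ∑ i, ‖l (radialPowDeriv s x (EuclideanSpace.single i 1))‖ ^ 2 := by
  have hr : 0 < ‖x‖ := norm_pos_iff.2 hx
  have hlx : l x = ∑ i, x i • l (EuclideanSpace.single i 1) := by
    conv_lhs => rw [← (EuclideanSpace.basisFun (Fin d) ℝ).sum_repr x]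
    simp
  have hcs : ‖l x‖ ^ 2 ≤ ‖x‖ ^ 2 * ∑ i, ‖l (EuclideanSpace.single i 1)‖ ^ 2 := by
    have h1 : ‖l x‖ ≤ ∑ i, |x i| * ‖l (EuclideanSpace.single i 1)‖ := by
      rw [hlx]
      refine (norm_sum_le _ _).trans (le_of_eq (Finset.sum_congr rfl fun i _ => ?_))
      rw [norm_smul, Real.norm_eq_abs]
    calc ‖l x‖ ^ 2 ≤ (∑ i, |x i| * ‖l (EuclideanSpace.single i 1)‖) ^ 2 :=
          pow_le_pow_left₀ (norm_nonneg _) h1 2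
      _ ≤ (∑ i, |x i| ^ 2) * ∑ i, ‖l (EuclideanSpace.single i 1)‖ ^ 2 :=
          Finset.sum_mul_sq_le_sq_mul_sq _ _ _
      _ = _ := by simp only [sq_abs, sum_sq_euclidean]
  have hexp : ∀ i, ‖l (radialPowDeriv s x (EuclideanSpace.single i 1))‖ ^ 2
      = ‖x‖ ^ (2 * (s - 1)) * (‖l (EuclideanSpace.single i 1)‖ ^ 2
        + 2 * ((s - 1) / ‖x‖ ^ 2) * inner ℝ (x i • l (EuclideanSpace.single i 1)) (l x)
        + ((s - 1) / ‖x‖ ^ 2) ^ 2 * ‖l x‖ ^ 2 * x i ^ 2) := fun i => by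
    have e : l (radialPowDeriv s x (EuclideanSpace.single i 1)) = ‖x‖ ^ (s - 1) •
        (l (EuclideanSpace.single i 1) + ((s - 1) / ‖x‖ ^ 2 * x i) • l x) := by
      simp [radialPowDeriv, EuclideanSpace.inner_single_right]
    rw [e, norm_smul, mul_pow, norm_add_sq_real, norm_smul, inner_smul_right, real_inner_smul_left,
      rpow_two_mul_eq_sq _ hr.le, Real.norm_eq_abs, Real.norm_eq_abs, sq_abs, mul_pow, sq_abs]
    ring
  simp only [hexp]
  rw [← Finset.mul_sum, Finset.sum_add_distrib, Finset.sum_add_distrib, ← Finset.mul_sum,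
    ← Finset.mul_sum, sum_sq_euclidean, ← sum_inner, ← hlx, real_inner_self_eq_norm_sq]
  refine mul_le_mul_of_nonneg_left ?_ (Real.rpow_nonneg hr.le _)
  set T := ∑ i, ‖l (EuclideanSpace.single i 1)‖ ^ 2
  have e : T + 2 * ((s - 1) / ‖x‖ ^ 2) * ‖l x‖ ^ 2
      + ((s - 1) / ‖x‖ ^ 2) ^ 2 * ‖l x‖ ^ 2 * ‖x‖ ^ 2
      = T - (1 - s ^ 2) * (‖l x‖ ^ 2 / ‖x‖ ^ 2) := by
    field_simp
    ring
  rw [e]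
  have h2 : ‖l x‖ ^ 2 / ‖x‖ ^ 2 ≤ T := by
    rw [div_le_iff₀ (by positivity)]; linarith
  nlinarith [mul_le_mul_of_nonneg_left h2 (show 0 ≤ 1 - s ^ 2 by nlinarith)]

theorem integral_fderiv_apply_eq_zero_s8 {d : ℕ} {u : EuclideanSpace ℝ (Fin d) → ℝ}
    (hu : ContDiff ℝ 1 u) (hsupp : HasCompactSupport u) (v : EuclideanSpace ℝ (Fin d)) :
    ∫ x, fderiv ℝ u x v = 0 := by
  have hi : Integrable fun x => fderiv ℝ u x v :=
    ((hu.continuous_fderiv one_ne_zero).clm_apply continuous_const).integrable_of_hasCompactSupport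
      (hsupp.fderiv_apply ℝ v)
  have h := integral_mul_fderiv_eq_neg_fderiv_mul_of_integrable (μ := volume) (𝕜 := ℝ)
    (f := fun _ => (1 : ℝ)) (g := u) (v := v) (by simp) (by simpa using hi)
    (by simpa using hu.continuous.integrable_of_hasCompactSupport hsupp)
    (fun x _ => differentiableAt_const 1) fun x _ => hu.differentiable one_ne_zero x
  simpa using h

/-- The ground state representation of the quadratic form `∫ |∇f|² + a |x|⁻² |f|²`. -/
theorem quadraticForm_eq_integral_sq {d : ℕ} {a γ : ℝ}
    (ha : a = γ ^ 2 + γ * ((d : ℝ) - 2)) {f : EuclideanSpace ℝ (Fin d) → ℂ}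
    (hf : ContDiff ℝ 1 f) (hsupp : HasCompactSupport f) (h0 : f =ᶠ[nhds 0] 0) :
    Integrable (fun x => ∑ i, ‖fderiv ℝ f x (EuclideanSpace.single i 1)
        - (γ * (x i / ‖x‖ ^ 2)) • f x‖ ^ 2) ∧
    ∫ x : EuclideanSpace ℝ (Fin d), ((∑ i, ‖fderiv ℝ f x (EuclideanSpace.single i 1)‖ ^ 2)
        + a / ‖x‖ ^ 2 * ‖f x‖ ^ 2)
      = ∫ x, ∑ i, ‖fderiv ℝ f x (EuclideanSpace.single i 1)
        - (γ * (x i / ‖x‖ ^ 2)) • f x‖ ^ 2 := by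
  have hV : ∀ (i : Fin d) (x : EuclideanSpace ℝ (Fin d)), x ≠ 0 →
      ContDiffAt ℝ 1 (fun y : EuclideanSpace ℝ (Fin d) => y i / ‖y‖ ^ 2) x := fun i x hx => by
    refine ContDiffAt.div ?_ (contDiff_norm_sq ℝ).contDiffAt
      (pow_ne_zero 2 (norm_ne_zero_iff.2 hx))
    exact (EuclideanSpace.proj (𝕜 := ℝ) i).contDiff.contDiffAt
  have cF : ∀ i, Continuous fun x => (γ * (x i / ‖x‖ ^ 2)) • f x := fun i => by
    refine ContDiff.continuous (𝕜 := ℝ) (n := 1) (contDiff_of_eventuallyEq_zero ?_ fun x hx => ?_)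
    · filter_upwards [h0] with x hx
      simp [hx]
    · exact (contDiffAt_const.mul (hV i x hx)).smul hf.contDiffAt
  have cD : ∀ i, Continuous fun x => fderiv ℝ f x (EuclideanSpace.single i 1) := fun i =>
    (hf.continuous_fderiv one_ne_zero).clm_apply continuous_const
  have hQint : Integrable (fun x => ∑ i, ‖fderiv ℝ f x (EuclideanSpace.single i 1)
        - (γ * (x i / ‖x‖ ^ 2)) • f x‖ ^ 2) := by
    refine Continuous.integrable_of_hasCompactSupport
      (continuous_finsetSum _ fun i _ => ((cD i).sub (cF i)).norm.pow 2)
      (HasCompactSupport.intro hsupp fun x hx => Finset.sum_eq_zero fun i _ => ?_)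
    rw [fderiv_of_notMem_tsupport ℝ hx, image_eq_zero_of_notMem_tsupport hx]
    simp
  refine ⟨hQint, ?_⟩
  let P : Fin d → EuclideanSpace ℝ (Fin d) → ℝ := fun i x => x i / ‖x‖ ^ 2 * ‖f x‖ ^ 2
  have cP : ∀ i, ContDiff ℝ 1 (P i) := fun i => by
    refine contDiff_of_eventuallyEq_zero ?_ fun x hx => (hV i x hx).mul (hf.contDiffAt.norm_sq ℝ)
    filter_upwards [h0] with x hx
    simp [P, hx]
  have sP : ∀ i, HasCompactSupport (P i) := fun i =>
    HasCompactSupport.intro hsupp fun x hx => by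
      simp [P, image_eq_zero_of_notMem_tsupport hx]
  have iP : ∀ i, Integrable fun x => fderiv ℝ (P i) x (EuclideanSpace.single i 1) := fun i =>
    (((cP i).continuous_fderiv one_ne_zero).clm_apply
      continuous_const).integrable_of_hasCompactSupport ((sP i).fderiv_apply ℝ _)
  have dP : ∀ (i : Fin d) (x : EuclideanSpace ℝ (Fin d)), x ≠ 0 →
      fderiv ℝ (P i) x (EuclideanSpace.single i 1)
        = (1 / ‖x‖ ^ 2 - 2 * x i ^ 2 / ‖x‖ ^ 4) * ‖f x‖ ^ 2 + 2 * (x i / ‖x‖ ^ 2) *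
          inner ℝ (fderiv ℝ f x (EuclideanSpace.single i 1)) (f x) := fun i x hx => by
    have hr : ‖x‖ ≠ 0 := norm_ne_zero_iff.2 hx
    have h1 : HasFDerivAt (fun y : EuclideanSpace ℝ (Fin d) => y i)
        (EuclideanSpace.proj (𝕜 := ℝ) i) x := (EuclideanSpace.proj (𝕜 := ℝ) i).hasFDerivAt
    have h2 : HasFDerivAt (fun y : EuclideanSpace ℝ (Fin d) => (‖y‖ ^ 2)⁻¹) _ x :=
      (hasDerivAt_inv (pow_ne_zero 2 hr)).comp_hasFDerivAt x
        (hasStrictFDerivAt_norm_sq x).hasFDerivAt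
    have h3 := ((hf.differentiable one_ne_zero x).hasFDerivAt).norm_sq
    have h4 : HasFDerivAt (P i) _ x := (h1.mul h2).mul h3
    rw [h4.fderiv, real_inner_comm]
    simp [EuclideanSpace.inner_single_right]
    field_simp
    ring
  have hpt : ∀ x, (∑ i, ‖fderiv ℝ f x (EuclideanSpace.single i 1)‖ ^ 2)
        + a / ‖x‖ ^ 2 * ‖f x‖ ^ 2
      = (∑ i, ‖fderiv ℝ f x (EuclideanSpace.single i 1) - (γ * (x i / ‖x‖ ^ 2)) • f x‖ ^ 2)
        + γ * ∑ i, fderiv ℝ (P i) x (EuclideanSpace.single i 1) := fun x => by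
    rcases eq_or_ne x 0 with rfl | hx
    · have hP : ∀ i, P i =ᶠ[nhds 0] 0 := fun i => by
        filter_upwards [h0] with x hx
        simp [P, hx]
      simp [(hP _).fderiv_eq, h0.eq_of_nhds]
    · have hr : ‖x‖ ≠ 0 := norm_ne_zero_iff.2 hx
      simp only [dP _ x hx, norm_sub_sq_real, norm_smul, real_inner_smul_right, mul_pow,
        Real.norm_eq_abs, sq_abs]
      have e : ∀ i, ‖fderiv ℝ f x (EuclideanSpace.single i 1)‖ ^ 2
          = (‖fderiv ℝ f x (EuclideanSpace.single i 1)‖ ^ 2 - 2 * (γ * (x i / ‖x‖ ^ 2) *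
            inner ℝ (fderiv ℝ f x (EuclideanSpace.single i 1)) (f x))
            + γ ^ 2 * (x i / ‖x‖ ^ 2) ^ 2 * ‖f x‖ ^ 2)
          + γ * ((1 / ‖x‖ ^ 2 - 2 * x i ^ 2 / ‖x‖ ^ 4) * ‖f x‖ ^ 2 + 2 * (x i / ‖x‖ ^ 2) *
            inner ℝ (fderiv ℝ f x (EuclideanSpace.single i 1)) (f x))
          - γ / ‖x‖ ^ 2 * ‖f x‖ ^ 2 - (γ ^ 2 - 2 * γ) / ‖x‖ ^ 4 * ‖f x‖ ^ 2 * x i ^ 2 := fun i => by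
        field_simp
        ring
      conv_lhs => rw [Finset.sum_congr rfl fun i _ => e i]
      rw [Finset.sum_sub_distrib, Finset.sum_sub_distrib, Finset.sum_add_distrib,
        ← Finset.mul_sum, ← Finset.mul_sum, ← Finset.mul_sum, sum_sq_euclidean, Finset.sum_const,
        Finset.card_univ, Fintype.card_fin, nsmul_eq_mul, ha]
      have e2 : γ / ‖x‖ ^ 2 * (d * ‖f x‖ ^ 2) + (γ ^ 2 - 2 * γ) / ‖x‖ ^ 4 * ‖f x‖ ^ 2 * ‖x‖ ^ 2
          = (γ ^ 2 + γ * ((d : ℝ) - 2)) / ‖x‖ ^ 2 * ‖f x‖ ^ 2 := by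
        field_simp
        ring
      linear_combination -e2
  simp only [hpt]
  rw [integral_add hQint ((integrable_finsetSum _ fun i _ => iP i).const_mul γ), integral_const_mul,
    integral_finsetSum _ fun i _ => iP i,
    Finset.sum_eq_zero fun i _ => integral_fderiv_apply_eq_zero_s8 (cP i) (sP i) _, mul_zero, add_zero]

theorem tendsto_radialPow_zero {d : ℕ} {s : ℝ} (hs : 0 < s) :
    Filter.Tendsto (radialPow s) (nhds (0 : EuclideanSpace ℝ (Fin d))) (nhds 0) := by
  rw [tendsto_zero_iff_norm_tendsto_zero]
  have h1 : Filter.Tendsto (fun x : EuclideanSpace ℝ (Fin d) => ‖x‖ ^ s) (nhds 0) (nhds 0) := by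
    have := (continuous_norm.rpow_const fun _ => .inr hs.le).tendsto (0 : EuclideanSpace ℝ (Fin d))
    rwa [norm_zero, Real.zero_rpow hs.ne'] at this
  refine h1.congr fun x => ?_
  rcases eq_or_ne x 0 with rfl | hx
  · simp [radialPow, Real.zero_rpow (ne_of_gt hs)]
  · exact (norm_radialPow s hx).symm

/-- A test function supported away from the origin, written in the coordinates
`y = radialPow β x` and divided by the power `|x| ^ γ`. -/
theorem exists_eq_norm_rpow_smul_comp_radialPow {d : ℕ} {β : ℝ} (hβ : 0 < β) (γ : ℝ)
    {f : EuclideanSpace ℝ (Fin d) → ℂ} (hf : ContDiff ℝ 1 f) (hsupp : HasCompactSupport f)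
    (h0 : f =ᶠ[nhds 0] 0) :
    ∃ g : EuclideanSpace ℝ (Fin d) → ℂ, ContDiff ℝ 1 g ∧ HasCompactSupport g ∧
      ∀ x, x ≠ 0 → f x = ‖x‖ ^ γ • g (radialPow β x) := by
  have hβ' : 0 < β⁻¹ := inv_pos.2 hβ
  refine ⟨fun y => ‖y‖ ^ (-(γ / β)) • f (radialPow β⁻¹ y), ?_, ?_, ?_⟩
  · refine contDiff_of_eventuallyEq_zero ?_ fun y hy => ?_
    · filter_upwards [(tendsto_radialPow_zero hβ').eventually h0] with y hy
      simp [hy]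
    · exact (contDiffAt_norm_rpow _ hy).smul (hf.contDiffAt.comp y (contDiffAt_radialPow _ hy))
  · obtain ⟨R, hR0, hR⟩ := hsupp.isCompact.isBounded.exists_pos_norm_lt
    refine HasCompactSupport.intro
      (isCompact_closedBall (0 : EuclideanSpace ℝ (Fin d)) (R ^ β)) fun y hy => ?_
    rw [mem_closedBall_zero_iff, not_le] at hy
    have hy0 : y ≠ 0 := norm_pos_iff.1 ((Real.rpow_pos_of_pos hR0 β).trans hy)
    have h1 : R < ‖radialPow β⁻¹ y‖ := by
      rw [norm_radialPow _ hy0]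
      exact (Real.lt_rpow_inv_iff_of_pos hR0.le (norm_nonneg y) hβ).2 hy
    have h2 : f (radialPow β⁻¹ y) = 0 :=
      image_eq_zero_of_notMem_tsupport fun h => (hR _ h).not_gt h1
    simp only [h2, smul_zero]
  · intro x hx
    have hr : 0 < ‖x‖ := norm_pos_iff.2 hx
    simp only
    rw [radialPow_radialPow (inv_mul_cancel₀ hβ.ne') hx, norm_radialPow β hx, smul_smul,
      ← Real.rpow_mul hr.le, ← Real.rpow_add hr]
    have : γ + β * -(γ / β) = 0 := by field_simp; ring
    rw [this, Real.rpow_zero, one_smul]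

/-- The Dirichlet integral of `g` is controlled by the quadratic form of
`|x| ^ γ g (radialPow β x)`, where `γ = (β - 1) (d - 2) / 2`. -/
theorem mul_dirichlet_le_quadraticForm {d : ℕ} (hd : 0 < d) {a β γ : ℝ} (hβ : 0 < β) (hβ1 : β ≤ 1)
    (hγ : γ = (β - 1) * (((d : ℝ) - 2) / 2))
    (ha : a = (((d : ℝ) - 2) / 2) ^ 2 * (β ^ 2 - 1)) {f g : EuclideanSpace ℝ (Fin d) → ℂ}
    (hf : ContDiff ℝ 1 f) (hsupp : HasCompactSupport f) (h0 : f =ᶠ[nhds 0] 0)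
    (hg : ContDiff ℝ 1 g) (hfg : ∀ x, x ≠ 0 → f x = ‖x‖ ^ γ • g (radialPow β x)) :
    β * ∫ x, ∑ i, ‖fderiv ℝ g x (EuclideanSpace.single i 1)‖ ^ 2 ≤
      ∫ x : EuclideanSpace ℝ (Fin d), ((∑ i, ‖fderiv ℝ f x (EuclideanSpace.single i 1)‖ ^ 2)
        + a / ‖x‖ ^ 2 * ‖f x‖ ^ 2) := by
  obtain ⟨hQint, heq⟩ := quadraticForm_eq_integral_sq (a := a) (γ := γ)
    (by rw [ha, hγ]; ring) hf hsupp h0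
  rw [heq, ← integral_comp_radialPow hd hβ, ← integral_const_mul]
  refine integral_mono_of_nonneg (.of_forall fun x => ?_) hQint ?_
  · have : 0 ≤ ∑ i, ‖fderiv ℝ g (radialPow β x) (EuclideanSpace.single i 1)‖ ^ 2 :=
      Finset.sum_nonneg fun i _ => sq_nonneg _
    simp only [Pi.zero_apply]
    positivity
  filter_upwards [ae_ne_zero_euclidean hd] with x hx
  have hr : 0 < ‖x‖ := norm_pos_iff.2 hx
  have hder : HasFDerivAt f _ x :=
    ((hasFDerivAt_norm_rpow_euclidean γ hx).smul
      (((hg.differentiable one_ne_zero (radialPow β x)).hasFDerivAt).comp x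
        (hasFDerivAt_radialPow β hx))).congr_of_eventuallyEq (by
          filter_upwards [isOpen_ne.mem_nhds hx] with y hy using hfg y hy)
  have e : ∀ i, ‖fderiv ℝ f x (EuclideanSpace.single i 1) - (γ * (x i / ‖x‖ ^ 2)) • f x‖ ^ 2
      = ‖x‖ ^ (2 * γ) * ‖fderiv ℝ g (radialPow β x)
        (radialPowDeriv β x (EuclideanSpace.single i 1))‖ ^ 2 := fun i => by
    have h1 : fderiv ℝ f x (EuclideanSpace.single i 1) - (γ * (x i / ‖x‖ ^ 2)) • f x
        = ‖x‖ ^ γ • fderiv ℝ g (radialPow β x)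
          (radialPowDeriv β x (EuclideanSpace.single i 1)) := by
      rw [hder.fderiv, hfg x hx, smul_smul]
      simp [EuclideanSpace.inner_single_right]
      ring
    rw [h1, norm_smul, mul_pow, Real.norm_eq_abs, sq_abs, rpow_two_mul_eq_sq γ hr.le]
  simp only [e]
  rw [← Finset.mul_sum]
  refine le_trans (le_of_eq ?_) (mul_le_mul_of_nonneg_left
    (sum_norm_comp_radialPowDeriv_sq_ge hβ.le hβ1 hx (fderiv ℝ g (radialPow β x)))
    (Real.rpow_nonneg hr.le (2 * γ)))
  rw [← mul_assoc (‖x‖ ^ (2 * γ)), ← Real.rpow_add hr,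
    show 2 * γ + 2 * (β - 1) = d * (β - 1) by rw [hγ]; ring]
  ring

/-- The Lebesgue norm of `|x| ^ γ g (radialPow β x)`, where `γ = (β - 1) (d - 2) / 2`. -/
theorem integral_norm_rpow_eq_inv_mul {d : ℕ} (hd : 3 ≤ d) {β γ : ℝ} (hβ : 0 < β)
    (hγ : γ = (β - 1) * (((d : ℝ) - 2) / 2)) {f g : EuclideanSpace ℝ (Fin d) → ℂ}
    (hfg : ∀ x, x ≠ 0 → f x = ‖x‖ ^ γ • g (radialPow β x)) :
    ∫ x, ‖f x‖ ^ (2 * (d : ℝ) / ((d : ℝ) - 2))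
      = β⁻¹ * ∫ x, ‖g x‖ ^ (2 * (d : ℝ) / ((d : ℝ) - 2)) := by
  have hd' : (3 : ℝ) ≤ d := by exact_mod_cast hd
  have hk : (d : ℝ) - 2 ≠ 0 := by linarith
  have hd0 : 0 < d := by omega
  rw [← integral_comp_radialPow hd0 hβ fun x => ‖g x‖ ^ (2 * (d : ℝ) / ((d : ℝ) - 2)),
    ← integral_const_mul]
  refine integral_congr_ae ?_
  filter_upwards [ae_ne_zero_euclidean hd0] with x hx
  have hr : 0 < ‖x‖ := norm_pos_iff.2 hx
  rw [hfg x hx, norm_smul, Real.norm_of_nonneg (Real.rpow_nonneg hr.le _),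
    Real.mul_rpow (Real.rpow_nonneg hr.le _) (norm_nonneg _), ← Real.rpow_mul hr.le,
    show γ * (2 * (d : ℝ) / ((d : ℝ) - 2)) = d * (β - 1) by rw [hγ]; field_simp]
  field_simp

/-- Sharp Sobolev embedding with inverse-square potential for
`-((d-2)/2)² < a < 0`:
`‖f‖_{L^{2d/(d-2)}} ≤ ‖W_a‖_{L^{2d/(d-2)}} Q_a(W_a)^{-1/2} Q_a(f)^{1/2}`. -/
theorem sharp_sobolev_negative_coupling
    (d : ℕ) (hd : 3 ≤ d) (a : ℝ)
    (ha : -(((d : ℝ) - 2) / 2) ^ 2 < a) (ha' : a < 0)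
    (β : ℝ) (hβ : β = Real.sqrt (1 + 4 * a / ((d : ℝ) - 2) ^ 2))
    (W : EuclideanSpace ℝ (Fin d) → ℝ)
    (hW : ∀ x, W x = ((d : ℝ) * ((d : ℝ) - 2) * β ^ 2) ^ (((d : ℝ) - 2) / 4) *
        (‖x‖ ^ (β - 1) / (1 + ‖x‖ ^ (2 * β))) ^ (((d : ℝ) - 2) / 2))
    (f : EuclideanSpace ℝ (Fin d) → ℂ)
    (hf : ContDiff ℝ (⊤ : ℕ∞) f) (hsupp : HasCompactSupport f)
    (h0 : (0 : EuclideanSpace ℝ (Fin d)) ∉ tsupport f) :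
    (∫ x : EuclideanSpace ℝ (Fin d), ‖f x‖ ^ (2 * (d : ℝ) / ((d : ℝ) - 2)))
        ^ (((d : ℝ) - 2) / (2 * (d : ℝ)))
      ≤ (∫ x : EuclideanSpace ℝ (Fin d), W x ^ (2 * (d : ℝ) / ((d : ℝ) - 2)))
          ^ (((d : ℝ) - 2) / (2 * (d : ℝ)))
        * (Real.sqrt (∫ x : EuclideanSpace ℝ (Fin d),
            ((∑ i, (fderiv ℝ W x (EuclideanSpace.single i 1)) ^ 2)
              + a / ‖x‖ ^ 2 * (W x) ^ 2)))⁻¹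
        * Real.sqrt (∫ x : EuclideanSpace ℝ (Fin d),
            ((∑ i, ‖fderiv ℝ f x (EuclideanSpace.single i 1)‖ ^ 2)
              + a / ‖x‖ ^ 2 * ‖f x‖ ^ 2)) := by
  have hd' : (3 : ℝ) ≤ d := by exact_mod_cast hd
  have hd0 : 0 < d := by omega
  have hk : 0 < (d : ℝ) - 2 := by linarith
  have hrad : 0 < 1 + 4 * a / ((d : ℝ) - 2) ^ 2 := by
    have : -1 < 4 * a / ((d : ℝ) - 2) ^ 2 := by
      rw [lt_div_iff₀ (by positivity)]
      linarith
    linarith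
  have hβ0 : 0 < β := hβ ▸ Real.sqrt_pos.2 hrad
  have hβsq : β ^ 2 = 1 + 4 * a / ((d : ℝ) - 2) ^ 2 := by rw [hβ, Real.sq_sqrt hrad.le]
  have haβ : a = (((d : ℝ) - 2) / 2) ^ 2 * (β ^ 2 - 1) := by
    rw [hβsq]
    field_simp
    ring
  have hβ1 : β ≤ 1 := by
    have : 4 * a / ((d : ℝ) - 2) ^ 2 ≤ 0 := div_nonpos_of_nonpos_of_nonneg (by linarith)
      (sq_nonneg _)
    nlinarith
  have hf1 : ContDiff ℝ 1 f := hf.of_le (by exact_mod_cast le_top)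
  have hf0 : f =ᶠ[nhds 0] 0 := notMem_tsupport_iff_eventuallyEq.1 h0
  obtain ⟨g, hg, hgs, hfg⟩ := exists_eq_norm_rpow_smul_comp_radialPow hβ0
    ((β - 1) * (((d : ℝ) - 2) / 2)) hf1 hsupp hf0
  have hQ := mul_dirichlet_le_quadraticForm hd0 hβ0 hβ1 rfl haβ hf1 hsupp hf0 hg hfg
  have hS := sharp_sobolev_euclidean hd hg hgs
  have hK := bubbleMass_pos hd0
  have hN0 : 0 ≤ ∫ x, ‖g x‖ ^ (2 * (d : ℝ) / ((d : ℝ) - 2)) :=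
    integral_nonneg fun x => Real.rpow_nonneg (norm_nonneg (g x)) _
  rw [integral_norm_rpow_eq_inv_mul hd hβ0 rfl hfg, integral_soliton_rpow hd hβ0 hW,
    quadraticForm_soliton hd hβ0 haβ hW]
  set N := ∫ x, ‖g x‖ ^ (2 * (d : ℝ) / ((d : ℝ) - 2))
  set D := ∫ x, ∑ i, ‖fderiv ℝ g x (EuclideanSpace.single i 1)‖ ^ 2
  set Q := ∫ x : EuclideanSpace ℝ (Fin d),
    ((∑ i, ‖fderiv ℝ f x (EuclideanSpace.single i 1)‖ ^ 2) + a / ‖x‖ ^ 2 * ‖f x‖ ^ 2)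
  set K := bubbleMass d
  have hX : 0 < (d : ℝ) * ((d : ℝ) - 2) := by positivity
  have hθ : ((d : ℝ) - 2) / (2 * d) = 1 / 2 - 1 / d := by field_simp
  have hM : 0 < ((d : ℝ) * ((d : ℝ) - 2) * β ^ 2) ^ ((d : ℝ) / 2) * β⁻¹ * K := by positivity
  have eM : (((d : ℝ) * ((d : ℝ) - 2) * β ^ 2) ^ ((d : ℝ) / 2) * β⁻¹ * K)
        ^ (((d : ℝ) - 2) / (2 * d)) *
      (√(((d : ℝ) * ((d : ℝ) - 2) * β ^ 2) ^ ((d : ℝ) / 2) * β⁻¹ * K))⁻¹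
      = (√((d : ℝ) * ((d : ℝ) - 2)))⁻¹ * β ^ (1 / (d : ℝ) - 1) * K ^ (-(1 / (d : ℝ))) := by
    rw [Real.sqrt_eq_rpow, ← Real.rpow_neg hM.le, ← Real.rpow_add hM, hθ,
      show 1 / 2 - 1 / (d : ℝ) + -(1 / 2) = -(1 / d) by ring,
      Real.mul_rpow (by positivity) hK.le, Real.mul_rpow (by positivity) (by positivity),
      ← Real.rpow_mul (by positivity), show (d : ℝ) / 2 * -(1 / d) = -(1 / 2) by field_simp,
      Real.rpow_neg (by positivity), ← Real.sqrt_eq_rpow, Real.sqrt_mul hX.le,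
      Real.sqrt_sq hβ0.le, Real.inv_rpow hβ0.le, Real.rpow_neg hβ0.le, inv_inv,
      Real.rpow_sub_one hβ0.ne']
    field_simp
  have hDQ : √D ≤ β ^ (-(1 / 2 : ℝ)) * √Q := by
    rw [Real.rpow_neg hβ0.le, ← Real.sqrt_eq_rpow, le_inv_mul_iff₀ (Real.sqrt_pos.2 hβ0),
      ← Real.sqrt_mul hβ0.le]
    exact Real.sqrt_le_sqrt hQ
  have eβ : β⁻¹ ^ (((d : ℝ) - 2) / (2 * d)) * β ^ (-(1 / 2 : ℝ)) = β ^ (1 / (d : ℝ) - 1) := by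
    rw [Real.inv_rpow hβ0.le, ← Real.rpow_neg hβ0.le, ← Real.rpow_add hβ0, hθ]
    congr 1
    ring
  rw [eM, Real.mul_rpow (inv_nonneg.2 hβ0.le) hN0, ← eβ]
  calc β⁻¹ ^ (((d : ℝ) - 2) / (2 * d)) * N ^ (((d : ℝ) - 2) / (2 * d))
      ≤ β⁻¹ ^ (((d : ℝ) - 2) / (2 * d)) * (K ^ (-(1 / (d : ℝ))) *
          (√((d : ℝ) * ((d : ℝ) - 2)))⁻¹ * (β ^ (-(1 / 2 : ℝ)) * √Q)) :=
        mul_le_mul_of_nonneg_left (hS.trans (mul_le_mul_of_nonneg_left hDQ (by positivity)))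
          (by positivity)
    _ = _ := by ring
end
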